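/- Fix an integer r ≥ 3 and a real ε > 0. Let H^r_{n,p} be the random r-graph on [n] in which each r-subset of [n] is included as an edge independently with probability p. If p > (1+ε)·C(n−1,r−1)^{−1}·log n, then P(H^r_{n,p} contains a perfect matching) → 1 as n → ∞ through multiples of r: for every ρ > 0 there is n₀ such that for every n ≥ n₀ divisible by r and every such p ∈ [0,1], P(H^r_{n,p} contains a perfect matching) ≥ 1 − ρ. -/

import Mathlib

open Finset

/-- The set of perfect matchings of the `r`-graph `H` on vertex set `V`. -/
def pmSet (V : Finset ℕ) (H : Finset (Finset ℕ)) : Finset (Finset (Finset ℕ)) :=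
  H.powerset.filter (fun M => (∀ A ∈ M, ∀ B ∈ M, A ≠ B → A ∩ B = ∅) ∧ M.biUnion id = V)

/-- The number of perfect matchings of `H`. -/
def pmCount (V : Finset ℕ) (H : Finset (Finset ℕ)) : ℕ := (pmSet V H).card

/-- All `r`-element subsets of `[n]`. -/
def Kn (n r : ℕ) : Finset (Finset ℕ) := Finset.powersetCard r (Finset.range n)

section Entropy

/-- index sets `J ⊆ S` such that `(E j)_{j ∈ J}` is a perfect matching of `W` -/
def pmI {ι : Type*} [DecidableEq ι] (E : ι → Finset ℕ) (S : Finset ι) (W : Finset ℕ) :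
    Finset (Finset ι) :=
  S.powerset.filter (fun J => (∀ i ∈ J, ∀ j ∈ J, i ≠ j → Disjoint (E i) (E j)) ∧ J.biUnion E = W)

/-- indices in `S` whose edge meets another edge in at least two vertices -/
def excI {ι : Type*} [DecidableEq ι] (E : ι → Finset ℕ) (S : Finset ι) : Finset ι :=
  S.filter (fun i => ∃ j ∈ S, j ≠ i ∧ 2 ≤ (E i ∩ E j).card)

/-- random greedy weight of a matching -/
noncomputable def PsiW {ι : Type*} [DecidableEq ι] (w : ι → ℝ) (T : Finset ι → ℝ) :
    ℕ → Finset ι → ℝ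
  | 0, _ => 1
  | k + 1, J => ∑ j ∈ J, w j / T J * PsiW w T k (J.erase j)

/-- random deletion functional -/
noncomputable def muW {ι : Type*} [DecidableEq ι] (f : Finset ι → ℝ) : ℕ → Finset ι → ℝ
  | 0, _ => 0
  | k + 1, J => f J + (∑ j ∈ J, muW f k (J.erase j)) / (k + 1)

variable {ι : Type*} [DecidableEq ι]

lemma mem_pmI {E : ι → Finset ℕ} {S J : Finset ι} {W : Finset ℕ} :
    J ∈ pmI E S W ↔ J ⊆ S ∧ (∀ i ∈ J, ∀ j ∈ J, i ≠ j → Disjoint (E i) (E j)) ∧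
      J.biUnion E = W := by
  simp [pmI]

lemma pmI_card {E : ι → Finset ℕ} {r : ℕ} (hE : ∀ i, (E i).card = r) {S J : Finset ι}
    {W : Finset ℕ} (h : J ∈ pmI E S W) : W.card = r * J.card := by
  obtain ⟨_, h2, h3⟩ := mem_pmI.1 h
  rw [← h3, Finset.card_biUnion (fun i hi j hj hij => h2 i hi j hj hij)]
  simp [hE, mul_comm]

lemma avg_log_le {κ : Type*} (s : Finset κ) (hs : s.Nonempty) (a : κ → ℝ)
    (ha : ∀ i ∈ s, 0 < a i) :
    (∑ i ∈ s, Real.log (a i)) / s.card ≤ Real.log ((∑ i ∈ s, a i) / s.card) := by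
  have hc : (0 : ℝ) < s.card := by exact_mod_cast hs.card_pos
  have hA : 0 < ∑ i ∈ s, a i := Finset.sum_pos ha hs
  set A := (∑ i ∈ s, a i) / s.card with hAd
  have hA' : 0 < A := div_pos hA hc
  rw [div_le_iff₀ hc]
  have : ∀ i ∈ s, Real.log (a i) ≤ Real.log A + (a i / A - 1) := by
    intro i hi
    have h1 := Real.log_le_sub_one_of_pos (div_pos (ha i hi) hA')
    rw [Real.log_div (ha i hi).ne' hA'.ne'] at h1
    linarith
  refine (Finset.sum_le_sum this).trans ?_
  rw [Finset.sum_add_distrib, Finset.sum_sub_distrib, ← Finset.sum_div]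
  simp only [Finset.sum_const, nsmul_eq_mul, mul_one]
  have : (∑ i ∈ s, a i) / A = s.card := by
    rw [hAd]; field_simp
  rw [this]
  linarith

lemma pmI_erase {E : ι → Finset ℕ} {S J : Finset ι} {W : Finset ℕ} (h : J ∈ pmI E S W) {j : ι}
    (hj : j ∈ J) : J.erase j ∈ pmI E S (W \ E j) := by
  obtain ⟨h1, h2, h3⟩ := mem_pmI.1 h
  refine mem_pmI.2 ⟨(Finset.erase_subset _ _).trans h1, ?_, ?_⟩
  · intro i hi k hk hik
    exact h2 i (Finset.mem_of_mem_erase hi) k (Finset.mem_of_mem_erase hk) hik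
  · ext v
    rw [← h3]
    simp only [Finset.mem_biUnion, Finset.mem_erase, Finset.mem_sdiff]
    constructor
    · rintro ⟨i, ⟨hij, hi⟩, hv⟩
      exact ⟨⟨i, hi, hv⟩, fun hv' => Finset.disjoint_left.1 (h2 i hi j hj hij) hv hv'⟩
    · rintro ⟨⟨i, hi, hv⟩, hv'⟩
      exact ⟨i, ⟨fun h => hv' (h ▸ hv), hi⟩, hv⟩

lemma PsiW_nonneg {w : ι → ℝ} {T : Finset ι → ℝ} (hw : ∀ i, 0 ≤ w i) (hT : ∀ K, 0 ≤ T K) :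
    ∀ (k : ℕ) (J : Finset ι), 0 ≤ PsiW w T k J := by
  intro k
  induction k with
  | zero => intro J; simp [PsiW]
  | succ k ih =>
    intro J
    simp only [PsiW]
    exact Finset.sum_nonneg fun j _ => mul_nonneg (div_nonneg (hw j) (hT J)) (ih _)

lemma PsiW_sum (E : ι → Finset ℕ) {r : ℕ} (hr : 0 < r) (hE : ∀ i, (E i).card = r) (S : Finset ι)
    (w : ι → ℝ) (hw : ∀ i, 0 ≤ w i) :
    ∀ (k : ℕ) (W : Finset ℕ), W.card = r * k →
      ∑ J ∈ pmI E S W, PsiW w (fun K => ∑ i ∈ S.filter (fun i => E i ⊆ K.biUnion E), w i) k J ≤ 1 := by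
  intro k
  set T : Finset ι → ℝ := (fun K => ∑ i ∈ S.filter (fun i => E i ⊆ K.biUnion E), w i) with hT
  have hT0 : ∀ K, 0 ≤ T K := fun K => Finset.sum_nonneg fun i _ => hw i
  induction k with
  | zero =>
    intro W hW
    have hW0 : W = ∅ := by simpa using hW
    have : pmI E S W ⊆ {∅} := by
      intro J hJ
      have := pmI_card hE hJ
      rw [hW0] at this
      simp at this
      simp
      rcases this with h | h
      · omega
      · exact h
    refine (Finset.sum_le_sum_of_subset_of_nonneg this (fun i _ _ => PsiW_nonneg hw hT0 _ _)).trans ?_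
    simp [PsiW]
  | succ k ih =>
    intro W hW
    set TW : ℝ := ∑ i ∈ S.filter (fun i => E i ⊆ W), w i with hTW
    have e1 : ∑ J ∈ pmI E S W, PsiW w T (k + 1) J
        = ∑ J ∈ pmI E S W, ∑ j ∈ J, w j / TW * PsiW w T k (J.erase j) := by
      refine Finset.sum_congr rfl fun J hJ => ?_
      have : T J = TW := by
        simp only [hT, hTW, (mem_pmI.1 hJ).2.2]
      simp only [PsiW, this]
    have e2 : ∑ J ∈ pmI E S W, ∑ j ∈ J, w j / TW * PsiW w T k (J.erase j)
        = ∑ j ∈ S.filter (fun i => E i ⊆ W), ∑ J ∈ (pmI E S W).filter (fun J => j ∈ J),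
            w j / TW * PsiW w T k (J.erase j) := by
      refine Finset.sum_comm' ?_
      intro J j
      simp only [Finset.mem_filter]
      constructor
      · rintro ⟨hJ, hj⟩
        obtain ⟨h1, h2, h3⟩ := mem_pmI.1 hJ
        exact ⟨⟨hJ, hj⟩, h1 hj, by rw [← h3]; exact Finset.subset_biUnion_of_mem E hj⟩
      · rintro ⟨h, _⟩
        exact h
    rw [e1, e2]
    have e3 : ∀ j ∈ S.filter (fun i => E i ⊆ W), ∑ J ∈ (pmI E S W).filter (fun J => j ∈ J),
            w j / TW * PsiW w T k (J.erase j) ≤ w j / TW := by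
      intro j hj
      rw [← Finset.mul_sum]
      have hnn : 0 ≤ w j / TW := div_nonneg (hw j) (Finset.sum_nonneg fun i _ => hw i)
      have hinj : Set.InjOn (fun J : Finset ι => J.erase j)
          ((pmI E S W).filter (fun J => j ∈ J) : Finset (Finset ι)) := by
        intro J hJ J' hJ' h
        simp only [Finset.coe_filter, Set.mem_setOf_eq] at hJ hJ'
        have h : J.erase j = J'.erase j := h
        rw [← Finset.insert_erase hJ.2, h, Finset.insert_erase hJ'.2]
      have : ∑ J ∈ (pmI E S W).filter (fun J => j ∈ J), PsiW w T k (J.erase j) ≤ 1 := by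
        rw [← Finset.sum_image (f := fun J => PsiW w T k J) hinj]
        refine le_trans (Finset.sum_le_sum_of_subset_of_nonneg ?_
          (fun i _ _ => PsiW_nonneg hw hT0 _ _)) (ih (W \ E j) ?_)
        · intro J hJ
          obtain ⟨J', hJ', rfl⟩ := Finset.mem_image.1 hJ
          rw [Finset.mem_filter] at hJ'
          exact pmI_erase hJ'.1 hJ'.2
        · rw [Finset.card_sdiff_of_subset (Finset.mem_filter.1 hj).2, hE, hW]
          rw [Nat.mul_succ]; omega
      calc _ ≤ w j / TW * 1 := mul_le_mul_of_nonneg_left this hnn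
        _ = _ := mul_one _
    refine (Finset.sum_le_sum e3).trans ?_
    rw [← Finset.sum_div]
    exact div_self_le_one _

lemma PsiW_pos {w : ι → ℝ} {T : Finset ι → ℝ} (hw : ∀ i, 0 < w i) :
    ∀ (k : ℕ) (J : Finset ι), J.card = k → (∀ K ⊆ J, K.Nonempty → 0 < T K) → 0 < PsiW w T k J := by
  intro k
  induction k with
  | zero => intro J _ _; simp [PsiW]
  | succ k ih =>
    intro J hJ hT
    simp only [PsiW]
    have hne : J.Nonempty := by rw [← Finset.card_pos]; omega
    refine Finset.sum_pos (fun j hj => mul_pos (div_pos (hw j) (hT J subset_rfl hne)) ?_) hne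
    refine ih _ ?_ fun K hK => hT K (hK.trans (Finset.erase_subset _ _))
    rw [Finset.card_erase_of_mem hj]; omega

lemma log_PsiW_ge {w : ι → ℝ} {T : Finset ι → ℝ} (hw : ∀ i, 0 < w i) :
    ∀ (k : ℕ) (J : Finset ι), J.card = k → (∀ K ⊆ J, K.Nonempty → 0 < T K) →
      ∑ j ∈ J, Real.log (w j) + muW (fun K => Real.log K.card - Real.log (T K)) k J
        ≤ Real.log (PsiW w T k J) := by
  intro k
  induction k with
  | zero =>
    intro J hJ _
    have : J = ∅ := by simpa using hJ
    simp [PsiW, muW, this]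
  | succ k ih =>
    intro J hJ hT
    have hne : J.Nonempty := by rw [← Finset.card_pos]; omega
    have hcard : ∀ j ∈ J, (J.erase j).card = k := by
      intro j hj; rw [Finset.card_erase_of_mem hj]; omega
    have hT' : ∀ j ∈ J, ∀ K ⊆ J.erase j, K.Nonempty → 0 < T K :=
      fun j hj K hK => hT K (hK.trans (Finset.erase_subset _ _))
    have hTJ := hT J subset_rfl hne
    have hpos : ∀ j ∈ J, 0 < w j * PsiW w T k (J.erase j) := fun j hj =>
      mul_pos (hw j) (PsiW_pos hw k _ (hcard j hj) (hT' j hj))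
    have h1 := avg_log_le J hne (fun j => w j * PsiW w T k (J.erase j)) hpos
    have hk : (J.card : ℝ) = k + 1 := by rw [hJ]; push_cast; ring
    have hk0 : (0 : ℝ) < k + 1 := by positivity
    have e1 : PsiW w T (k + 1) J
        = ((∑ j ∈ J, w j * PsiW w T k (J.erase j)) / J.card) * J.card / T J := by
      rw [div_mul_cancel₀ _ (by rw [hk]; exact hk0.ne')]
      simp only [PsiW]
      rw [Finset.sum_div]
      exact Finset.sum_congr rfl fun j _ => by ring
    have hS : 0 < ∑ j ∈ J, w j * PsiW w T k (J.erase j) := Finset.sum_pos hpos hne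
    have hc : (0 : ℝ) < J.card := by rw [hk]; exact hk0
    rw [e1, Real.log_div (by positivity) hTJ.ne', Real.log_mul (by positivity) hc.ne']
    have h2 : ∑ j ∈ J, (∑ i ∈ J, Real.log (w i) +
        muW (fun K => Real.log K.card - Real.log (T K)) k (J.erase j)) ≤
        ∑ j ∈ J, Real.log (w j * PsiW w T k (J.erase j)) := by
      refine Finset.sum_le_sum fun j hj => ?_
      rw [Real.log_mul (hw j).ne' (PsiW_pos hw k _ (hcard j hj) (hT' j hj)).ne']
      have := ih (J.erase j) (hcard j hj) (hT' j hj)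
      rw [← Finset.add_sum_erase J _ hj]
      linarith
    rw [Finset.sum_add_distrib, Finset.sum_const, nsmul_eq_mul] at h2
    simp only [muW]
    have h3 := div_le_div_of_nonneg_right h2 hc.le
    rw [add_div, mul_div_cancel_left₀ _ hc.ne'] at h3
    rw [hk] at h3 h1 ⊢
    linarith

lemma muW_mono {f g : Finset ι → ℝ} :
    ∀ (k : ℕ) (J : Finset ι), J.card = k → (∀ K ⊆ J, K.Nonempty → f K ≤ g K) →
      muW f k J ≤ muW g k J := by
  intro k
  induction k with
  | zero => intro J _ _; simp [muW]
  | succ k ih =>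
    intro J hJ h
    have hne : J.Nonempty := by rw [← Finset.card_pos]; omega
    simp only [muW]
    refine add_le_add (h J subset_rfl hne) (div_le_div_of_nonneg_right
      (Finset.sum_le_sum fun j hj => ih _ ?_ ?_) (by positivity))
    · rw [Finset.card_erase_of_mem hj]; omega
    · exact fun K hK => h K (hK.trans (Finset.erase_subset _ _))

lemma muW_add {f g : Finset ι → ℝ} :
    ∀ (k : ℕ) (J : Finset ι), muW (fun K => f K + g K) k J = muW f k J + muW g k J := by
  intro k
  induction k with
  | zero => intro J; simp [muW]
  | succ k ih =>
    intro J
    simp only [muW, ih, Finset.sum_add_distrib]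
    ring

lemma muW_sum {κ : Type*} (s : Finset κ) (c : κ → ℝ) (f : κ → Finset ι → ℝ) :
    ∀ (k : ℕ) (J : Finset ι), muW (fun K => ∑ a ∈ s, c a * f a K) k J = ∑ a ∈ s, c a * muW (f a) k J := by
  intro k
  induction k with
  | zero => intro J; simp [muW]
  | succ k ih =>
    intro J
    simp only [muW, ih]
    rw [Finset.sum_comm, Finset.sum_div, ← Finset.sum_add_distrib]
    refine Finset.sum_congr rfl fun a _ => ?_
    rw [← Finset.mul_sum]
    ring

lemma muW_card (h : ℕ → ℝ) :
    ∀ (k : ℕ) (J : Finset ι), J.card = k →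
      muW (fun K => h K.card) k J = ∑ i ∈ Finset.range k, h (i + 1) := by
  intro k
  induction k with
  | zero => intro J; simp [muW]
  | succ k ih =>
    intro J hJ
    simp only [muW]
    rw [Finset.sum_congr rfl (fun j hj => ih (J.erase j)
      (by rw [Finset.card_erase_of_mem hj]; omega)), Finset.sum_const, nsmul_eq_mul, hJ,
      Finset.sum_range_succ]
    push_cast
    field_simp
    ring

lemma muW_zero : ∀ (k : ℕ) (J : Finset ι) (f : Finset ι → ℝ), (∀ K ⊆ J, f K = 0) → muW f k J = 0 := by
  intro k
  induction k with
  | zero => intro J f _; simp [muW]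
  | succ k ih =>
    intro J f h
    simp only [muW]
    rw [h J subset_rfl, Finset.sum_eq_zero fun j _ => ih _ _
      fun K hK => h K (hK.trans (Finset.erase_subset _ _))]
    simp

lemma muW_ind (h : ℕ → ℝ) (hh : ∀ i, 0 ≤ h i) (T : Finset ι) :
    ∀ (k : ℕ) (J : Finset ι), J.card = k → T ⊆ J →
      muW (fun K => if T ⊆ K then h K.card else 0) k J
        ≤ ∑ i ∈ Finset.range k, h (i + 1) * (((i : ℝ) + 1) / k) ^ T.card := by
  intro k
  induction k with
  | zero => intro J; simp [muW]
  | succ k ih =>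
    intro J hJ hTJ
    simp only [muW, if_pos hTJ, hJ]
    rw [Finset.sum_range_succ, add_comm]
    have hk1 : (0:ℝ) < k + 1 := by positivity
    have hlast : h (k + 1) * (((k : ℝ) + 1) / ((k + 1 : ℕ) : ℝ)) ^ T.card = h (k + 1) := by
      push_cast
      rw [div_self hk1.ne']; simp
    rw [hlast]
    refine add_le_add ?_ le_rfl
    have hz : ∀ j ∈ T, muW (fun K => if T ⊆ K then h K.card else 0) k (J.erase j) = 0 := by
      intro j hj
      refine muW_zero _ _ _ fun K hK => if_neg fun hTK => ?_
      exact absurd (hK (hTK hj)) (by simp)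
    rw [← Finset.sum_sdiff hTJ, Finset.sum_eq_zero hz, add_zero]
    have hb : ∀ j ∈ J \ T, muW (fun K => if T ⊆ K then h K.card else 0) k (J.erase j)
        ≤ ∑ i ∈ Finset.range k, h (i + 1) * (((i : ℝ) + 1) / k) ^ T.card := by
      intro j hj
      rw [Finset.mem_sdiff] at hj
      refine ih _ (by rw [Finset.card_erase_of_mem hj.1]; omega) ?_
      exact fun t ht => Finset.mem_erase.2 ⟨fun h => hj.2 (h ▸ ht), hTJ ht⟩
    have hb2 := Finset.sum_le_sum hb
    rw [Finset.sum_const, nsmul_eq_mul, Finset.card_sdiff_of_subset hTJ, hJ] at hb2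
    refine (div_le_div_of_nonneg_right hb2 hk1.le).trans ?_
    rw [mul_div_right_comm, Finset.mul_sum]
    refine Finset.sum_le_sum fun i hi => ?_
    rw [mul_left_comm]
    refine mul_le_mul_of_nonneg_left ?_ (hh _)
    have hkpos : (0 : ℝ) < k := by
      have : 0 < k := lt_of_le_of_lt (Nat.zero_le _) (Finset.mem_range.1 hi)
      exact_mod_cast this
    have hTc : T.card ≤ k + 1 := hJ ▸ Finset.card_le_card hTJ
    have e : (((i : ℝ) + 1) / ((k + 1 : ℕ) : ℝ)) = (k / (k + 1)) * (((i : ℝ) + 1) / k) := by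
      push_cast; field_simp
    rw [e, mul_pow]
    refine mul_le_mul_of_nonneg_right ?_ (by positivity)
    have hB := one_add_mul_le_pow (a := -(1 / ((k:ℝ) + 1))) (by
      have : 1 / ((k:ℝ)+1) ≤ 1 := by rw [div_le_one hk1]; linarith
      linarith) T.card
    have e2 : 1 + -(1 / ((k:ℝ) + 1)) = k / (k + 1) := by field_simp; ring
    rw [e2] at hB
    refine le_trans (le_of_eq ?_) hB
    rw [Nat.cast_sub hTc]
    push_cast
    field_simp
    ring

end Entropy

section Entropy2
variable {ι : Type*} [DecidableEq ι]

lemma T_sum_le (E : ι → Finset ℕ) {r l : ℕ} (hr : 0 < r) (hl : 0 < l) (hE : ∀ i, (E i).card = r)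
    (S : Finset ι) (W : Finset ℕ) (hW : W.card = r * l) (w : ι → ℝ) (hw : ∀ i, 0 < w i)
    (hw1 : ∀ i, w i ≤ 1) (Q Wt : ℝ) (hQ : ((excI E S).card : ℝ) ≤ Q) (hWt : ∑ i ∈ S, w i ≤ Wt)
    (J : Finset ι) (hJ : J ∈ pmI E S W) (x : ℝ) (hx0 : 0 ≤ x) (hx1 : x ≤ 1) :
    ∑ i ∈ S.filter (fun i => E i ⊆ W), w i * x ^ (J.filter (fun j => ¬ Disjoint (E i) (E j))).card
      ≤ (l + Q) * x + Wt * x ^ r := by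
  obtain ⟨h1, h2, h3⟩ := mem_pmI.1 hJ
  have hJl : J.card = l := by
    have := pmI_card hE hJ
    rw [hW] at this
    exact (Nat.eq_of_mul_eq_mul_left hr this).symm
  have key : ∀ i ∈ S.filter (fun i => E i ⊆ W),
      w i * x ^ (J.filter (fun j => ¬ Disjoint (E i) (E j))).card ≤
        (if i ∈ J then x else 0) + (if i ∈ excI E S then x else 0) + w i * x ^ r := by
    intro i hi
    obtain ⟨hiS, hiW⟩ := Finset.mem_filter.1 hi
    set T := J.filter (fun j => ¬ Disjoint (E i) (E j)) with hT
    have hsub : E i ⊆ T.biUnion (fun j => E i ∩ E j) := by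
      intro v hv
      have := hiW hv
      rw [← h3, Finset.mem_biUnion] at this
      obtain ⟨j, hj, hvj⟩ := this
      rw [Finset.mem_biUnion]
      refine ⟨j, Finset.mem_filter.2 ⟨hj, Finset.not_disjoint_iff.2 ⟨v, hv, hvj⟩⟩, ?_⟩
      exact Finset.mem_inter.2 ⟨hv, hvj⟩
    have hT1 : 1 ≤ T.card := by
      rw [Nat.one_le_iff_ne_zero, ne_eq, Finset.card_eq_zero]
      intro h0
      rw [h0] at hsub
      simp at hsub
      have := hE i
      rw [hsub] at this
      simp at this
      omega
    have hb1 : w i * x ^ T.card ≤ x := by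
      calc w i * x ^ T.card ≤ 1 * x ^ 1 :=
            mul_le_mul (hw1 i) (pow_le_pow_of_le_one hx0 hx1 hT1) (by positivity) (by norm_num)
        _ = x := by ring
    have hwr : 0 ≤ w i * x ^ r := mul_nonneg (hw i).le (by positivity)
    by_cases hiJ : i ∈ J
    · rw [if_pos hiJ]
      have : (0:ℝ) ≤ if i ∈ excI E S then x else 0 := by split_ifs <;> simp [hx0]
      linarith
    · by_cases hiX : i ∈ excI E S
      · rw [if_neg hiJ, if_pos hiX]; linarith
      · rw [if_neg hiJ, if_neg hiX]
        have hrT : r ≤ T.card := by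
          calc r = (E i).card := (hE i).symm
            _ ≤ (T.biUnion (fun j => E i ∩ E j)).card := Finset.card_le_card hsub
            _ ≤ ∑ j ∈ T, (E i ∩ E j).card := Finset.card_biUnion_le
            _ ≤ ∑ j ∈ T, 1 := by
                refine Finset.sum_le_sum fun j hj => ?_
                have hjJ := (Finset.mem_filter.1 hj).1
                by_contra hlt
                refine hiX (Finset.mem_filter.2 ⟨hiS, j, h1 hjJ, ?_, by omega⟩)
                rintro rfl
                exact hiJ hjJ
            _ = T.card := by simp
        have := mul_le_mul_of_nonneg_left (pow_le_pow_of_le_one hx0 hx1 hrT) (hw i).le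
        linarith
  refine (Finset.sum_le_sum key).trans ?_
  rw [Finset.sum_add_distrib, Finset.sum_add_distrib]
  have a1 : ∑ i ∈ S.filter (fun i => E i ⊆ W), (if i ∈ J then x else 0) ≤ l * x := by
    rw [← Finset.sum_filter, Finset.sum_const, nsmul_eq_mul]
    refine mul_le_mul_of_nonneg_right ?_ hx0
    rw [← hJl]
    exact_mod_cast Finset.card_le_card (fun i hi => (Finset.mem_filter.1 hi).2)
  have a2 : ∑ i ∈ S.filter (fun i => E i ⊆ W), (if i ∈ excI E S then x else 0) ≤ Q * x := by
    rw [← Finset.sum_filter, Finset.sum_const, nsmul_eq_mul]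
    refine mul_le_mul_of_nonneg_right (le_trans ?_ hQ) hx0
    exact_mod_cast Finset.card_le_card (fun i hi => (Finset.mem_filter.1 hi).2)
  have a3 : ∑ i ∈ S.filter (fun i => E i ⊆ W), w i * x ^ r ≤ Wt * x ^ r := by
    rw [← Finset.sum_mul]
    refine mul_le_mul_of_nonneg_right (le_trans ?_ hWt) (by positivity)
    exact Finset.sum_le_sum_of_subset_of_nonneg (Finset.filter_subset _ _) fun i _ _ => (hw i).le
  linarith

theorem entropy_bound (E : ι → Finset ℕ) {r l : ℕ} (hr : 0 < r) (hl : 0 < l)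
    (hE : ∀ i, (E i).card = r)
    (S : Finset ι) (W : Finset ℕ) (hW : W.card = r * l) (w : ι → ℝ) (hw : ∀ i, 0 < w i)
    (hw1 : ∀ i, w i ≤ 1) (Q Wt : ℝ) (hQ : ((excI E S).card : ℝ) ≤ Q) (hWt : ∑ i ∈ S, w i ≤ Wt)
    (hne : (pmI E S W).Nonempty) :
    Real.log ((pmI E S W).card) ≤
      ∑ i ∈ Finset.range l, Real.log (1 + Q / l + Wt / l * (((i : ℝ) + 1) / l) ^ (r - 1))
      + (∑ J ∈ pmI E S W, ∑ j ∈ J, - Real.log (w j)) / (pmI E S W).card := by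
  set T : Finset ι → ℝ := (fun K => ∑ i ∈ S.filter (fun i => E i ⊆ K.biUnion E), w i) with hT
  have hl0 : (0 : ℝ) < l := by exact_mod_cast hl
  have hQ0 : 0 ≤ Q := le_trans (by positivity) hQ
  have hWt0 : 0 ≤ Wt := le_trans (Finset.sum_nonneg fun i _ => (hw i).le) hWt
  set c : ℕ → ℝ := fun k => (l + Q) * ((k : ℝ) / l) + Wt * ((k : ℝ) / l) ^ r with hc
  have hcpos : ∀ k, 0 < k → 0 < c k := by
    intro k hk
    have : (0:ℝ) < k := by exact_mod_cast hk
    positivity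
  have hcnn : ∀ k, 0 ≤ c k := by
    intro k
    positivity
  have hcard : ∀ J ∈ pmI E S W, J.card = l := by
    intro J hJ
    have := pmI_card hE hJ
    rw [hW] at this
    exact (Nat.eq_of_mul_eq_mul_left hr this).symm
  have hTpos : ∀ J ∈ pmI E S W, ∀ K ⊆ J, K.Nonempty → 0 < T K := by
    rintro J hJ K hK ⟨j, hj⟩
    refine Finset.sum_pos (fun i _ => hw i) ⟨j, Finset.mem_filter.2 ⟨(mem_pmI.1 hJ).1 (hK hj), ?_⟩⟩
    exact Finset.subset_biUnion_of_mem E hj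
  have hmu : ∀ J ∈ pmI E S W, muW (fun K => Real.log (T K)) l J
      ≤ ∑ i ∈ Finset.range l, Real.log (c (i + 1)) := by
    intro J hJ
    obtain ⟨h1, h2, h3⟩ := mem_pmI.1 hJ
    set Ti : ι → Finset ι := fun i => J.filter (fun j => ¬ Disjoint (E i) (E j)) with hTi
    have s1 : muW (fun K => Real.log (T K)) l J ≤
        muW (fun K => (Real.log (c K.card) - 1) + ∑ i ∈ S.filter (fun i => E i ⊆ W),
          w i * (if Ti i ⊆ K then (c K.card)⁻¹ else 0)) l J := by
      refine muW_mono l J (hcard J hJ) ?_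
      intro K hK hKne
      have hck := hcpos K.card hKne.card_pos
      have hTK := hTpos J hJ K hK hKne
      have hlog := Real.log_le_sub_one_of_pos (div_pos hTK hck)
      rw [Real.log_div hTK.ne' hck.ne'] at hlog
      have : T K / c K.card ≤ ∑ i ∈ S.filter (fun i => E i ⊆ W),
          w i * (if Ti i ⊆ K then (c K.card)⁻¹ else 0) := by
        rw [div_eq_mul_inv, hT]
        simp only
        rw [Finset.sum_mul]
        have hsub : S.filter (fun i => E i ⊆ K.biUnion E) ⊆ S.filter (fun i => E i ⊆ W) := by
          intro i hi
          rw [Finset.mem_filter] at hi ⊢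
          refine ⟨hi.1, hi.2.trans ?_⟩
          rw [← h3]
          exact Finset.biUnion_subset_biUnion_of_subset_left _ hK
        refine le_trans (Finset.sum_le_sum (g := fun i => w i * (if Ti i ⊆ K then (c K.card)⁻¹ else 0)) ?_)
          (Finset.sum_le_sum_of_subset_of_nonneg hsub ?_)
        · intro i hi
          rw [if_pos]
          intro j hj
          rw [hTi, Finset.mem_filter] at hj
          obtain ⟨hjJ, hd⟩ := hj
          obtain ⟨v, hv, hvj⟩ := Finset.not_disjoint_iff.1 hd
          have := (Finset.mem_filter.1 hi).2 hv
          obtain ⟨j', hj', hvj'⟩ := Finset.mem_biUnion.1 this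
          by_cases hjj : j = j'
          · rw [hjj]; exact hj'
          · exact absurd hvj' (Finset.disjoint_left.1 (h2 j hjJ j' (hK hj') hjj) hvj)
        · intro i _ _
          refine mul_nonneg (hw i).le ?_
          split_ifs
          · exact (inv_pos.2 hck).le
          · exact le_rfl
      linarith
    refine s1.trans ?_
    rw [muW_add, muW_card (fun k => Real.log (c k) - 1) l J (hcard J hJ), muW_sum]
    have s2 : ∑ i ∈ S.filter (fun i => E i ⊆ W),
        w i * muW (fun K => if Ti i ⊆ K then (c K.card)⁻¹ else 0) l J ≤
        ∑ i ∈ S.filter (fun i => E i ⊆ W), w i *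
          ∑ k ∈ Finset.range l, (c (k + 1))⁻¹ * (((k : ℝ) + 1) / l) ^ (Ti i).card := by
      refine Finset.sum_le_sum fun i _ => mul_le_mul_of_nonneg_left ?_ (hw i).le
      exact muW_ind (fun k => (c k)⁻¹) (fun k => inv_nonneg.2 (hcnn k)) (Ti i) l J (hcard J hJ)
        (Finset.filter_subset _ _)
    have s3 : ∑ i ∈ S.filter (fun i => E i ⊆ W), w i *
          ∑ k ∈ Finset.range l, (c (k + 1))⁻¹ * (((k : ℝ) + 1) / l) ^ (Ti i).card ≤
          ∑ k ∈ Finset.range l, (1 : ℝ) := by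
      simp_rw [Finset.mul_sum]
      rw [Finset.sum_comm]
      refine Finset.sum_le_sum fun k hk => ?_
      have hkl : (k : ℝ) + 1 ≤ l := by exact_mod_cast Finset.mem_range.1 hk
      have := T_sum_le E hr hl hE S W hW w hw hw1 Q Wt hQ hWt J hJ (((k : ℝ) + 1) / l)
        (by positivity) (by rw [div_le_one hl0]; exact hkl)
      have hck := hcpos (k + 1) (Nat.succ_pos _)
      calc _ = (c (k + 1))⁻¹ * ∑ i ∈ S.filter (fun i => E i ⊆ W), w i *
            (((k : ℝ) + 1) / l) ^ (Ti i).card := by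
            rw [Finset.mul_sum]
            exact Finset.sum_congr rfl fun i _ => by ring
        _ ≤ (c (k + 1))⁻¹ * c (k + 1) := by
            refine mul_le_mul_of_nonneg_left ?_ (inv_pos.2 hck).le
            refine this.trans (le_of_eq ?_)
            simp only [hc]; push_cast; ring
        _ = 1 := inv_mul_cancel₀ hck.ne'
    rw [Finset.sum_sub_distrib]
    linarith
  have hlow : ∀ J ∈ pmI E S W, ∑ j ∈ J, Real.log (w j)
      - ∑ i ∈ Finset.range l, Real.log (1 + Q / l + Wt / l * (((i : ℝ) + 1) / l) ^ (r - 1))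
      ≤ Real.log (PsiW w T l J) := by
    intro J hJ
    refine le_trans ?_ (log_PsiW_ge hw l J (hcard J hJ) (hTpos J hJ))
    have e : muW (fun K => Real.log K.card - Real.log (T K)) l J
        + muW (fun K => Real.log (T K)) l J = ∑ i ∈ Finset.range l, Real.log ((i + 1 : ℕ) : ℝ) := by
      rw [← muW_add, ← muW_card (fun k => Real.log (k : ℝ)) l J (hcard J hJ)]
      congr 1
      ext K
      ring
    have h4 := hmu J hJ
    have h5 : ∑ i ∈ Finset.range l, Real.log (c (i + 1)) =
        ∑ i ∈ Finset.range l, Real.log ((i + 1 : ℕ) : ℝ) +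
        ∑ i ∈ Finset.range l, Real.log (1 + Q / l + Wt / l * (((i : ℝ) + 1) / l) ^ (r - 1)) := by
      rw [← Finset.sum_add_distrib]
      refine Finset.sum_congr rfl fun i _ => ?_
      rw [← Real.log_mul (by positivity) (by positivity)]
      congr 1
      simp only [hc]
      obtain ⟨s, rfl⟩ : ∃ s, r = s + 1 := ⟨r - 1, by omega⟩
      simp only [Nat.add_sub_cancel]
      push_cast
      rw [pow_succ]
      field_simp
    linarith
  have hP := PsiW_sum E hr hE S w (fun i => (hw i).le) l W hW
  have hPpos : ∀ J ∈ pmI E S W, 0 < PsiW w T l J := fun J hJ =>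
    PsiW_pos hw l J (hcard J hJ) (hTpos J hJ)
  have h6 := avg_log_le (pmI E S W) hne (fun J => PsiW w T l J) hPpos
  have hN : (0 : ℝ) < (pmI E S W).card := by exact_mod_cast hne.card_pos
  have h7 : Real.log ((∑ J ∈ pmI E S W, PsiW w T l J) / (pmI E S W).card)
      ≤ - Real.log (pmI E S W).card := by
    rw [Real.log_div (Finset.sum_pos hPpos hne).ne' hN.ne']
    have := Real.log_nonpos (Finset.sum_nonneg fun J hJ => (hPpos J hJ).le) hP
    linarith
  have h8 := Finset.sum_le_sum hlow
  rw [Finset.sum_sub_distrib, Finset.sum_const, nsmul_eq_mul] at h8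
  have h9 := div_le_div_of_nonneg_right h8 hN.le
  rw [sub_div, mul_div_cancel_left₀ _ hN.ne'] at h9
  have h10 : (∑ J ∈ pmI E S W, ∑ j ∈ J, - Real.log (w j)) / ((pmI E S W).card : ℝ)
      = - ((∑ J ∈ pmI E S W, ∑ j ∈ J, Real.log (w j)) / ((pmI E S W).card : ℝ)) := by
    simp only [Finset.sum_neg_distrib]
    ring
  rw [h10]
  linarith

end Entropy2

section Analytic

lemma sum_log_succ_le (l : ℕ) (hl : 0 < l) :
    ∑ i ∈ Finset.range l, Real.log ((i : ℝ) + 1) ≤ 1 + Real.log l + l * Real.log l - l := by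
  induction l with
  | zero => omega
  | succ l ih =>
    rcases Nat.eq_zero_or_pos l with rfl | hl
    · simp
    · have h := ih hl
      rw [Finset.sum_range_succ]
      have hl0 : (0 : ℝ) < l := by exact_mod_cast hl
      have h1 : Real.log (l / (l + 1)) ≤ l / (l + 1) - 1 :=
        Real.log_le_sub_one_of_pos (by positivity)
      rw [Real.log_div hl0.ne' (by positivity)] at h1
      have h2 : (l : ℝ) / (l + 1) - 1 = - (1 / (l + 1)) := by field_simp; ring
      rw [h2] at h1
      have h3 : ((l : ℝ) + 1) * (Real.log l - Real.log (l + 1)) ≤ (l + 1) * -(1 / (l + 1)) :=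
        mul_le_mul_of_nonneg_left h1 (by positivity)
      have h4 : ((l : ℝ) + 1) * -(1 / (l + 1)) = -1 := by field_simp
      rw [h4] at h3
      push_cast
      linarith

lemma sum_inv_sqrt_le (l : ℕ) :
    ∑ i ∈ Finset.range l, 1 / Real.sqrt ((i : ℝ) + 1) ≤ 2 * Real.sqrt l := by
  induction l with
  | zero => simp
  | succ l ih =>
    rw [Finset.sum_range_succ]
    have h1 : 1 / Real.sqrt ((l : ℝ) + 1) ≤ 2 * (Real.sqrt (l + 1) - Real.sqrt l) := by
      have a := Real.sqrt_nonneg (l : ℝ)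
      have b : 0 < Real.sqrt ((l : ℝ) + 1) := Real.sqrt_pos.2 (by positivity)
      have a2 := Real.sq_sqrt (show (0 : ℝ) ≤ l by positivity)
      have b2 := Real.sq_sqrt (show (0 : ℝ) ≤ (l : ℝ) + 1 by positivity)
      rw [div_le_iff₀ b]
      nlinarith [sq_nonneg (Real.sqrt ((l : ℝ) + 1) - Real.sqrt l)]
    push_cast
    linarith

lemma sum_log_bound (s l : ℕ) (hs : 0 < s) (hl : 0 < l) (a b θ : ℝ) (ha : 0 ≤ a) (hb : 0 < b)
    (hθ : 0 < θ) (hab : a ≤ b * θ ^ (2 * s)) :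
    ∑ i ∈ Finset.range l, Real.log (a + b * (((i : ℝ) + 1) / l) ^ s)
      ≤ l * Real.log b + s * (1 + Real.log l - l) + 4 * s * θ * l := by
  have hl0 : (0 : ℝ) < l := by exact_mod_cast hl
  have key : ∀ i ∈ Finset.range l, Real.log (a + b * (((i : ℝ) + 1) / l) ^ s)
      ≤ Real.log b + s * (Real.log ((i : ℝ) + 1) - Real.log l)
        + 2 * s * θ * Real.sqrt l * (1 / Real.sqrt ((i : ℝ) + 1)) := by
    intro i _
    have hi : (0 : ℝ) < (i : ℝ) + 1 := by positivity
    set x : ℝ := ((i : ℝ) + 1) / l with hx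
    have hx0 : 0 < x := by positivity
    set u : ℝ := θ / Real.sqrt x with hu
    have hsx : 0 < Real.sqrt x := Real.sqrt_pos.2 hx0
    have hu0 : 0 < u := by positivity
    have hu2 : u ^ (2 * s) * x ^ s = θ ^ (2 * s) := by
      rw [hu, div_pow, pow_mul (Real.sqrt x), Real.sq_sqrt hx0.le]
      field_simp
    have h1 : a + b * x ^ s ≤ b * x ^ s * (1 + u) ^ (2 * s) := by
      have : 1 + u ^ (2 * s) ≤ (1 + u) ^ (2 * s) := by
        have := pow_add_pow_le (show (0:ℝ) ≤ 1 by norm_num) hu0.le (show 2 * s ≠ 0 by omega)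
        simpa using this
      calc a + b * x ^ s ≤ b * θ ^ (2 * s) + b * x ^ s := by linarith
        _ = b * x ^ s * (1 + u ^ (2 * s)) := by rw [← hu2]; ring
        _ ≤ _ := mul_le_mul_of_nonneg_left this (by positivity)
    have h2 : Real.log (a + b * x ^ s) ≤ Real.log (b * x ^ s * (1 + u) ^ (2 * s)) :=
      Real.log_le_log (by positivity) h1
    rw [Real.log_mul (by positivity) (by positivity), Real.log_mul hb.ne' (by positivity),
      Real.log_pow, Real.log_pow, hx, Real.log_div hi.ne' hl0.ne', ← hx] at h2
    have h3 : Real.log (1 + u) ≤ u := by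
      have := Real.log_le_sub_one_of_pos (show 0 < 1 + u by positivity)
      linarith
    have h4 : u = θ * Real.sqrt l * (1 / Real.sqrt ((i : ℝ) + 1)) := by
      rw [hu, hx, Real.sqrt_div hi.le]
      field_simp
    have h5 : ((2 * s : ℕ) : ℝ) * Real.log (1 + u) ≤ (2 * s : ℕ) * u :=
      mul_le_mul_of_nonneg_left h3 (by positivity)
    rw [h4] at h5
    rw [h4] at h2
    push_cast at h5 h2
    linarith
  refine (Finset.sum_le_sum key).trans ?_
  rw [Finset.sum_add_distrib, Finset.sum_add_distrib, ← Finset.mul_sum, ← Finset.mul_sum,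
    Finset.sum_sub_distrib]
  simp only [Finset.sum_const, Finset.card_range, nsmul_eq_mul]
  have h1 := sum_log_succ_le l hl
  have h2 := sum_inv_sqrt_le l
  have h3 : 2 * s * θ * Real.sqrt l * ∑ i ∈ Finset.range l, 1 / Real.sqrt ((i : ℝ) + 1)
      ≤ 2 * s * θ * Real.sqrt l * (2 * Real.sqrt l) := mul_le_mul_of_nonneg_left h2 (by positivity)
  have h4 : Real.sqrt l * Real.sqrt l = l := Real.mul_self_sqrt hl0.le
  have h5 : 2 * s * θ * Real.sqrt l * (2 * Real.sqrt l) = 4 * s * θ * l := by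
    rw [show 2 * s * θ * Real.sqrt l * (2 * Real.sqrt l)
      = 4 * s * θ * (Real.sqrt l * Real.sqrt l) by ring, h4]
  have h6 : (s : ℝ) * (∑ i ∈ Finset.range l, Real.log ((i : ℝ) + 1) - l * Real.log l) ≤
      s * (1 + Real.log l - l) := mul_le_mul_of_nonneg_left (by linarith) (by positivity)
  linarith

/-- `j! e^j / j^j` is nondecreasing, in a two-parameter form -/
lemma fact_ratio (j k : ℕ) :
    ((j + k : ℕ) : ℝ) ^ k * (j.factorial : ℝ) ≤ Real.exp k * ((j + k).factorial : ℝ) := by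
  have mono : ∀ n : ℕ, (n.factorial : ℝ) * Real.exp n * ((n + 1 : ℕ) : ℝ) ^ (n + 1)
      ≤ ((n + 1).factorial : ℝ) * Real.exp (n + 1 : ℕ) * (n : ℝ) ^ n := by
    intro n
    rw [Nat.factorial_succ]
    push_cast
    rw [Real.exp_add]
    have : ((n : ℝ) + 1) ^ n ≤ Real.exp 1 * (n : ℝ) ^ n := by
      rcases Nat.eq_zero_or_pos n with rfl | hn
      · simp
      have hn0 : (0 : ℝ) < n := by exact_mod_cast hn
      have h1 : ((n : ℝ) + 1) / n ≤ Real.exp (1 / n) := by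
        have := Real.add_one_le_exp (1 / (n : ℝ))
        calc ((n : ℝ) + 1) / n = 1 / n + 1 := by field_simp; ring
          _ ≤ _ := this
      have h2 := pow_le_pow_left₀ (by positivity) h1 n
      rw [← Real.exp_nat_mul, div_pow, mul_one_div_cancel hn0.ne', div_le_iff₀ (by positivity)] at h2
      exact h2
    have h0 : (0 : ℝ) ≤ (n.factorial : ℝ) * Real.exp n * (n + 1) := by positivity
    have := mul_le_mul_of_nonneg_left this h0
    calc _ = (n.factorial : ℝ) * Real.exp n * (n + 1) * (n + 1) ^ n := by ring
      _ ≤ _ := this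
      _ = _ := by ring
  have mono2 : ∀ k : ℕ, (j.factorial : ℝ) * Real.exp j * ((j + k : ℕ) : ℝ) ^ (j + k)
      ≤ ((j + k).factorial : ℝ) * Real.exp (j + k : ℕ) * (j : ℝ) ^ j := by
    intro k
    induction k with
    | zero => simp
    | succ k ih =>
      have h := mono (j + k)
      rcases Nat.eq_zero_or_pos (j + k) with h0 | h0
      · have hj : j = 0 := by omega
        have hk : k = 0 := by omega
        subst hj; subst hk
        simp
      have hp : (0 : ℝ) < ((j + k : ℕ) : ℝ) ^ (j + k) := by
        have : (0:ℝ) < ((j + k : ℕ) : ℝ) := by exact_mod_cast h0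
        positivity
      have hq : (0 : ℝ) < (j + k).factorial * Real.exp (j + k : ℕ) := by positivity
      rw [← mul_le_mul_iff_left₀ (mul_pos hp hq)]
      have := mul_le_mul ih h (by positivity) (by positivity)
      have ee : j + (k + 1) = j + k + 1 := by ring
      rw [ee]
      nlinarith [this]
  have h := mono2 k
  rcases Nat.eq_zero_or_pos j with rfl | hj
  · simp at h ⊢
    linarith
  have hjk : (0 : ℝ) < ((j + k : ℕ) : ℝ) := by
    have : 0 < j + k := by omega
    exact_mod_cast this
  have hjj : (j : ℝ) ^ j ≤ ((j + k : ℕ) : ℝ) ^ j :=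
    pow_le_pow_left₀ (by positivity) (by push_cast; linarith [show (0:ℝ) ≤ k by positivity]) _
  have h2 : (j.factorial : ℝ) * Real.exp j * ((j + k : ℕ) : ℝ) ^ (j + k)
      ≤ ((j + k).factorial : ℝ) * Real.exp (j + k : ℕ) * ((j + k : ℕ) : ℝ) ^ j :=
    h.trans (mul_le_mul_of_nonneg_left hjj (by positivity))
  have hp : (0:ℝ) < Real.exp j * ((j + k : ℕ) : ℝ) ^ j := by positivity
  rw [← mul_le_mul_iff_left₀ hp]
  have e1 : Real.exp ((j + k : ℕ) : ℝ) = Real.exp j * Real.exp k := by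
    push_cast; exact Real.exp_add _ _
  rw [e1, pow_add] at h2
  nlinarith [h2]

lemma desc_ratio_small (n k : ℕ) (hk : 2 * k ≤ n) (hn : 0 < n) :
    (n : ℝ) ^ k ≤ Real.exp (2 * (k : ℝ) ^ 2 / n) * (n.descFactorial k : ℝ) := by
  have hn0 : (0 : ℝ) < n := by exact_mod_cast hn
  have hk0 : 2 * (k : ℝ) ≤ n := by exact_mod_cast hk
  have h1 : ((n : ℝ) - k) ^ k ≤ (n.descFactorial k : ℝ) := by
    have h := Nat.pow_sub_le_descFactorial n k
    have h' : ((n - k : ℕ) : ℝ) ^ k ≤ ((n + 1 - k : ℕ) : ℝ) ^ k :=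
      pow_le_pow_left₀ (by positivity) (by exact_mod_cast (by omega)) _
    have h'' : (((n + 1 - k) ^ k : ℕ) : ℝ) ≤ (n.descFactorial k : ℝ) := by exact_mod_cast h
    rw [Nat.cast_sub (by omega)] at h'
    push_cast at h''
    exact h'.trans h''
  have h2 : (n : ℝ) ≤ Real.exp (2 * k / n) * (n - k) := by
    have h3 := Real.add_one_le_exp (2 * (k : ℝ) / n)
    have h4 : (n : ℝ) ≤ (2 * k / n + 1) * (n - k) := by
      have : (2 * (k:ℝ) / n + 1) * (n - k) = n + k * (1 - 2 * k / n) := by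
        field_simp; ring
      rw [this]
      have : 2 * (k : ℝ) / n ≤ 1 := by rw [div_le_one hn0]; exact hk0
      have : 0 ≤ (k : ℝ) * (1 - 2 * k / n) := mul_nonneg (by positivity) (by linarith)
      linarith
    exact h4.trans (mul_le_mul_of_nonneg_right h3 (by linarith [show (0:ℝ) ≤ k by positivity]))
  calc (n : ℝ) ^ k ≤ (Real.exp (2 * k / n) * (n - k)) ^ k := pow_le_pow_left₀ hn0.le h2 _
    _ = Real.exp (2 * (k : ℝ) ^ 2 / n) * ((n : ℝ) - k) ^ k := by
        rw [mul_pow, ← Real.exp_nat_mul]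
        congr 2
        ring
    _ ≤ _ := mul_le_mul_of_nonneg_left h1 (Real.exp_pos _).le

end Analytic

section Transfer
open Function

variable {R : Type*} [Fintype R] {M : ℕ}

lemma sum_update {ι : Type*} [Fintype ι] [DecidableEq ι] (i : ι) (f : (ι → R) → ℝ) :
    ∑ e : ι → R, ∑ x : R, f (update e i x) = Fintype.card R * ∑ e, f e := by
  classical
  have h1 : ∑ e : ι → R, ∑ x : R, f (update e i x)
      = ∑ y : (ι → R) × R, f (update y.1 i y.2) := by
    rw [Fintype.sum_prod_type]
  have h2 : ∑ y : (ι → R) × R, f (update y.1 i y.2) = ∑ y : (ι → R) × R, f y.1 := by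
    refine Finset.sum_bij' (fun y _ => (update y.1 i y.2, y.1 i))
      (fun y _ => (update y.1 i y.2, y.1 i)) (fun _ _ => Finset.mem_univ _)
      (fun _ _ => Finset.mem_univ _) ?_ ?_ ?_
    · intro y _; simp
    · intro y _; simp
    · intro y _; simp
  rw [h1, h2, Fintype.sum_prod_type]
  simp only [Finset.sum_const, Finset.card_univ, nsmul_eq_mul]
  rw [Finset.mul_sum]

lemma sum_comp_perm {ι : Type*} [Fintype ι] [DecidableEq ι] (π : Equiv.Perm ι) (f : (ι → R) → ℝ) :
    ∑ e : ι → R, f (e ∘ π) = ∑ e, f e := by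
  refine Fintype.sum_equiv (Equiv.arrowCongr π.symm (Equiv.refl R)) _ _ ?_
  intro e
  rfl

open scoped Classical in
lemma transfer_forward [Nonempty R] (i0 : ℕ) (κ : ℕ → (Fin M → R) → ℝ)
    (Ev : ℕ → (Fin M → R) → Prop) (β : ℝ) (hβ : β ≤ 2)
    (h01 : ∀ i e, 0 ≤ κ i e ∧ κ i e ≤ 1)
    (hdep : ∀ i (j : Fin M) e x, i < j.val → κ i (update e j x) = κ i e)
    (hEdep : ∀ i (j : Fin M) e x, i ≤ j.val → (Ev i (update e j x) ↔ Ev i e))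
    (hEβ : ∀ i (h : i < M) e, i0 ≤ i → Ev i e →
      β * Fintype.card R ≤ ∑ x, κ i (update e ⟨i, h⟩ x))
    (m : ℕ) (hm : i0 ≤ m) (hmM : m ≤ M) :
    (∑ e ∈ (Finset.univ : Finset (Fin M → R)).filter (fun e => ∀ i ∈ Finset.Ico i0 m, Ev i e),
      ∏ i ∈ Finset.Ico i0 m, (1 - κ i e / 2)) ≤ (1 - β / 2) ^ (m - i0) *
        Fintype.card (Fin M → R) := by
  induction m, hm using Nat.le_induction with
  | base => simp
  | succ m hm ih =>
    have ih := ih (by omega)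
    have hmM' : m < M := by omega
    set G : (Fin M → R) → ℝ := fun e => if ∀ i ∈ Finset.Ico i0 m, Ev i e then
      ∏ i ∈ Finset.Ico i0 m, (1 - κ i e / 2) else 0 with hG
    have hG0 : ∀ e, 0 ≤ G e := by
      intro e
      simp only [hG]
      split_ifs
      · exact Finset.prod_nonneg fun i _ => by linarith [(h01 i e).2]
      · exact le_rfl
    set H : (Fin M → R) → ℝ := fun e => if Ev m e then G e else 0 with hH
    have hGu : ∀ e x, G (update e ⟨m, hmM'⟩ x) = G e := by
      intro e x
      simp only [hG]
      have a : (∀ i ∈ Finset.Ico i0 m, Ev i (update e ⟨m, hmM'⟩ x)) ↔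
          (∀ i ∈ Finset.Ico i0 m, Ev i e) := by
        refine forall₂_congr fun i hi => hEdep i _ e x ?_
        exact (Finset.mem_Ico.1 hi).2.le
      have b : ∏ i ∈ Finset.Ico i0 m, (1 - κ i (update e ⟨m, hmM'⟩ x) / 2)
          = ∏ i ∈ Finset.Ico i0 m, (1 - κ i e / 2) := by
        refine Finset.prod_congr rfl fun i hi => ?_
        rw [hdep i _ e x (Finset.mem_Ico.1 hi).2]
      simp only [a, b]
    have hHu : ∀ e x, H (update e ⟨m, hmM'⟩ x) = H e := by
      intro e x
      simp only [hH, hGu, hEdep m ⟨m, hmM'⟩ e x le_rfl]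
    have hR : (0 : ℝ) < Fintype.card R := by exact_mod_cast Fintype.card_pos
    have e1 : ∑ e ∈ (Finset.univ : Finset (Fin M → R)).filter
        (fun e => ∀ i ∈ Finset.Ico i0 (m + 1), Ev i e),
        ∏ i ∈ Finset.Ico i0 (m + 1), (1 - κ i e / 2) = ∑ e, H e * (1 - κ m e / 2) := by
      rw [Finset.sum_filter]
      refine Finset.sum_congr rfl fun e _ => ?_
      have hiff : (∀ i ∈ Finset.Ico i0 (m + 1), Ev i e) ↔
          (∀ i ∈ Finset.Ico i0 m, Ev i e) ∧ Ev m e := by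
        constructor
        · intro h
          exact ⟨fun i hi => h i (Finset.mem_Ico.2 ⟨(Finset.mem_Ico.1 hi).1,
            (Finset.mem_Ico.1 hi).2.trans (Nat.lt_succ_self m)⟩),
            h m (Finset.mem_Ico.2 ⟨hm, Nat.lt_succ_self m⟩)⟩
        · rintro ⟨h1, h2⟩ i hi
          rcases Nat.lt_succ_iff_lt_or_eq.1 (Finset.mem_Ico.1 hi).2 with h | h
          · exact h1 i (Finset.mem_Ico.2 ⟨(Finset.mem_Ico.1 hi).1, h⟩)
          · rw [h]; exact h2
      rw [Finset.prod_Ico_succ_top hm]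
      simp only [hiff, hH, hG]
      by_cases ha : (∀ i ∈ Finset.Ico i0 m, Ev i e) <;> by_cases hb : Ev m e <;> simp [ha, hb]
    have e2 : Fintype.card R * ∑ e, H e * (1 - κ m e / 2)
        ≤ Fintype.card R * ((1 - β / 2) * ∑ e, H e) := by
      rw [← sum_update ⟨m, hmM'⟩]
      rw [Finset.mul_sum, Finset.mul_sum]
      refine Finset.sum_le_sum fun e _ => ?_
      simp only [hHu]
      rw [← Finset.mul_sum, Finset.sum_sub_distrib, ← Finset.sum_div]
      simp only [Finset.sum_const, Finset.card_univ, nsmul_eq_mul, mul_one]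
      by_cases hb : Ev m e
      · have := hEβ m hmM' e hm hb
        have hHe : 0 ≤ H e := by simp only [hH, if_pos hb]; exact hG0 e
        nlinarith [mul_le_mul_of_nonneg_left this hHe]
      · simp [hH, hb]
    have e3 := le_of_mul_le_mul_left e2 hR
    have e4 : ∑ e, H e ≤ ∑ e, G e := by
      refine Finset.sum_le_sum fun e _ => ?_
      simp only [hH]
      split_ifs
      · exact le_rfl
      · exact hG0 e
    have e5 : ∑ e, G e ≤ (1 - β / 2) ^ (m - i0) * Fintype.card (Fin M → R) := by
      refine le_trans (le_of_eq ?_) ih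
      rw [Finset.sum_filter]
    have hb2 : 0 ≤ 1 - β / 2 := by linarith
    calc _ = ∑ e, H e * (1 - κ m e / 2) := by convert e1
      _ ≤ (1 - β / 2) * ∑ e, H e := e3
      _ ≤ (1 - β / 2) * ((1 - β / 2) ^ (m - i0) * Fintype.card (Fin M → R)) :=
          mul_le_mul_of_nonneg_left (e4.trans e5) hb2
      _ = _ := by
          rw [Nat.succ_sub hm, pow_succ]; ring

lemma transfer_backward (i0 : ℕ) (κ : ℕ → (Fin M → R) → ℝ)
    (Qv : (Fin M → R) → Prop) (η : ℝ) (hη : 0 ≤ η)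
    (h01 : ∀ i e, 0 ≤ κ i e ∧ κ i e ≤ 1)
    (hsym : ∀ i (a b : Fin M) e, a.val < i → b.val < i → κ i (e ∘ Equiv.swap a b) = κ i e)
    (hQη : ∀ i (h : i < M) e, i0 ≤ i → Qv e →
      ∑ j ∈ (Finset.univ : Finset (Fin M)).filter (fun j => j.val ≤ i),
        κ i (e ∘ Equiv.swap j ⟨i, h⟩) ≤ η * (i + 1))
    (m : ℕ) (hm : i0 ≤ m) (hmM : m ≤ M) :
    ∀ g : (Fin M → R) → ℝ, (∀ e, 0 ≤ g e) → (∀ e, ¬ Qv e → g e = 0) →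
      (∀ (a b : Fin M) e, a.val < m → b.val < m → g (e ∘ Equiv.swap a b) = g e) →
      ∑ e, g e * ∏ i ∈ Finset.Ico i0 m, (1 + κ i e) ≤ (1 + η) ^ (m - i0) * ∑ e, g e := by
  classical
  induction m, hm using Nat.le_induction with
  | base => intro g _ _ _; simp
  | succ m hm ih =>
    intro g hg0 hgQ hgs
    have hmM' : m < M := by omega
    have h1 := ih (by omega) (fun e => g e * (1 + κ m e))
      (fun e => mul_nonneg (hg0 e) (by linarith [(h01 m e).1]))
      (fun e he => by simp [hgQ e he])
      (fun a b e ha hb => by rw [hgs a b e (by omega) (by omega), hsym m a b e ha hb])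
    have e0 : ∑ e, g e * ∏ i ∈ Finset.Ico i0 (m + 1), (1 + κ i e)
        = ∑ e, g e * (1 + κ m e) * ∏ i ∈ Finset.Ico i0 m, (1 + κ i e) := by
      refine Finset.sum_congr rfl fun e _ => ?_
      rw [Finset.prod_Ico_succ_top hm]; ring
    rw [e0]
    refine h1.trans ?_
    have hfc : ((Finset.univ : Finset (Fin M)).filter (fun j => j.val ≤ m)).card = m + 1 := by
      have : (Finset.univ : Finset (Fin M)).filter (fun j => j.val ≤ m)
          = Finset.Iic (⟨m, hmM'⟩ : Fin M) := by
        ext j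
        simp [Fin.le_def]
      rw [this]; simp
    have h2 : (m + 1 : ℝ) * ∑ e, g e * κ m e ≤ (m + 1 : ℝ) * (η * ∑ e, g e) := by
      have h3 : ∀ j ∈ (Finset.univ : Finset (Fin M)).filter (fun j => j.val ≤ m),
          ∑ e, g e * κ m e = ∑ e, g e * κ m (e ∘ Equiv.swap j ⟨m, hmM'⟩) := by
        intro j hj
        have hj' : j.val ≤ m := (Finset.mem_filter.1 hj).2
        rw [← sum_comp_perm (Equiv.swap j ⟨m, hmM'⟩)]
        refine Finset.sum_congr rfl fun e _ => ?_
        rw [hgs j ⟨m, hmM'⟩ e (by omega) (by simp)]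
      have h4 := Finset.sum_congr rfl h3
      rw [Finset.sum_const, hfc, nsmul_eq_mul, Finset.sum_comm] at h4
      push_cast at h4
      rw [h4, Finset.mul_sum, Finset.mul_sum]
      refine Finset.sum_le_sum fun e _ => ?_
      rw [← Finset.mul_sum]
      by_cases hq : Qv e
      · have := mul_le_mul_of_nonneg_left (hQη m hmM' e hm hq) (hg0 e)
        linarith
      · simp [hgQ e hq]
    have h5 := le_of_mul_le_mul_left h2 (by positivity)
    have h6 : ∑ e, g e * (1 + κ m e) ≤ (1 + η) * ∑ e, g e := by
      simp only [mul_add, mul_one, Finset.sum_add_distrib]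
      linarith
    calc _ ≤ (1 + η) ^ (m - i0) * ((1 + η) * ∑ e, g e) :=
          mul_le_mul_of_nonneg_left h6 (by positivity)
      _ = _ := by rw [Nat.succ_sub hm, pow_succ]; ring

open scoped Classical in
theorem transfer [Nonempty R] (i0 : ℕ) (hi0 : i0 ≤ M) (κ : ℕ → (Fin M → R) → ℝ)
    (Ev : ℕ → (Fin M → R) → Prop) (Qv : (Fin M → R) → Prop)
    (β η : ℝ) (hβ : β ≤ 2) (hη : 0 ≤ η)
    (h01 : ∀ i e, 0 ≤ κ i e ∧ κ i e ≤ 1)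
    (hdep : ∀ i (j : Fin M) e x, i < j.val → κ i (update e j x) = κ i e)
    (hEdep : ∀ i (j : Fin M) e x, i ≤ j.val → (Ev i (update e j x) ↔ Ev i e))
    (hEβ : ∀ i (h : i < M) e, i0 ≤ i → Ev i e →
      β * Fintype.card R ≤ ∑ x, κ i (update e ⟨i, h⟩ x))
    (hsym : ∀ i (a b : Fin M) e, a.val < i → b.val < i → κ i (e ∘ Equiv.swap a b) = κ i e)
    (hQsym : ∀ (a b : Fin M) e, Qv (e ∘ Equiv.swap a b) ↔ Qv e)
    (hQη : ∀ i (h : i < M) e, i0 ≤ i → Qv e →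
      ∑ j ∈ (Finset.univ : Finset (Fin M)).filter (fun j => j.val ≤ i),
        κ i (e ∘ Equiv.swap j ⟨i, h⟩) ≤ η * (i + 1)) :
    (((Finset.univ : Finset (Fin M → R)).filter
      (fun e => Qv e ∧ ∀ i ∈ Finset.Ico i0 M, Ev i e)).card : ℝ) ^ 2 ≤
        ((1 - β / 2) * (1 + η)) ^ (M - i0) * (Fintype.card (Fin M → R) : ℝ) ^ 2 := by
  have hF := transfer_forward i0 κ Ev β hβ h01 hdep hEdep hEβ M hi0 le_rfl
  have hB := transfer_backward i0 κ Qv η hη h01 hsym hQη M hi0 le_rfl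
    (fun e => if Qv e then 1 else 0) (fun e => by split_ifs <;> norm_num)
    (fun e he => by simp [he]) (fun a b e _ _ => by simp only [hQsym a b e])
  set Bd := (Finset.univ : Finset (Fin M → R)).filter
      (fun e => Qv e ∧ ∀ i ∈ Finset.Ico i0 M, Ev i e) with hBd
  set P1 : (Fin M → R) → ℝ := fun e => ∏ i ∈ Finset.Ico i0 M, (1 - κ i e / 2) with hP1
  set P2 : (Fin M → R) → ℝ := fun e => ∏ i ∈ Finset.Ico i0 M, (1 + κ i e) with hP2
  have hP1n : ∀ e, 0 ≤ P1 e := fun e => Finset.prod_nonneg fun i _ => by linarith [(h01 i e).2]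
  have hP2n : ∀ e, 0 ≤ P2 e := fun e => Finset.prod_nonneg fun i _ => by linarith [(h01 i e).1]
  have hPP : ∀ e, 1 ≤ P1 e * P2 e := by
    intro e
    simp only [hP1, hP2]
    rw [← Finset.prod_mul_distrib]
    refine Finset.prod_induction _ (fun x => (1:ℝ) ≤ x) (fun a b ha hb => by nlinarith) le_rfl fun i _ => ?_
    have := h01 i e
    nlinarith
  have hCS := Finset.sum_sq_le_sum_mul_sum_of_sq_le_mul Bd (r := fun _ => (1:ℝ)) (f := P1) (g := P2)
    (fun e _ => hP1n e) (fun e _ => hP2n e) (fun e _ => by simpa using hPP e)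
  have hF' : ∑ e ∈ Bd, P1 e ≤ (1 - β / 2) ^ (M - i0) * Fintype.card (Fin M → R) := by
    refine le_trans (Finset.sum_le_sum_of_subset_of_nonneg ?_ (fun e _ _ => hP1n e)) hF
    intro e he
    rw [hBd, Finset.mem_filter] at he
    exact Finset.mem_filter.2 ⟨he.1, he.2.2⟩
  have hB' : ∑ e ∈ Bd, P2 e ≤ (1 + η) ^ (M - i0) * Fintype.card (Fin M → R) := by
    have a1 : ∑ e ∈ Bd, P2 e ≤ ∑ e, (if Qv e then (1:ℝ) else 0) * P2 e := by
      have : ∀ e ∈ Bd, P2 e = (if Qv e then (1:ℝ) else 0) * P2 e := by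
        intro e he
        rw [hBd, Finset.mem_filter] at he
        simp [he.2.1]
      rw [Finset.sum_congr rfl this]
      refine Finset.sum_le_sum_of_subset_of_nonneg (Finset.subset_univ _) fun e _ _ => ?_
      exact mul_nonneg (by split_ifs <;> norm_num) (hP2n e)
    have a2 : ∑ e : Fin M → R, (if Qv e then (1:ℝ) else 0) ≤ Fintype.card (Fin M → R) := by
      calc _ ≤ ∑ e : Fin M → R, (1:ℝ) := Finset.sum_le_sum fun e _ => by split_ifs <;> norm_num
        _ = _ := by simp
    exact a1.trans (hB.trans (mul_le_mul_of_nonneg_left a2 (by positivity)))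
  have hnn : 0 ≤ ∑ e ∈ Bd, P2 e := Finset.sum_nonneg fun e _ => hP2n e
  have h1 : (∑ e ∈ Bd, (1:ℝ)) = Bd.card := by simp
  rw [h1] at hCS
  have hb2 : 0 ≤ 1 - β / 2 := by linarith
  calc (Bd.card : ℝ) ^ 2 ≤ (∑ e ∈ Bd, P1 e) * ∑ e ∈ Bd, P2 e := hCS
    _ ≤ ((1 - β / 2) ^ (M - i0) * Fintype.card (Fin M → R)) *
        ((1 + η) ^ (M - i0) * Fintype.card (Fin M → R)) :=
        mul_le_mul hF' hB' hnn (by positivity)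
    _ = _ := by rw [mul_pow]; ring

end Transfer

section Blowup
open Function

lemma mgf_one {R : Type*} [Fintype R] [Nonempty R] (f : R → ℝ) (hf : ∀ x y, |f x - f y| ≤ 1)
    (s : ℝ) : ∑ x, Real.exp (s * f x) ≤
      Fintype.card R * Real.exp (s * ((∑ x, f x) / Fintype.card R) + s ^ 2 / 2) := by
  have hR : (0 : ℝ) < Fintype.card R := by exact_mod_cast Fintype.card_pos
  set μ := (∑ x, f x) / Fintype.card R with hμ
  have hμ' : ∑ x, f x = Fintype.card R * μ := by rw [hμ]; field_simp
  have hdev : ∀ x, |f x - μ| ≤ 1 := by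
    intro x
    have h1 : ∀ y, f y ≤ f x + 1 := fun y => by linarith [(abs_le.1 (hf y x)).2]
    have h2 : ∀ y, f x - 1 ≤ f y := fun y => by linarith [(abs_le.1 (hf y x)).1]
    have h3 := Finset.sum_le_sum (s := Finset.univ) fun y _ => h1 y
    have h4 := Finset.sum_le_sum (s := Finset.univ) fun y _ => h2 y
    simp only [Finset.sum_const, Finset.card_univ, nsmul_eq_mul] at h3 h4
    rw [hμ'] at h3 h4
    have h5 := le_of_mul_le_mul_left h3 hR
    have h6 := le_of_mul_le_mul_left h4 hR
    rw [abs_le]; constructor <;> linarith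
  have h1 : ∀ x, Real.exp (s * f x) ≤
      Real.exp (s * μ) * (Real.cosh s + (f x - μ) * Real.sinh s) := by
    intro x
    have := Real.exp_mul_le_cosh_add_mul_sinh (hdev x) s
    calc Real.exp (s * f x) = Real.exp (s * μ) * Real.exp ((f x - μ) * s) := by
          rw [← Real.exp_add]; congr 1; ring
      _ ≤ _ := mul_le_mul_of_nonneg_left this (Real.exp_pos _).le
  refine (Finset.sum_le_sum fun x _ => h1 x).trans ?_
  rw [← Finset.mul_sum, Finset.sum_add_distrib, ← Finset.sum_mul, Finset.sum_sub_distrib, hμ']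
  simp only [Finset.sum_const, Finset.card_univ, nsmul_eq_mul]
  rw [Real.exp_add]
  have := Real.cosh_le_exp_half_sq s
  have h2 := mul_le_mul_of_nonneg_left this (mul_pos hR (Real.exp_pos (s * μ))).le
  nlinarith [h2]

lemma mgf_prod {R : Type*} [Fintype R] [Nonempty R] (M : ℕ) : ∀ (f : (Fin M → R) → ℝ)
    (_ : ∀ e i x, |f (update e i x) - f e| ≤ 1)
    (s : ℝ), ∑ e, Real.exp (s * f e) ≤ Fintype.card (Fin M → R) *
      Real.exp (s * ((∑ e, f e) / Fintype.card (Fin M → R)) + M * s ^ 2 / 2) := by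
  induction M with
  | zero =>
    intro f hf s
    simp
  | succ M ih =>
    intro f hf s
    have hR : (0 : ℝ) < Fintype.card R := by exact_mod_cast Fintype.card_pos
    have hO : (0 : ℝ) < Fintype.card (Fin M → R) := by exact_mod_cast Fintype.card_pos
    have split : ∀ g : (Fin (M + 1) → R) → ℝ,
        ∑ e, g e = ∑ x : R, ∑ e : Fin M → R, g (Fin.cons x e) := by
      intro g
      rw [← Fintype.sum_prod_type']
      exact (Fintype.sum_equiv (Fin.consEquiv (fun _ => R)) _ _ (fun y => rfl)).symm
    have hcard : (Fintype.card (Fin (M + 1) → R) : ℝ) = Fintype.card R * Fintype.card (Fin M → R) := by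
      simp only [Fintype.card_fun, Fintype.card_fin]
      push_cast
      rw [pow_succ]; ring
    set fb : R → ℝ := fun x => (∑ e : Fin M → R, f (Fin.cons x e)) / Fintype.card (Fin M → R)
      with hfb
    have h1 : ∀ x, ∑ e : Fin M → R, Real.exp (s * f (Fin.cons x e)) ≤
        Fintype.card (Fin M → R) * Real.exp (M * s ^ 2 / 2) * Real.exp (s * fb x) := by
      intro x
      have := ih (fun e => f (Fin.cons x e)) (fun e i y => by
        rw [Fin.cons_update]; exact hf _ _ _) s
      refine this.trans (le_of_eq ?_)
      rw [Real.exp_add]; ring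
    have h2 : ∀ x y, |fb x - fb y| ≤ 1 := by
      intro x y
      simp only [hfb]
      rw [← sub_div, ← Finset.sum_sub_distrib, abs_div, abs_of_pos hO, div_le_one hO]
      refine (Finset.abs_sum_le_sum_abs _ _).trans ?_
      calc ∑ e : Fin M → R, |f (Fin.cons x e) - f (Fin.cons y e)| ≤ ∑ e : Fin M → R, (1:ℝ) := by
            refine Finset.sum_le_sum fun e _ => ?_
            have := hf (Fin.cons y e) 0 x
            rwa [Fin.update_cons_zero] at this
        _ = _ := by simp
    have h3 := mgf_one fb h2 s
    rw [split]
    refine (Finset.sum_le_sum fun x _ => h1 x).trans ?_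
    rw [← Finset.mul_sum]
    refine (mul_le_mul_of_nonneg_left h3 (by positivity)).trans (le_of_eq ?_)
    have e1 : (∑ x, fb x) / Fintype.card R = (∑ e, f e) / Fintype.card (Fin (M + 1) → R) := by
      rw [split, hcard, hfb, ← Finset.sum_div, div_div, mul_comm (Fintype.card R : ℝ)]
    rw [e1, hcard]
    have e2 : Real.exp (s * ((∑ e, f e) / (Fintype.card R * Fintype.card (Fin M → R)))
        + (M + 1 : ℕ) * s ^ 2 / 2) = Real.exp (M * s ^ 2 / 2) *
        Real.exp (s * ((∑ e, f e) / (Fintype.card R * Fintype.card (Fin M → R))) + s ^ 2 / 2) := by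
      rw [← Real.exp_add]; congr 1; push_cast; ring
    rw [e2]; ring

theorem blowup {R : Type*} [Fintype R] [DecidableEq R] [Nonempty R] {M : ℕ} (hM : 0 < M)
    (A : Finset (Fin M → R)) (a d : ℝ) (ha : 0 < a)
    (hA : Real.exp (-a) * Fintype.card (Fin M → R) ≤ A.card)
    (hd : 2 * Real.sqrt (2 * M * a) ≤ d) :
    (((Finset.univ : Finset (Fin M → R)).filter
      (fun e => ∀ e' ∈ A, d < hammingDist e e')).card : ℝ) ≤
      Real.exp (-a) * Fintype.card (Fin M → R) := by
  have hO : (0 : ℝ) < Fintype.card (Fin M → R) := by exact_mod_cast Fintype.card_pos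
  have hM0 : (0 : ℝ) < M := by exact_mod_cast hM
  have hAne : A.Nonempty := by
    rw [← Finset.card_pos]
    have : (0 : ℝ) < A.card := lt_of_lt_of_le (by positivity) hA
    exact_mod_cast this
  set f : (Fin M → R) → ℕ := fun e => A.inf' hAne (fun e' => hammingDist e e') with hf
  have hf1 : ∀ e i x, f (update e i x) ≤ f e + 1 := by
    intro e i x
    obtain ⟨e', he', hee⟩ := Finset.exists_mem_eq_inf' hAne (fun e' => hammingDist e e')
    have h1 : f (update e i x) ≤ hammingDist (update e i x) e' := Finset.inf'_le _ he'
    have h2 := hammingDist_triangle (update e i x) e e'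
    have h3 : hammingDist (update e i x) e ≤ 1 := by
      unfold hammingDist
      refine (Finset.card_le_card (t := {i}) ?_).trans (by simp)
      intro j hj
      simp only [Finset.mem_filter, Finset.mem_univ, true_and] at hj
      simp only [Finset.mem_singleton]
      by_contra hji
      exact hj (update_of_ne hji _ _)
    have h4 : f e = hammingDist e e' := hee
    omega
  have hf2 : ∀ e i x, |(f (update e i x) : ℝ) - f e| ≤ 1 := by
    intro e i x
    have h1 := hf1 e i x
    have h2 := hf1 (update e i x) i (e i)
    simp only [update_idem, update_eq_self] at h2
    have h1' : (f (update e i x) : ℝ) ≤ f e + 1 := by exact_mod_cast h1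
    have h2' : (f e : ℝ) ≤ f (update e i x) + 1 := by exact_mod_cast h2
    rw [abs_le]; constructor <;> linarith
  set s : ℝ := Real.sqrt (2 * a / M) with hs
  have hs0 : 0 ≤ s := Real.sqrt_nonneg _
  have hs2 : M * s ^ 2 = 2 * a := by
    rw [hs, Real.sq_sqrt (by positivity)]; field_simp
  have hsd : 4 * a ≤ s * d := by
    have h1 : s * Real.sqrt (2 * M * a) = 2 * a := by
      rw [hs, ← Real.sqrt_mul (by positivity)]
      rw [show 2 * a / M * (2 * M * a) = (2 * a) ^ 2 by field_simp]
      exact Real.sqrt_sq (by positivity)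
    calc 4 * a = s * (2 * Real.sqrt (2 * M * a)) := by linarith
      _ ≤ _ := mul_le_mul_of_nonneg_left hd hs0
  have m1 := mgf_prod M (fun e => (f e : ℝ)) hf2 s
  have m2 := mgf_prod M (fun e => (f e : ℝ)) hf2 (-s)
  set μ := (∑ e, (f e : ℝ)) / Fintype.card (Fin M → R) with hμ
  set Bd := (Finset.univ : Finset (Fin M → R)).filter (fun e => ∀ e' ∈ A, d < hammingDist e e')
    with hBd
  have l1 : Bd.card * Real.exp (s * d) ≤ ∑ e, Real.exp (s * (f e : ℝ)) := by
    calc Bd.card * Real.exp (s * d) = ∑ e ∈ Bd, Real.exp (s * d) := by simp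
      _ ≤ ∑ e ∈ Bd, Real.exp (s * (f e : ℝ)) := by
          refine Finset.sum_le_sum fun e he => ?_
          refine Real.exp_le_exp.2 (mul_le_mul_of_nonneg_left ?_ hs0)
          obtain ⟨e', he', hee⟩ := Finset.exists_mem_eq_inf' hAne (fun e' => hammingDist e e')
          have h4 : f e = hammingDist e e' := hee
          rw [h4]
          exact ((Finset.mem_filter.1 he).2 e' he').le
      _ ≤ _ := Finset.sum_le_sum_of_subset_of_nonneg (Finset.subset_univ _)
          fun e _ _ => (Real.exp_pos _).le
  have l2 : (A.card : ℝ) ≤ ∑ e, Real.exp (-s * (f e : ℝ)) := by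
    calc (A.card : ℝ) = ∑ e ∈ A, (1:ℝ) := by simp
      _ ≤ ∑ e ∈ A, Real.exp (-s * (f e : ℝ)) := by
          refine Finset.sum_le_sum fun e he => ?_
          have : f e ≤ hammingDist e e := Finset.inf'_le _ he
          rw [hammingDist_self] at this
          have : f e = 0 := by omega
          simp [this]
      _ ≤ _ := Finset.sum_le_sum_of_subset_of_nonneg (Finset.subset_univ _)
          fun e _ _ => (Real.exp_pos _).le
  have l3 := l1.trans m1
  have l4 := hA.trans (l2.trans m2)
  rw [hs2] at l3
  rw [show M * (-s) ^ 2 = M * s ^ 2 by ring, hs2, mul_comm] at l4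
  have l5 := le_of_mul_le_mul_left l4 hO
  rw [Real.exp_le_exp] at l5
  have l6 : Bd.card ≤ Fintype.card (Fin M → R) * Real.exp (s * μ + 2 * a / 2) / Real.exp (s * d) := by
    rw [le_div_iff₀ (Real.exp_pos _)]; exact l3
  refine l6.trans ?_
  rw [mul_div_assoc, ← Real.exp_sub, mul_comm]
  refine mul_le_mul_of_nonneg_right (Real.exp_le_exp.2 ?_) hO.le
  linarith

end Blowup

section SecondMoment
open Function

/-- the type of all possible edges -/
abbrev RR (n r : ℕ) := {A : Finset ℕ // A ∈ Kn n r}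

abbrev PMp {ι : Type*} [DecidableEq ι] (E : ι → Finset ℕ) (J : Finset ι) (W : Finset ℕ) : Prop :=
  (∀ i ∈ J, ∀ j ∈ J, i ≠ j → Disjoint (E i) (E j)) ∧ J.biUnion E = W

lemma RR_card (n r : ℕ) : Fintype.card (RR n r) = n.choose r := by
  simp [Kn]

lemma RR_mem {n r : ℕ} (x : RR n r) : x.1 ⊆ Finset.range n ∧ x.1.card = r := by
  have := x.2
  simpa [Kn, Finset.mem_powersetCard] using this

lemma PMp_insert {ι : Type*} [DecidableEq ι] (E : ι → Finset ℕ) (D : Finset ι) (j : ι) (hj : j ∉ D)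
    (W : Finset ℕ) : PMp E (insert j D) W ↔ E j ⊆ W ∧ PMp E D (W \ E j) := by
  constructor
  · intro ⟨h1, h2⟩
    refine ⟨?_, fun a ha b hb hab => h1 a (Finset.mem_insert_of_mem ha) b
      (Finset.mem_insert_of_mem hb) hab, ?_⟩
    · rw [← h2]; exact Finset.subset_biUnion_of_mem E (Finset.mem_insert_self _ _)
    · rw [← h2, Finset.biUnion_insert, Finset.union_sdiff_left]
      refine (Finset.sdiff_eq_self_of_disjoint ?_).symm
      rw [Finset.disjoint_biUnion_left]
      intro a ha
      exact h1 a (Finset.mem_insert_of_mem ha) j (Finset.mem_insert_self _ _)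
        (fun h => hj (h ▸ ha))
  · rintro ⟨h0, h1, h2⟩
    have hd : ∀ a ∈ D, Disjoint (E a) (E j) := by
      intro a ha
      have : E a ⊆ W \ E j := h2 ▸ Finset.subset_biUnion_of_mem E ha
      exact Finset.disjoint_of_subset_left this Finset.sdiff_disjoint
    refine ⟨?_, ?_⟩
    · intro a ha b hb hab
      rcases Finset.mem_insert.1 ha with rfl | ha'
      · rcases Finset.mem_insert.1 hb with rfl | hb'
        · exact absurd rfl hab
        · exact (hd b hb').symm
      · rcases Finset.mem_insert.1 hb with rfl | hb'
        · exact hd a ha'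
        · exact h1 a ha' b hb' hab
    · rw [Finset.biUnion_insert, h2, Finset.union_sdiff_of_subset h0]

/-- probability that `k` independent random edges form a perfect matching of a given set of size `rk` -/
noncomputable def piK (n r k : ℕ) : ℝ := ∏ i ∈ Finset.range k, ((r * (i + 1)).choose r : ℝ) / (n.choose r : ℝ)

lemma card_sub_RR {n r : ℕ} (W : Finset ℕ) (hW : W ⊆ Finset.range n) :
    ∑ x : RR n r, (if x.1 ⊆ W then (1:ℝ) else 0) = (W.card.choose r : ℝ) := by
  rw [Finset.sum_boole]
  congr 1
  rw [← Finset.card_powersetCard]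
  refine Finset.card_bij (fun x _ => x.1) ?_ ?_ ?_
  · intro x hx
    exact Finset.mem_powersetCard.2 ⟨(Finset.mem_filter.1 hx).2, (RR_mem x).2⟩
  · intro x _ y _ h; exact Subtype.ext h
  · intro A hA
    rw [Finset.mem_powersetCard] at hA
    exact ⟨⟨A, Finset.mem_powersetCard.2 ⟨hA.1.trans hW, hA.2⟩⟩, by simp [hA.1], rfl⟩

lemma avgPM {n r M : ℕ} (hn : 0 < n.choose r) (D : Finset (Fin M)) :
    ∀ (f : (Fin M → RR n r) → ℝ) (W : (Fin M → RR n r) → Finset ℕ),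
      (∀ j ∈ D, ∀ e x, f (update e j x) = f e) → (∀ j ∈ D, ∀ e x, W (update e j x) = W e) →
      (∀ e, f e ≠ 0 → W e ⊆ Finset.range n ∧ (W e).card = r * D.card) →
      ∑ e, f e * (if PMp (fun i => (e i).1) D (W e) then (1:ℝ) else 0)
        = (∑ e, f e) * piK n r D.card := by
  have hn0 : (0 : ℝ) < n.choose r := by exact_mod_cast hn
  induction D using Finset.induction_on with
  | empty =>
    intro f W _ _ h3
    simp only [Finset.card_empty, piK, Finset.range_zero, Finset.prod_empty, mul_one]
    refine Finset.sum_congr rfl fun e _ => ?_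
    by_cases hf : f e = 0
    · simp [hf]
    · have := (h3 e hf).2
      simp at this
      simp [PMp, this]
  | insert j D hj ih =>
    intro f W h1 h2 h3
    have hjm := Finset.mem_insert_self j D
    have hcard : (insert j D).card = D.card + 1 := Finset.card_insert_of_notMem hj
    set f' : (Fin M → RR n r) → ℝ := fun e => f e * (if (e j).1 ⊆ W e then 1 else 0) with hf'
    set W' : (Fin M → RR n r) → Finset ℕ := fun e => W e \ (e j).1 with hW'
    have hupd : ∀ i ∈ D, ∀ (e : Fin M → RR n r) x, update e i x j = e j := by
      intro i hi e x
      exact update_of_ne (fun h : j = i => hj (by rw [h]; exact hi)) _ _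
    have := ih f' W' (fun i hi e x => by
        simp only [hf', hupd i hi, h1 i (Finset.mem_insert_of_mem hi),
          h2 i (Finset.mem_insert_of_mem hi)])
      (fun i hi e x => by
        simp only [hW', hupd i hi, h2 i (Finset.mem_insert_of_mem hi)])
      (fun e he => by
        simp only [hf'] at he
        have he1 : f e ≠ 0 := left_ne_zero_of_mul he
        have he2 : (e j).1 ⊆ W e := by
          by_contra h
          simp [h] at he
        obtain ⟨a, b⟩ := h3 e he1
        refine ⟨Finset.sdiff_subset.trans a, ?_⟩
        simp only [hW']
        rw [Finset.card_sdiff_of_subset he2, b, hcard, (RR_mem (e j)).2, Nat.mul_succ]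
        omega)
    have e1 : ∑ e, f e * (if PMp (fun i => (e i).1) (insert j D) (W e) then (1:ℝ) else 0)
        = ∑ e, f' e * (if PMp (fun i => (e i).1) D (W' e) then (1:ℝ) else 0) := by
      refine Finset.sum_congr rfl fun e _ => ?_
      have hiff := PMp_insert (fun i => (e i).1) D j hj (W e)
      simp only [hf', hW']
      by_cases ha : (e j).1 ⊆ W e
      · by_cases hb : PMp (fun i => (e i).1) D (W e \ (e j).1)
        · rw [if_pos (hiff.2 ⟨ha, hb⟩), if_pos ha, if_pos hb]; ring
        · rw [if_neg (fun h => hb (hiff.1 h).2), if_neg hb]; ring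
      · rw [if_neg (fun h => ha (hiff.1 h).1), if_neg ha]; ring
    rw [e1, this]
    have e2 : (n.choose r : ℝ) * ∑ e, f' e = (∑ e, f e) * ((r * (D.card + 1)).choose r : ℝ) := by
      have := sum_update j f'
      rw [RR_card] at this
      rw [← this, Finset.sum_mul]
      refine Finset.sum_congr rfl fun e _ => ?_
      simp only [hf', h1 j hjm, h2 j hjm, update_self]
      rw [← Finset.mul_sum]
      by_cases hf : f e = 0
      · simp [hf]
      · rw [card_sub_RR _ (h3 e hf).1, (h3 e hf).2, hcard]
    rw [hcard]
    unfold piK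
    rw [Finset.prod_range_succ]
    field_simp
    linear_combination (∏ x ∈ Finset.range D.card, ((r * (x + 1)).choose r : ℝ) / (n.choose r : ℝ)) * e2

lemma piK_pos {n r k : ℕ} (hr : 0 < r) (hn : 0 < n.choose r) : 0 < piK n r k := by
  refine Finset.prod_pos fun i _ => ?_
  have h : 0 < (r * (i + 1)).choose r := Nat.choose_pos (Nat.le_mul_of_pos_right r (by omega))
  have h1 : (0:ℝ) < (r * (i + 1)).choose r := by exact_mod_cast h
  have h2 : (0:ℝ) < n.choose r := by exact_mod_cast hn
  positivity

lemma piK_closed {n r : ℕ} (hn : 0 < n.choose r) (k : ℕ) :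
    piK n r k * ((r.factorial : ℝ) * n.choose r) ^ k = ((r * k).factorial : ℝ) := by
  have h2 : (0:ℝ) < n.choose r := by exact_mod_cast hn
  induction k with
  | zero => simp [piK]
  | succ k ih =>
    have : piK n r (k + 1) = piK n r k * (((r * (k + 1)).choose r : ℝ) / (n.choose r : ℝ)) := by
      unfold piK; rw [Finset.prod_range_succ]
    rw [this]
    have h3 := Nat.choose_mul_factorial_mul_factorial (n := r * (k + 1)) (k := r)
      (Nat.le_mul_of_pos_right r (by omega))
    rw [show r * (k + 1) - r = r * k by rw [Nat.mul_succ]; omega] at h3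
    have h4 : ((r * (k + 1)).choose r : ℝ) * r.factorial * (r * k).factorial
        = ((r * (k + 1)).factorial : ℝ) := by exact_mod_cast h3
    rw [← h4, ← ih, pow_succ]
    field_simp

lemma piK_ratio {n r l t : ℕ} (hr : 0 < r) (hn : n = r * l) (hl : 0 < l) (ht : t ≤ l) :
    piK n r (l - t) * (n.factorial : ℝ) ≤
      piK n r l * ((n : ℝ) ^ (r * t) * ((n - r * t).factorial : ℝ)) := by
  have hrn : r ≤ n := by rw [hn]; exact Nat.le_mul_of_pos_right r hl
  have hc : 0 < n.choose r := Nat.choose_pos hrn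
  have h1 := piK_closed (r := r) hc (l - t)
  have h2 := piK_closed (r := r) hc l
  rw [← hn] at h2
  have h0 : r * (l - t) = n - r * t := by rw [hn, Nat.mul_sub]
  rw [h0] at h1
  set c : ℝ := (r.factorial : ℝ) * n.choose r with hcdef
  have hcpos : 0 < c := by
    have h2 : (0:ℝ) < n.choose r := by exact_mod_cast hc
    positivity
  have hcle : c ≤ (n : ℝ) ^ r := by
    have : r.factorial * n.choose r ≤ n ^ r := by
      rw [← Nat.descFactorial_eq_factorial_mul_choose]
      exact Nat.descFactorial_le_pow n r
    rw [hcdef]; exact_mod_cast this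
  have hct : c ^ t ≤ (n : ℝ) ^ (r * t) := by
    rw [pow_mul]; exact pow_le_pow_left₀ hcpos.le hcle t
  have hsplit : c ^ l = c ^ (l - t) * c ^ t := by rw [← pow_add]; congr 1; omega
  have hp := piK_pos (k := l) hr hc
  rw [← h2, ← h1, hsplit]
  have hp2 := piK_pos (k := l - t) hr hc
  calc _ = piK n r l * piK n r (l - t) * c ^ (l - t) * c ^ t := by ring
    _ ≤ piK n r l * piK n r (l - t) * c ^ (l - t) * (n : ℝ) ^ (r * t) :=
        mul_le_mul_of_nonneg_left hct (by positivity)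
    _ = _ := by ring

lemma piK_ratio_exp {n r l t : ℕ} (hr : 0 < r) (hn : n = r * l) (hl : 0 < l) (ht : t ≤ l) :
    piK n r (l - t) ≤ piK n r l * Real.exp (r * t) := by
  have h := piK_ratio hr hn hl ht
  have hrn : r ≤ n := by rw [hn]; exact Nat.le_mul_of_pos_right r hl
  have hc : 0 < n.choose r := Nat.choose_pos hrn
  have hle : r * t ≤ n := by rw [hn]; exact Nat.mul_le_mul_left r ht
  have h1 := fact_ratio (n - r * t) (r * t)
  rw [Nat.sub_add_cancel hle] at h1
  have hf : (0:ℝ) < n.factorial := by positivity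
  have hp := piK_pos (k := l) hr hc
  rw [← mul_le_mul_iff_left₀ hf]
  refine h.trans ?_
  refine (mul_le_mul_of_nonneg_left h1 hp.le).trans (le_of_eq ?_)
  push_cast; ring

lemma piK_ratio_small {n r l t : ℕ} (hr : 0 < r) (hn : n = r * l) (hl : 0 < l) (ht : 2 * t ≤ l) :
    piK n r (l - t) ≤ piK n r l * Real.exp (2 * (r * t : ℝ) ^ 2 / n) := by
  have h := piK_ratio hr hn hl (show t ≤ l by omega)
  have hrn : r ≤ n := by rw [hn]; exact Nat.le_mul_of_pos_right r hl
  have hc : 0 < n.choose r := Nat.choose_pos hrn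
  have hle : 2 * (r * t) ≤ n := by rw [hn]; nlinarith
  have h1 := desc_ratio_small n (r * t) hle (by omega)
  have h2 := Nat.factorial_mul_descFactorial (n := n) (k := r * t) (by omega)
  have h2' : ((n - r * t).factorial : ℝ) * (n.descFactorial (r * t) : ℝ) = n.factorial := by
    exact_mod_cast h2
  have hf : (0:ℝ) < n.factorial := by positivity
  have hp := piK_pos (k := l) hr hc
  rw [← mul_le_mul_iff_left₀ hf]
  refine h.trans ?_
  have h3 := mul_le_mul_of_nonneg_right h1 (show (0:ℝ) ≤ (n - r * t).factorial by positivity)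
  refine (mul_le_mul_of_nonneg_left h3 hp.le).trans (le_of_eq ?_)
  rw [← h2']
  push_cast; ring

lemma choose_sub_le (m l t : ℕ) (hl : l ≤ m) (ht : t ≤ l) :
    (m - t).choose (l - t) * m ^ t ≤ m.choose l * l ^ t := by
  induction t with
  | zero => simp
  | succ t ih =>
    have ih := ih (by omega)
    have h1 := Nat.add_one_mul_choose_eq (m - (t + 1)) (l - (t + 1))
    rw [show m - (t + 1) + 1 = m - t by omega, show l - (t + 1) + 1 = l - t by omega] at h1
    have hmt : 0 < m - t := by omega
    have h2 : m * (l - t) ≤ l * (m - t) := by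
      rw [Nat.mul_sub, Nat.mul_sub, mul_comm l m]
      have : l * t ≤ m * t := Nat.mul_le_mul_right t hl
      omega
    refine Nat.le_of_mul_le_mul_left ?_ hmt
    calc (m - t) * ((m - (t + 1)).choose (l - (t + 1)) * m ^ (t + 1))
        = ((m - t) * (m - (t + 1)).choose (l - (t + 1))) * m ^ t * m := by ring
      _ = (m - t).choose (l - t) * m ^ t * (m * (l - t)) := by rw [h1]; ring
      _ ≤ (m.choose l * l ^ t) * (l * (m - t)) := Nat.mul_le_mul ih h2
      _ = _ := by ring

/-- hypergeometric generating function bound -/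
lemma hyper_mgf {ι : Type*} [DecidableEq ι] (S J : Finset ι) (l m : ℕ) (hS : S.card = m)
    (hJS : J ⊆ S) (hJ : J.card = l) (hm : 0 < m) (y : ℝ) (hy : 0 ≤ y) :
    ∑ J' ∈ S.powersetCard l, (1 + y) ^ (J ∩ J').card ≤
      (m.choose l : ℝ) * Real.exp (y * l ^ 2 / m) := by
  have hlm : l ≤ m := by rw [← hJ, ← hS]; exact Finset.card_le_card hJS
  have hm0 : (0 : ℝ) < m := by exact_mod_cast hm
  have e1 : ∀ J' : Finset ι, (1 + y) ^ (J ∩ J').card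
      = ∑ T ∈ J.powerset, (if T ⊆ J' then y ^ T.card else 0) := by
    intro J'
    rw [add_comm, ← Finset.sum_pow_mul_eq_add_pow, ← Finset.sum_filter]
    refine Finset.sum_congr ?_ fun T _ => by simp
    ext T
    simp only [Finset.mem_powerset, Finset.mem_filter, Finset.subset_inter_iff]
  simp_rw [e1]
  rw [Finset.sum_comm]
  have e2 : ∀ T ∈ J.powerset, ∑ J' ∈ S.powersetCard l, (if T ⊆ J' then y ^ T.card else 0)
      ≤ (m.choose l : ℝ) * (y * (l / m)) ^ T.card := by
    intro T hT
    rw [Finset.mem_powerset] at hT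
    have hTl : T.card ≤ l := hJ ▸ Finset.card_le_card hT
    rw [← Finset.sum_filter, Finset.sum_const, nsmul_eq_mul]
    have c1 : ((S.powersetCard l).filter (fun J' => T ⊆ J')).card ≤ (m - T.card).choose (l - T.card) := by
      rw [← hS, ← Finset.card_sdiff_of_subset (hT.trans hJS), ← Finset.card_powersetCard]
      refine Finset.card_le_card_of_injOn (fun J' => J' \ T) ?_ ?_
      · intro J' hJ'
        have hJ' := Finset.mem_coe.1 hJ'
        rw [Finset.mem_filter, Finset.mem_powersetCard] at hJ'
        refine Finset.mem_coe.2 (Finset.mem_powersetCard.2 ⟨Finset.sdiff_subset_sdiff hJ'.1.1 subset_rfl, ?_⟩)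
        rw [Finset.card_sdiff_of_subset hJ'.2, hJ'.1.2]
      · intro A hA B hB hAB
        have hA := (Finset.mem_filter.1 (Finset.mem_coe.1 hA)).2
        have hB := (Finset.mem_filter.1 (Finset.mem_coe.1 hB)).2
        have hAB : A \ T = B \ T := hAB
        rw [← Finset.sdiff_union_of_subset hA, hAB, Finset.sdiff_union_of_subset hB]
    have c2 := choose_sub_le m l T.card hlm hTl
    have c3 : ((m - T.card).choose (l - T.card) : ℝ) * (m : ℝ) ^ T.card ≤ m.choose l * (l : ℝ) ^ T.card := by
      exact_mod_cast c2
    have c4 : ((m - T.card).choose (l - T.card) : ℝ) ≤ m.choose l * ((l : ℝ) / m) ^ T.card := by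
      rw [div_pow, ← mul_div_assoc, le_div_iff₀ (by positivity)]; exact c3
    have c5 : (((S.powersetCard l).filter (fun J' => T ⊆ J')).card : ℝ) ≤
        (m - T.card).choose (l - T.card) := by exact_mod_cast c1
    calc _ ≤ (m.choose l * ((l : ℝ) / m) ^ T.card) * y ^ T.card :=
          mul_le_mul_of_nonneg_right (c5.trans c4) (by positivity)
      _ = _ := by rw [mul_pow]; ring
  refine (Finset.sum_le_sum e2).trans ?_
  rw [← Finset.mul_sum]
  refine mul_le_mul_of_nonneg_left ?_ (by positivity)
  have e3 : ∑ T ∈ J.powerset, (y * (l / m : ℝ)) ^ T.card = (y * (l / m) + 1) ^ l := by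
    rw [← hJ, ← Finset.sum_pow_mul_eq_add_pow]
    exact Finset.sum_congr rfl fun T _ => by simp
  rw [e3]
  calc (y * ((l:ℝ) / m) + 1) ^ l ≤ (Real.exp (y * (l / m))) ^ l :=
        pow_le_pow_left₀ (by positivity) (Real.add_one_le_exp _) l
    _ = _ := by rw [← Real.exp_nat_mul]; congr 1; ring

end SecondMoment

section SecondMoment2
open Function

lemma PMp_biUnion_card {ι : Type*} [DecidableEq ι] {E : ι → Finset ℕ} {r : ℕ} (hE : ∀ i, (E i).card = r)
    {J : Finset ι} {W : Finset ℕ} (h : PMp E J W) : W.card = r * J.card := by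
  rw [← h.2, Finset.card_biUnion (fun i hi j hj hij => h.1 i hi j hj hij)]
  simp [hE, mul_comm]

noncomputable def XX {n r M : ℕ} (l : ℕ) (S : Finset (Fin M)) (e : Fin M → RR n r) : ℝ :=
  ∑ J ∈ S.powersetCard l, (if PMp (fun i => (e i).1) J (Finset.range n) then (1:ℝ) else 0)

lemma sum_PM_const {n r l M : ℕ} (hr : 0 < r) (hn : n = r * l) (hl : 0 < l) (J : Finset (Fin M)) (hJ : J.card = l) :
    ∑ e : Fin M → RR n r, (if PMp (fun i => (e i).1) J (Finset.range n) then (1:ℝ) else 0)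
      = Fintype.card (Fin M → RR n r) * piK n r l := by
  have hrn : r ≤ n := by rw [hn]; exact Nat.le_mul_of_pos_right r hl
  have hc : 0 < n.choose r := Nat.choose_pos hrn
  have h := avgPM (n := n) (r := r) hc J (fun _ => 1) (fun _ => Finset.range n)
    (by intros; rfl) (by intros; rfl) (by intro e _; exact ⟨subset_rfl, by simp [hJ, hn]⟩)
  simp only [one_mul] at h
  rw [h, hJ]; simp

lemma pair_PM {n r l M : ℕ} (hr : 0 < r) (hn : n = r * l) (hl : 0 < l) (J J' : Finset (Fin M))
    (hJ : J.card = l) (hJ' : J'.card = l) :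
    ∑ e : Fin M → RR n r, (if PMp (fun i => (e i).1) J (Finset.range n) then (1:ℝ) else 0) *
        (if PMp (fun i => (e i).1) J' (Finset.range n) then (1:ℝ) else 0)
      ≤ Fintype.card (Fin M → RR n r) * piK n r l * piK n r (l - (J ∩ J').card) := by
  have hrn : r ≤ n := by rw [hn]; exact Nat.le_mul_of_pos_right r hl
  have hc : 0 < n.choose r := Nat.choose_pos hrn
  have hcard : (J' \ J).card = l - (J ∩ J').card := by
    rw [Finset.card_sdiff, hJ']
  have hle : (J ∩ J').card ≤ l := by rw [← hJ]; exact Finset.card_le_card Finset.inter_subset_left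
  have hinv : ∀ j ∈ J' \ J, ∀ (e : Fin M → RR n r) x, ∀ i ∈ J, update e j x i = e i := by
    intro j hj e x i hi
    refine update_of_ne (fun h : i = j => ?_) _ _
    rw [h] at hi
    exact (Finset.mem_sdiff.1 hj).2 hi
  have h := avgPM (n := n) (r := r) hc (J' \ J)
    (fun e => if PMp (fun i => (e i).1) J (Finset.range n) then (1:ℝ) else 0)
    (fun e => Finset.range n \ (J ∩ J').biUnion (fun i => (e i).1))
    (by
      intro j hj e x
      have hi := hinv j hj e x
      have : PMp (fun i => (update e j x i).1) J (Finset.range n) ↔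
          PMp (fun i => (e i).1) J (Finset.range n) := by
        have h2 : J.biUnion (fun i => (update e j x i).1) = J.biUnion (fun i => (e i).1) :=
          Finset.biUnion_congr rfl (fun i hi' => by rw [hi i hi'])
        unfold PMp
        rw [h2]
        refine and_congr_left fun _ => ?_
        refine forall₂_congr fun a ha => forall₂_congr fun b hb => ?_
        simp only [hi a ha, hi b hb]
      simp only [this])
    (by
      intro j hj e x
      have hi := hinv j hj e x
      have h2 : (J ∩ J').biUnion (fun i => (update e j x i).1) = (J ∩ J').biUnion (fun i => (e i).1) :=
        Finset.biUnion_congr rfl (fun i hi' => by rw [hi i (Finset.mem_inter.1 hi').1])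
      simp only [h2])
    (by
      intro e he
      have hP : PMp (fun i => (e i).1) J (Finset.range n) := by
        by_contra hcon; simp only [hcon, if_false] at he; exact he rfl
      refine ⟨Finset.sdiff_subset, ?_⟩
      have h1 : PMp (fun i => (e i).1) (J ∩ J') ((J ∩ J').biUnion (fun i => (e i).1)) :=
        ⟨fun a ha b hb => hP.1 a (Finset.mem_inter.1 ha).1 b (Finset.mem_inter.1 hb).1, rfl⟩
      have h2 := PMp_biUnion_card (fun i => (RR_mem (e i)).2) h1
      have h3 : (J ∩ J').biUnion (fun i => (e i).1) ⊆ Finset.range n := by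
        rw [← hP.2]; exact Finset.biUnion_subset_biUnion_of_subset_left _ Finset.inter_subset_left
      rw [Finset.card_sdiff_of_subset h3, h2, hcard, Finset.card_range, hn, Nat.mul_sub])
  rw [sum_PM_const hr hn hl J hJ, hcard] at h
  rw [← h]
  refine Finset.sum_le_sum fun e _ => ?_
  refine mul_le_mul_of_nonneg_left ?_ (by split_ifs <;> norm_num)
  split_ifs with h1 h2 h2
  · exact le_rfl
  · refine absurd ?_ h2
    refine ⟨fun a ha b hb => h1.1 a (Finset.mem_sdiff.1 ha).1 b (Finset.mem_sdiff.1 hb).1, ?_⟩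
    have hu : J' = (J ∩ J') ∪ (J' \ J) := by
      ext x; simp only [Finset.mem_union, Finset.mem_inter, Finset.mem_sdiff]; tauto
    have h3 : Finset.range n = (J ∩ J').biUnion (fun i => (e i).1) ∪ (J' \ J).biUnion (fun i => (e i).1) := by
      rw [← Finset.union_biUnion, ← hu, h1.2]
    rw [h3, Finset.union_sdiff_left]
    refine (Finset.sdiff_eq_self_of_disjoint ?_).symm
    rw [Finset.disjoint_biUnion_left]
    intro a ha
    rw [Finset.disjoint_biUnion_right]
    intro b hb
    rw [Finset.mem_sdiff] at ha
    rw [Finset.mem_inter] at hb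
    exact h1.1 a ha.1 b hb.2 (fun h => ha.2 (h ▸ hb.1))
  · norm_num
  · norm_num

lemma second_moment {n r l M m t0 : ℕ} (hr : 0 < r) (hn : n = r * l) (hl : 0 < l) (S : Finset (Fin M))
    (hS : S.card = m) (hm : 0 < m) (ht0 : 2 * t0 ≤ l)
    (ht : (Real.exp (r + 1) - 1) * l ^ 2 / m ≤ t0) :
    (∑ e : Fin M → RR n r, XX l S e = Fintype.card (Fin M → RR n r) * (m.choose l * piK n r l)) ∧
    (∑ e : Fin M → RR n r, XX l S e ^ 2 ≤ Fintype.card (Fin M → RR n r) *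
      ((Real.exp (2 * (r * t0 : ℝ) ^ 2 / n) + 1) * (m.choose l * piK n r l) ^ 2)) := by
  have hrn : r ≤ n := by rw [hn]; exact Nat.le_mul_of_pos_right r hl
  have hc : 0 < n.choose r := Nat.choose_pos hrn
  have hp := piK_pos (k := l) hr hc
  constructor
  · unfold XX
    rw [Finset.sum_comm]
    rw [Finset.sum_congr rfl (fun J hJ => sum_PM_const hr hn hl J (Finset.mem_powersetCard.1 hJ).2)]
    rw [Finset.sum_const, Finset.card_powersetCard, hS, nsmul_eq_mul]; ring
  · have e1 : ∑ e : Fin M → RR n r, XX l S e ^ 2 = ∑ J ∈ S.powersetCard l, ∑ J' ∈ S.powersetCard l,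
        ∑ e : Fin M → RR n r, (if PMp (fun i => (e i).1) J (Finset.range n) then (1:ℝ) else 0) *
        (if PMp (fun i => (e i).1) J' (Finset.range n) then (1:ℝ) else 0) := by
      unfold XX
      simp_rw [sq, Finset.sum_mul_sum]
      rw [Finset.sum_comm]
      refine Finset.sum_congr rfl fun J _ => ?_
      rw [Finset.sum_comm]
    rw [e1]
    set C : ℝ := Real.exp (2 * (r * t0 : ℝ) ^ 2 / n) with hC
    have hn0 : (0:ℝ) < n := by
      have : 0 < n := by omega
      exact_mod_cast this
    have e2 : ∀ J ∈ S.powersetCard l, ∀ J' ∈ S.powersetCard l,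
        piK n r (l - (J ∩ J').card) ≤ piK n r l * (C + Real.exp (-t0) * (1 + (Real.exp (r + 1) - 1)) ^ (J ∩ J').card) := by
      intro J hJ J' hJ'
      set t := (J ∩ J').card with htdef
      have htl : t ≤ l := by
        rw [← (Finset.mem_powersetCard.1 hJ).2]; exact Finset.card_le_card Finset.inter_subset_left
      by_cases hc2 : t ≤ t0
      · refine (piK_ratio_small hr hn hl (by omega : 2 * t ≤ l)).trans ?_
        refine mul_le_mul_of_nonneg_left ?_ hp.le
        have : Real.exp (2 * (r * t : ℝ) ^ 2 / n) ≤ C := by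
          rw [hC]; apply Real.exp_le_exp.2
          have : (t:ℝ) ≤ t0 := by exact_mod_cast hc2
          gcongr
        have h2 : 0 ≤ Real.exp (-(t0:ℝ)) * (1 + (Real.exp (r + 1) - 1)) ^ t := by
          rw [add_sub_cancel]; positivity
        linarith
      · refine (piK_ratio_exp hr hn hl htl).trans ?_
        refine mul_le_mul_of_nonneg_left ?_ hp.le
        have hC0 : 0 < C := Real.exp_pos _
        rw [add_sub_cancel, ← Real.exp_nat_mul, ← Real.exp_add]
        have : Real.exp (r * t) ≤ Real.exp (-(t0:ℝ) + t * (r + 1)) := by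
          apply Real.exp_le_exp.2
          have : (t0:ℝ) ≤ t := by exact_mod_cast (by omega : t0 ≤ t)
          nlinarith
        linarith
    have hexp1 : (0:ℝ) ≤ Real.exp (r + 1) - 1 := by
      have : (1:ℝ) ≤ Real.exp (r+1) := Real.one_le_exp (by positivity)
      linarith
    have e3 : ∀ J ∈ S.powersetCard l, ∑ J' ∈ S.powersetCard l,
        ∑ e : Fin M → RR n r, (if PMp (fun i => (e i).1) J (Finset.range n) then (1:ℝ) else 0) *
        (if PMp (fun i => (e i).1) J' (Finset.range n) then (1:ℝ) else 0) ≤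
        Fintype.card (Fin M → RR n r) * piK n r l * (piK n r l * (m.choose l * (C + 1))) := by
      intro J hJ
      have hJ2 := Finset.mem_powersetCard.1 hJ
      have hmgf := hyper_mgf S J l m hS hJ2.1 hJ2.2 hm _ hexp1
      calc _ ≤ ∑ J' ∈ S.powersetCard l, Fintype.card (Fin M → RR n r) * piK n r l *
            (piK n r l * (C + Real.exp (-t0) * (1 + (Real.exp (r + 1) - 1)) ^ (J ∩ J').card)) := by
            refine Finset.sum_le_sum fun J' hJ' => ?_
            refine (pair_PM hr hn hl J J' hJ2.2 (Finset.mem_powersetCard.1 hJ').2).trans ?_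
            exact mul_le_mul_of_nonneg_left (e2 J hJ J' hJ') (by positivity)
        _ = Fintype.card (Fin M → RR n r) * piK n r l * (piK n r l * (m.choose l * C +
            Real.exp (-t0) * ∑ J' ∈ S.powersetCard l, (1 + (Real.exp (r + 1) - 1)) ^ (J ∩ J').card)) := by
            rw [← Finset.mul_sum, ← Finset.mul_sum, Finset.sum_add_distrib, ← Finset.mul_sum,
              Finset.sum_const, Finset.card_powersetCard, hS, nsmul_eq_mul]
        _ ≤ _ := by
            refine mul_le_mul_of_nonneg_left ?_ (by positivity)
            refine mul_le_mul_of_nonneg_left ?_ hp.le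
            have h4 : Real.exp (-(t0:ℝ)) * ∑ J' ∈ S.powersetCard l, (1 + (Real.exp (r + 1) - 1)) ^ (J ∩ J').card
                ≤ Real.exp (-(t0:ℝ)) * (m.choose l * Real.exp t0) := by
              refine mul_le_mul_of_nonneg_left (hmgf.trans ?_) (Real.exp_pos _).le
              refine mul_le_mul_of_nonneg_left (Real.exp_le_exp.2 ht) (by positivity)
            have h5 : Real.exp (-(t0:ℝ)) * (m.choose l * Real.exp t0) = m.choose l := by
              rw [mul_comm, mul_assoc, ← Real.exp_add]; simp
            rw [h5] at h4
            linarith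
    refine (Finset.sum_le_sum e3).trans ?_
    rw [Finset.sum_const, Finset.card_powersetCard, hS, nsmul_eq_mul]
    apply le_of_eq; ring

lemma paley_zygmund {Ω : Type*} [Fintype Ω] [DecidableEq Ω] [Nonempty Ω] (X : Ω → ℝ) (μ K a : ℝ) (hμ : 0 < μ)
    (h1 : ∑ e, X e = Fintype.card Ω * μ) (h2 : ∑ e, X e ^ 2 ≤ Fintype.card Ω * (K * μ ^ 2))
    (hK : 4 * K ≤ Real.exp a) :
    Real.exp (-a) * Fintype.card Ω ≤ ((Finset.univ.filter (fun e => μ / 2 ≤ X e)).card : ℝ) := by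
  set A := Finset.univ.filter (fun e => μ / 2 ≤ X e) with hA
  have hc : (0:ℝ) < Fintype.card Ω := by exact_mod_cast Fintype.card_pos
  have hsp : ∑ e, X e ≤ ∑ e ∈ A, X e + Fintype.card Ω * (μ / 2) := by
    rw [← Finset.sum_filter_add_sum_filter_not Finset.univ (fun e => μ / 2 ≤ X e)]
    rw [← hA]
    have : ∑ e ∈ Finset.univ.filter (fun e => ¬ μ / 2 ≤ X e), X e ≤
        ∑ e ∈ Finset.univ.filter (fun e => ¬ μ / 2 ≤ X e), μ / 2 :=
      Finset.sum_le_sum fun e he => (not_le.1 (Finset.mem_filter.1 he).2).le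
    have h3 : ∑ e ∈ Finset.univ.filter (fun e => ¬ μ / 2 ≤ X e), μ / 2 ≤ Fintype.card Ω * (μ / 2) := by
      rw [Finset.sum_const, nsmul_eq_mul]
      refine mul_le_mul_of_nonneg_right ?_ (by positivity)
      exact_mod_cast Finset.card_le_univ _
    linarith
  have hcs : (∑ e ∈ A, X e) ^ 2 ≤ A.card * ∑ e ∈ A, X e ^ 2 := sq_sum_le_card_mul_sum_sq
  have hsub : ∑ e ∈ A, X e ^ 2 ≤ ∑ e, X e ^ 2 :=
    Finset.sum_le_sum_of_subset_of_nonneg (Finset.subset_univ _) (fun e _ _ => sq_nonneg _)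
  have h4 : (Fintype.card Ω * (μ / 2)) ^ 2 ≤ (∑ e ∈ A, X e) ^ 2 :=
    pow_le_pow_left₀ (by positivity) (by linarith) 2
  have h5 : (Fintype.card Ω * (μ / 2)) ^ 2 ≤ A.card * (Fintype.card Ω * (K * μ ^ 2)) :=
    h4.trans (hcs.trans (mul_le_mul_of_nonneg_left (hsub.trans h2) (by positivity)))
  have h6 : (Fintype.card Ω : ℝ) ≤ A.card * (4 * K) := by
    have : (Fintype.card Ω : ℝ) * (Fintype.card Ω * μ ^ 2) ≤ A.card * (4 * K) * (Fintype.card Ω * μ ^ 2) := by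
      nlinarith
    exact le_of_mul_le_mul_right this (by positivity)
  have h7 : (Fintype.card Ω : ℝ) ≤ A.card * Real.exp a :=
    h6.trans (mul_le_mul_of_nonneg_left hK (by positivity))
  rw [Real.exp_neg, inv_mul_le_iff₀ (Real.exp_pos a)]
  linarith

end SecondMoment2

section Near
open Function

/-- number of perfect matchings of `W` using edges indexed by `S` -/
noncomputable def phi {n r M : ℕ} (e : Fin M → RR n r) (S : Finset (Fin M)) (W : Finset ℕ) : ℝ :=
  ((pmI (fun i => (e i).1) S W).card : ℝ)

lemma phi_nonneg {n r M : ℕ} (e : Fin M → RR n r) (S : Finset (Fin M)) (W : Finset ℕ) : 0 ≤ phi e S W := by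
  unfold phi; positivity

lemma phi_mono {n r M : ℕ} (e : Fin M → RR n r) {S S' : Finset (Fin M)} (h : S ⊆ S') (W : Finset ℕ) :
    phi e S W ≤ phi e S' W := by
  unfold phi
  have : (pmI (fun i => (e i).1) S W).card ≤ (pmI (fun i => (e i).1) S' W).card := by
    refine Finset.card_le_card fun J hJ => ?_
    rw [mem_pmI] at hJ ⊢
    exact ⟨hJ.1.trans h, hJ.2⟩
  exact_mod_cast this

lemma XX_eq_phi {n r l M : ℕ} (hr : 0 < r) (hn : n = r * l) (S : Finset (Fin M)) (e : Fin M → RR n r) :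
    XX l S e = phi e S (Finset.range n) := by
  unfold XX phi
  rw [Finset.sum_boole]
  congr 2
  ext J
  rw [mem_pmI, Finset.mem_filter, Finset.mem_powersetCard]
  constructor
  · intro h; exact ⟨h.1.1, h.2⟩
  · intro h
    refine ⟨⟨h.1, ?_⟩, h.2⟩
    have h2 := PMp_biUnion_card (fun i => (RR_mem (e i)).2) (show PMp (fun i => (e i).1) J (Finset.range n) from h.2)
    rw [Finset.card_range, hn] at h2
    exact (Nat.eq_of_mul_eq_mul_left hr h2).symm

lemma near_lemma {n r M d : ℕ} (S : Finset (Fin M)) (e e' : Fin M → RR n r) (T : ℝ) (hT : 0 < T)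
    (hd : hammingDist e e' ≤ d) (h : T ≤ phi e' S (Finset.range n)) :
    ∃ Z ⊆ Finset.range n, (∃ k, k ≤ d ∧ Z.card = r * k) ∧ T / 2 ^ d ≤ phi e S (Finset.range n \ Z) := by
  classical
  set D : Finset (Fin M) := Finset.univ.filter (fun i => e i ≠ e' i) with hD
  have hDc : D.card ≤ d := by
    rw [← show hammingDist e e' = D.card from rfl]; exact hd
  set P := pmI (fun i => (e' i).1) S (Finset.range n) with hP
  have hex : ∃ K ∈ D.powerset, T / 2 ^ d ≤ ((P.filter (fun J => J ∩ D = K)).card : ℝ) := by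
    by_contra hcon
    push Not at hcon
    have h1 : P.card = ∑ K ∈ D.powerset, (P.filter (fun J => J ∩ D = K)).card :=
      Finset.card_eq_sum_card_fiberwise (fun J _ => Finset.mem_coe.2 (Finset.mem_powerset.2 Finset.inter_subset_right))
    have h2 : (P.card : ℝ) < ∑ K ∈ D.powerset, T / 2 ^ d := by
      rw [h1]; push_cast
      exact Finset.sum_lt_sum_of_nonempty ⟨∅, Finset.mem_powerset.2 (Finset.empty_subset _)⟩ hcon
    rw [Finset.sum_const, Finset.card_powerset, nsmul_eq_mul] at h2
    have h3 : ((2 ^ D.card : ℕ) : ℝ) * (T / 2 ^ d) ≤ T := by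
      push_cast
      rw [← mul_div_assoc, div_le_iff₀ (by positivity), mul_comm]
      exact mul_le_mul_of_nonneg_left (pow_le_pow_right₀ (by norm_num) hDc) hT.le
    unfold phi at h
    linarith
  obtain ⟨K, hK, hKT⟩ := hex
  have hKD : K ⊆ D := Finset.mem_powerset.1 hK
  have hne : (P.filter (fun J => J ∩ D = K)).Nonempty := by
    rw [← Finset.card_pos]
    have : (0:ℝ) < ((P.filter (fun J => J ∩ D = K)).card : ℝ) := lt_of_lt_of_le (by positivity) hKT
    exact_mod_cast this
  obtain ⟨J0, hJ0⟩ := hne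
  rw [Finset.mem_filter, hP, mem_pmI] at hJ0
  obtain ⟨⟨hJS, hJd, hJu⟩, hJK⟩ := hJ0
  have hKJ : K ⊆ J0 := hJK ▸ Finset.inter_subset_left
  refine ⟨K.biUnion (fun i => (e' i).1), ?_, ⟨K.card, (Finset.card_le_card hKD).trans hDc, ?_⟩, ?_⟩
  · rw [← hJu]; exact Finset.biUnion_subset_biUnion_of_subset_left _ hKJ
  · exact PMp_biUnion_card (fun i => (RR_mem (e' i)).2) (J := K)
      ⟨fun a ha b hb => hJd a (hKJ ha) b (hKJ hb), rfl⟩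
  · refine hKT.trans ?_
    unfold phi
    have : (P.filter (fun J => J ∩ D = K)).card ≤
        (pmI (fun i => (e i).1) S (Finset.range n \ K.biUnion (fun i => (e' i).1))).card := by
      refine Finset.card_le_card_of_injOn (fun J => J \ D) ?_ ?_
      · intro J hJ
        have hJ := Finset.mem_coe.1 hJ
        rw [Finset.mem_filter, hP, mem_pmI] at hJ
        obtain ⟨⟨a1, a2, a3⟩, a4⟩ := hJ
        have heq : ∀ i ∈ J \ D, e i = e' i := by
          intro i hi
          have := (Finset.mem_sdiff.1 hi).2
          simpa [hD] using this
        refine Finset.mem_coe.2 (mem_pmI.2 ⟨Finset.sdiff_subset.trans a1, ?_, ?_⟩)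
        · intro a ha b hb hab
          simp only [heq a ha, heq b hb]
          exact a2 a (Finset.mem_sdiff.1 ha).1 b (Finset.mem_sdiff.1 hb).1 hab
        · have h1 : (J \ D).biUnion (fun i => (e i).1) = (J \ D).biUnion (fun i => (e' i).1) :=
            Finset.biUnion_congr rfl (fun i hi => by rw [heq i hi])
          show (J \ D).biUnion (fun i => (e i).1) = _
          rw [h1, ← a3, ← a4]
          have hu : J = (J ∩ D) ∪ (J \ D) := by
            ext x; simp only [Finset.mem_union, Finset.mem_inter, Finset.mem_sdiff]; tauto
          have h3 : J.biUnion (fun i => (e' i).1) = (J ∩ D).biUnion (fun i => (e' i).1) ∪ (J \ D).biUnion (fun i => (e' i).1) := by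
            rw [← Finset.union_biUnion, ← hu]
          rw [h3, Finset.union_sdiff_left]
          refine (Finset.sdiff_eq_self_of_disjoint ?_).symm
          rw [Finset.disjoint_biUnion_left]
          intro a ha
          rw [Finset.disjoint_biUnion_right]
          intro b hb
          rw [Finset.mem_sdiff] at ha
          rw [Finset.mem_inter] at hb
          exact a2 a ha.1 b hb.1 (fun h => ha.2 (h ▸ hb.2))
      · intro A hA B hB hAB
        have hA := (Finset.mem_filter.1 (Finset.mem_coe.1 hA)).2
        have hB := (Finset.mem_filter.1 (Finset.mem_coe.1 hB)).2
        have hAB : A \ D = B \ D := hAB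
        rw [← Finset.sdiff_union_inter A D, ← Finset.sdiff_union_inter B D, hAB, hA, hB]
    exact_mod_cast this

open scoped Classical in
/-- most sequences have many nearly perfect matchings -/
lemma near_most {n r l M m t0 d : ℕ} (hr : 0 < r) (hn : n = r * l) (hl : 0 < l) (S : Finset (Fin M))
    (hS : S.card = m) (hlm : l ≤ m) (hM : 0 < M) (ht0 : 2 * t0 ≤ l)
    (ht : (Real.exp (r + 1) - 1) * l ^ 2 / m ≤ t0) (a : ℝ) (ha : 0 < a)
    (hK : 4 * (Real.exp (2 * (r * t0 : ℝ) ^ 2 / n) + 1) ≤ Real.exp a)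
    (hd : 2 * Real.sqrt (2 * M * a) ≤ d) :
    ((Finset.univ.filter (fun e : Fin M → RR n r => ¬ ∃ Z ⊆ Finset.range n, (∃ k, k ≤ d ∧ Z.card = r * k) ∧
      (m.choose l * piK n r l) / 2 / 2 ^ d ≤ phi e S (Finset.range n \ Z))).card : ℝ)
      ≤ Real.exp (-a) * Fintype.card (Fin M → RR n r) := by
  have hrn : r ≤ n := by rw [hn]; exact Nat.le_mul_of_pos_right r hl
  have hc : 0 < n.choose r := Nat.choose_pos hrn
  have hp := piK_pos (k := l) hr hc
  haveI : Nonempty (RR n r) := by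
    rw [← Fintype.card_pos_iff, RR_card]; exact hc
  have hch : (0:ℝ) < m.choose l := by exact_mod_cast Nat.choose_pos hlm
  obtain ⟨s1, s2⟩ := second_moment hr hn hl S hS (by omega) ht0 ht
  have hA := paley_zygmund (fun e : Fin M → RR n r => XX l S e) (m.choose l * piK n r l) _ a (by positivity) s1 s2 hK
  have hb := blowup hM _ a d ha hA hd
  refine le_trans ?_ hb
  refine Nat.cast_le.2 (Finset.card_le_card fun e he => ?_)
  rw [Finset.mem_filter] at he ⊢
  refine ⟨he.1, fun e' he' => ?_⟩
  by_contra hcon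
  refine he.2 (near_lemma S e e' _ (half_pos (mul_pos hch hp)) (not_lt.1 ?_) ?_)
  · exact_mod_cast hcon
  · rw [← XX_eq_phi hr hn]; exact (Finset.mem_filter.1 he').2

end Near

section FewBad
open Function

def Large {n r M : ℕ} (T τ : ℝ) (K : ℕ) (e : Fin M → RR n r) (S : Finset (Fin M)) (W : Finset ℕ) : Prop :=
  W ⊆ Finset.range n ∧ ∃ k ≤ K, (Finset.range n \ W).card = r * k ∧ T * τ ^ k ≤ phi e S W

lemma logT_lower {n r l i0 : ℕ} (hr : 0 < r) (hn : n = r * l) (hl : 0 < l) (hi : l < i0) :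
    (l:ℝ) * Real.log (((i0:ℝ) - l) / l) - 1 - Real.log l - (r - 1) * l ≤
      Real.log (i0.choose l * piK n r l) := by
  have hrn : r ≤ n := by rw [hn]; exact Nat.le_mul_of_pos_right r hl
  have hc : 0 < n.choose r := Nat.choose_pos hrn
  have hp := piK_pos (k := l) hr hc
  have hch : (0:ℝ) < i0.choose l := by exact_mod_cast Nat.choose_pos hi.le
  have hl0 : (0:ℝ) < l := by exact_mod_cast hl
  have hn0 : (0:ℝ) < n := by
    have : 0 < n := by omega
    exact_mod_cast this
  have hil : (0:ℝ) < (i0:ℝ) - l := by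
    have : (l:ℝ) < i0 := by exact_mod_cast hi
    linarith
  -- binomial
  have h1 : ((i0:ℝ) - l) ^ l ≤ i0.choose l * l.factorial := by
    have h := Nat.pow_sub_le_descFactorial i0 l
    rw [Nat.descFactorial_eq_factorial_mul_choose] at h
    have h' : (((i0 + 1 - l : ℕ)) : ℝ) ^ l ≤ l.factorial * i0.choose l := by exact_mod_cast h
    have h2 : (i0:ℝ) - l ≤ ((i0 + 1 - l : ℕ) : ℝ) := by
      rw [Nat.cast_sub (by omega)]; push_cast; linarith
    calc _ ≤ (((i0 + 1 - l : ℕ)) : ℝ) ^ l := pow_le_pow_left₀ hil.le h2 l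
      _ ≤ _ := by linarith
  have h2 : Real.log (l.factorial) ≤ 1 + Real.log l + l * Real.log l - l := by
    refine le_trans (le_of_eq ?_) (sum_log_succ_le l hl)
    rw [← Real.log_prod (fun i _ => by positivity), ← Finset.prod_range_add_one_eq_factorial]
    push_cast; rfl
  have h3 : (l:ℝ) * Real.log ((i0:ℝ) - l) ≤ Real.log (i0.choose l) + Real.log l.factorial := by
    rw [← Real.log_mul hch.ne' (by positivity), ← Real.log_pow]
    exact Real.log_le_log (by positivity) h1
  have h4 : -(n:ℝ) ≤ Real.log (piK n r l) := by
    have a1 := piK_closed (r := r) hc l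
    rw [← hn] at a1
    have a2 := fact_ratio 0 n
    simp only [zero_add, Nat.factorial_zero, Nat.cast_one, mul_one] at a2
    have a3 : ((r.factorial : ℝ) * n.choose r) ^ l ≤ (n:ℝ) ^ n := by
      have : r.factorial * n.choose r ≤ n ^ r := by
        rw [← Nat.descFactorial_eq_factorial_mul_choose]
        exact Nat.descFactorial_le_pow n r
      have h' : ((r.factorial : ℝ) * n.choose r) ≤ (n:ℝ) ^ r := by exact_mod_cast this
      calc _ ≤ ((n:ℝ) ^ r) ^ l := pow_le_pow_left₀ (by positivity) h' l
        _ = _ := by rw [← pow_mul, ← hn]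
    have a4 : Real.exp (-(n:ℝ)) ≤ piK n r l := by
      rw [Real.exp_neg, inv_le_iff_one_le_mul₀' (Real.exp_pos _)]
      have h5 : (n:ℝ) ^ n ≤ (Real.exp n * piK n r l) * (n:ℝ) ^ n := by
        calc (n:ℝ) ^ n ≤ Real.exp n * n.factorial := a2
          _ = Real.exp n * (piK n r l * ((r.factorial : ℝ) * n.choose r) ^ l) := by rw [a1]
          _ ≤ Real.exp n * (piK n r l * (n:ℝ) ^ n) := by gcongr
          _ = _ := by ring
      have h6 : (0:ℝ) < (n:ℝ) ^ n := by positivity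
      exact le_of_mul_le_mul_right (by linarith) h6
    calc -(n:ℝ) = Real.log (Real.exp (-(n:ℝ))) := by rw [Real.log_exp]
      _ ≤ _ := Real.log_le_log (Real.exp_pos _) a4
  rw [Real.log_mul hch.ne' hp.ne', Real.log_div hil.ne' hl0.ne']
  have h5 : (n:ℝ) = r * l := by rw [hn]; push_cast; ring
  rw [h5] at h4
  nlinarith

lemma excI_mono {ι : Type*} [DecidableEq ι] (E : ι → Finset ℕ) {S S' : Finset ι} (h : S ⊆ S') :
    excI E S ⊆ excI E S' := by
  intro i hi
  unfold excI at *
  rw [Finset.mem_filter] at *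
  obtain ⟨h1, j, h2, h3⟩ := hi
  exact ⟨h h1, j, h h2, h3⟩

lemma phi_erase {n r M : ℕ} (hr : 0 < r) (e : Fin M → RR n r) (S : Finset (Fin M)) (W : Finset ℕ) (q : Fin M) :
    ((((pmI (fun i => (e i).1) S W).filter (fun J => q ∈ J)).card : ℕ) : ℝ) ≤ phi e (S.erase q) (W \ (e q).1) := by
  unfold phi
  have : ((pmI (fun i => (e i).1) S W).filter (fun J => q ∈ J)).card ≤
      (pmI (fun i => (e i).1) (S.erase q) (W \ (e q).1)).card := by
    refine Finset.card_le_card_of_injOn (fun J => J.erase q) ?_ ?_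
    · intro J hJ
      have hJ := Finset.mem_filter.1 (Finset.mem_coe.1 hJ)
      have h1 := mem_pmI.1 (pmI_erase hJ.1 hJ.2)
      have h2 := (mem_pmI.1 hJ.1).1
      exact Finset.mem_coe.2 (mem_pmI.2 ⟨Finset.erase_subset_erase _ h2, h1.2⟩)
    · intro A hA B hB hAB
      have hA := (Finset.mem_filter.1 (Finset.mem_coe.1 hA)).2
      have hB := (Finset.mem_filter.1 (Finset.mem_coe.1 hB)).2
      have hAB : A.erase q = B.erase q := hAB
      rw [← Finset.insert_erase hA, hAB, Finset.insert_erase hB]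
  exact_mod_cast this

/-- the drop event for a single edge `x` -/
def Drop {n r M : ℕ} (T τ : ℝ) (K : ℕ) (e : Fin M → RR n r) (S : Finset (Fin M)) (W : Finset ℕ) (x : RR n r) : Prop :=
  Large T τ K e S W ∧ x.1 ⊆ W ∧ phi e S (W \ x.1) < τ * phi e S W

set_option maxHeartbeats 1000000 in
open scoped Classical in
theorem few_bad {n r l M i0 K d : ℕ} (hr : 2 ≤ r) (hn : n = r * l) (hl : 0 < l) (hK : 2 * K ≤ l)
    (η γ c θ T τ : ℝ) (hη : 0 < η) (hη1 : η ≤ 1) (hγ : 0 < γ) (hγ1 : γ ≤ 1/4) (hc : 0 < c) (hc1 : c ≤ 1)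
    (hθ : 0 < θ) (hM : l ≤ M) (hτ : τ = c * l / M) (hi0 : (1 - 2 * γ) * M ≤ (i0:ℝ) - l)
    (hT : T = i0.choose l * piK n r l / 2 / 2 ^ d) (hθ2 : 6 * (l:ℝ) ≤ M * θ ^ (2 * (r - 1)))
    (hnum : 4 * γ * l + c * l + 4 * (r - 1) * θ * l + r * (1 + Real.log l) + (d + 1)
      + K * (r + Real.log (1 / c)) < η / 2 * (l - K))
    (e : Fin M → RR n r) (hexc : ((excI (fun i => (e i).1) Finset.univ).card : ℝ) ≤ l)
    (S : Finset (Fin M)) (W : Finset ℕ) :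
    ((S.filter (fun q => Drop T τ K e (S.erase q) W (e q))).card : ℝ) ≤ η * S.card := by
  set B := S.filter (fun q => Drop T τ K e (S.erase q) W (e q)) with hB
  by_contra hcon
  rw [not_le] at hcon
  have hl0 : (0:ℝ) < l := by exact_mod_cast hl
  have hlM : (l:ℝ) ≤ M := by exact_mod_cast hM
  have hM0 : (0:ℝ) < M := by linarith
  have hτ0 : 0 < τ := by rw [hτ]; positivity
  have hrn : r ≤ n := by rw [hn]; exact Nat.le_mul_of_pos_right r hl
  have hcn : 0 < n.choose r := Nat.choose_pos hrn
  have hp := piK_pos (k := l) (by omega : 0 < r) hcn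
  have hil : l < i0 := by
    have : (0:ℝ) < (i0:ℝ) - l := lt_of_lt_of_le (by nlinarith) hi0
    have : (l:ℝ) < i0 := by linarith
    exact_mod_cast this
  have hch : (0:ℝ) < i0.choose l := by exact_mod_cast Nat.choose_pos hil.le
  have hT0 : 0 < T := by rw [hT]; positivity
  have hBpos : 0 < B.card := by
    have : (0:ℝ) < B.card := lt_of_le_of_lt (by positivity) hcon
    exact_mod_cast this
  obtain ⟨q0, hq0⟩ := Finset.card_pos.1 hBpos
  obtain ⟨hq0S, ⟨hWV, k, hkK, hWk, hbig⟩, -, -⟩ := Finset.mem_filter.1 hq0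
  have hkl : 2 * k ≤ l := by omega
  set l' := l - k with hl'
  have hl'0 : 0 < l' := by omega
  have hWc : W.card = r * l' := by
    have := Finset.card_sdiff_of_subset hWV
    have h2 := Finset.card_le_card hWV
    rw [Finset.card_range] at this h2
    rw [hl', Nat.mul_sub, ← hn]
    omega
  have hPhi : T * τ ^ k ≤ phi e S W := hbig.trans (phi_mono e (Finset.erase_subset _ _) W)
  have hPhi0 : 0 < phi e S W := lt_of_lt_of_le (by positivity) hPhi
  set w : Fin M → ℝ := fun i => if i ∈ B then 1/2 else 1 with hw
  have hBS : B ⊆ S := Finset.filter_subset _ _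
  have hne : (pmI (fun i => (e i).1) S W).Nonempty := by
    rw [← Finset.card_pos]; unfold phi at hPhi0; exact_mod_cast hPhi0
  have hSM : (S.card : ℝ) ≤ M := by
    have := Finset.card_le_univ S
    simp at this
    exact_mod_cast this
  have hWt : ∑ i ∈ S, w i ≤ (1 - η / 2) * M := by
    have h1 : ∑ i ∈ S, w i = S.card - B.card / 2 := by
      have h2 : ∀ i ∈ S, w i = 1 - (if i ∈ B then (1/2:ℝ) else 0) := by
        intro i _; simp only [hw]; split_ifs <;> norm_num
      rw [Finset.sum_congr rfl h2, Finset.sum_sub_distrib, ← Finset.sum_filter,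
        Finset.filter_mem_eq_inter, Finset.inter_eq_right.2 hBS]
      simp; ring
    rw [h1]
    have h3 : (1 - η / 2) * S.card ≤ (1 - η / 2) * M := mul_le_mul_of_nonneg_left hSM (by linarith)
    linarith
  have hQ : ((excI (fun i => (e i).1) S).card : ℝ) ≤ l :=
    le_trans (Nat.cast_le.2 (Finset.card_le_card (excI_mono _ (Finset.subset_univ S)))) hexc
  have hent := entropy_bound (fun i => (e i).1) (by omega : 0 < r) hl'0 (fun i => (RR_mem (e i)).2) S W hWc w
    (fun i => by simp only [hw]; split_ifs <;> norm_num) (fun i => by simp only [hw]; split_ifs <;> norm_num)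
    l ((1 - η / 2) * M) hQ hWt hne
  have hl'R : (l':ℝ) = l - k := by rw [hl', Nat.cast_sub (by omega)]
  have hl'R0 : (0:ℝ) < l' := by exact_mod_cast hl'0
  have hk2 : 2 * (k:ℝ) ≤ l := by exact_mod_cast hkl
  have hkK' : (k:ℝ) ≤ K := by exact_mod_cast hkK
  -- the average term
  have havg : (∑ J ∈ pmI (fun i => (e i).1) S W, ∑ j ∈ J, - Real.log (w j)) /
      (pmI (fun i => (e i).1) S W).card ≤ c * l := by
    have hcp : (0:ℝ) < (pmI (fun i => (e i).1) S W).card := by exact_mod_cast Finset.card_pos.2 hne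
    rw [div_le_iff₀ hcp]
    have h1 : ∀ J ∈ pmI (fun i => (e i).1) S W, ∑ j ∈ J, - Real.log (w j) ≤
        ∑ q ∈ B, (if q ∈ J then (1:ℝ) else 0) := by
      intro J _
      have h2 : ∀ j ∈ J, - Real.log (w j) ≤ (if j ∈ B then (1:ℝ) else 0) := by
        intro j _
        simp only [hw]
        split_ifs
        · rw [one_div, Real.log_inv, neg_neg]
          have := Real.log_two_lt_d9
          linarith
        · simp
      refine (Finset.sum_le_sum h2).trans (le_of_eq ?_)
      rw [← Finset.sum_filter, ← Finset.sum_filter, Finset.filter_mem_eq_inter,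
        Finset.filter_mem_eq_inter, Finset.inter_comm]
    refine (Finset.sum_le_sum h1).trans ?_
    rw [Finset.sum_comm]
    have h3 : ∀ q ∈ B, ∑ J ∈ pmI (fun i => (e i).1) S W, (if q ∈ J then (1:ℝ) else 0) ≤ τ * phi e S W := by
      intro q hq
      rw [Finset.sum_boole]
      refine (phi_erase (by omega) e S W q).trans ?_
      have h4 := (Finset.mem_filter.1 hq).2.2.2
      refine h4.le.trans (mul_le_mul_of_nonneg_left (phi_mono e (Finset.erase_subset _ _) W) hτ0.le)
    refine (Finset.sum_le_sum h3).trans ?_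
    rw [Finset.sum_const, nsmul_eq_mul]
    have h5 : (B.card:ℝ) ≤ M := le_trans (Nat.cast_le.2 (Finset.card_le_card hBS)) hSM
    have h6 : (B.card:ℝ) * τ ≤ c * l := by
      calc (B.card:ℝ) * τ ≤ M * τ := mul_le_mul_of_nonneg_right h5 hτ0.le
        _ = c * l := by rw [hτ]; field_simp
    calc (B.card:ℝ) * (τ * phi e S W) = (B.card * τ) * phi e S W := by ring
      _ ≤ c * l * phi e S W := mul_le_mul_of_nonneg_right h6 hPhi0.le
      _ = _ := rfl
  have hs1 : ((r - 1 : ℕ) : ℝ) = r - 1 := by rw [Nat.cast_sub (by omega)]; norm_num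
  have hslb := sum_log_bound (r - 1) l' (by omega) hl'0 (1 + l / l') ((1 - η / 2) * M / l') θ
    (by positivity) (by
      have : 0 < (1 - η/2) := by linarith
      positivity) hθ (by
      have h1 : (l:ℝ) / l' ≤ 2 := by rw [div_le_iff₀ hl'R0]; linarith
      have h2 : (3:ℝ) ≤ (1 - η / 2) * M / l' * θ ^ (2 * (r - 1)) := by
        rw [div_mul_eq_mul_div, le_div_iff₀ hl'R0]
        have h3 : (1/2) * (M * θ ^ (2 * (r - 1))) ≤ (1 - η / 2) * M * θ ^ (2 * (r - 1)) := by
          rw [mul_assoc]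
          exact mul_le_mul_of_nonneg_right (by linarith) (by positivity)
        have : (l':ℝ) ≤ l := by rw [hl'R]; linarith [Nat.cast_nonneg (α := ℝ) k]
        linarith
      linarith)
  rw [hs1] at hslb
  have hup : Real.log (phi e S W) ≤ l' * Real.log ((1 - η / 2) * M / l') + (r - 1) * (1 + Real.log l' - l')
      + 4 * (r - 1) * θ * l' + c * l := by
    have : Real.log (phi e S W) ≤ _ := hent
    linarith
  have hlow : Real.log T + k * Real.log τ ≤ Real.log (phi e S W) := by
    rw [← Real.log_pow, ← Real.log_mul hT0.ne' (by positivity)]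
    exact Real.log_le_log (by positivity) hPhi
  have hlogT : Real.log (i0.choose l * piK n r l) - (d + 1) ≤ Real.log T := by
    rw [hT, Real.log_div (by positivity) (by positivity), Real.log_div (by positivity) (by norm_num), Real.log_pow]
    have := Real.log_two_lt_d9
    have hd0 : (0:ℝ) ≤ d := by positivity
    have hd1 : (d:ℝ) * Real.log 2 ≤ d * 1 := mul_le_mul_of_nonneg_left (by linarith) hd0
    linarith
  have hTl := logT_lower (by omega : 0 < r) hn hl hil
  have hLM : Real.log (M / l) - 4 * γ ≤ Real.log (((i0:ℝ) - l) / l) := by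
    have h1 : Real.exp (-(4 * γ)) ≤ 1 - 2 * γ := by
      have h2 : 1 + 4 * γ ≤ Real.exp (4 * γ) := by linarith [Real.add_one_le_exp (4 * γ)]
      rw [Real.exp_neg, inv_le_iff_one_le_mul₀' (Real.exp_pos _)]
      have h3 : (1 + 4 * γ) * (1 - 2 * γ) ≤ Real.exp (4 * γ) * (1 - 2 * γ) :=
        mul_le_mul_of_nonneg_right h2 (by linarith)
      have h4 : γ * γ ≤ 1 / 4 * γ := mul_le_mul_of_nonneg_right hγ1 hγ.le
      linarith
    have h2 : Real.log (M / l) - 4 * γ = Real.log (Real.exp (-(4 * γ)) * (M / l)) := by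
      rw [Real.log_mul (Real.exp_ne_zero _) (by positivity), Real.log_exp]; ring
    rw [h2]
    refine Real.log_le_log (by positivity) ?_
    rw [← mul_div_assoc]
    refine div_le_div_of_nonneg_right ?_ hl0.le
    exact (mul_le_mul_of_nonneg_right h1 hM0.le).trans hi0
  have hlogτ : Real.log τ = - Real.log (1 / c) - Real.log (M / l) := by
    rw [hτ, one_div, Real.log_inv, Real.log_div (by positivity) (by positivity),
      Real.log_div (by positivity) (by positivity), Real.log_mul (by positivity) (by positivity)]
    ring
  have hlogup : l' * Real.log ((1 - η / 2) * M / l') ≤ - (η / 2) * l' + l' * Real.log (M / l) + k := by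
    have h0 : 0 < 1 - η / 2 := by linarith
    have h1 : Real.log ((1 - η / 2) * M / l') = Real.log (1 - η / 2) + Real.log (M / l) + Real.log (l / l') := by
      rw [← Real.log_mul (by positivity) (by positivity), ← Real.log_mul (by positivity) (by positivity)]
      congr 1; field_simp
    have h2 : Real.log (1 - η / 2) ≤ - (η / 2) := by
      have := Real.log_le_sub_one_of_pos h0; linarith
    have h3 : Real.log (l / l') ≤ l / l' - 1 := Real.log_le_sub_one_of_pos (by positivity)
    have h4 : (l':ℝ) * (l / l' - 1) = k := by
      rw [hl'R] at *; field_simp; ring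
    rw [h1]
    have h5 := mul_le_mul_of_nonneg_left h2 hl'R0.le
    have h6 := mul_le_mul_of_nonneg_left h3 hl'R0.le
    rw [h4] at h6
    rw [mul_add, mul_add]
    linarith
  have hlogl' : Real.log l' ≤ Real.log l := Real.log_le_log hl'R0 (by rw [hl'R]; linarith [Nat.cast_nonneg (α := ℝ) k])
  have hr1 : (1:ℝ) ≤ r - 1 := by
    have : (2:ℝ) ≤ r := by exact_mod_cast hr
    linarith
  have hk0 : (0:ℝ) ≤ k := by positivity
  have hlc : 0 ≤ Real.log (1 / c) := Real.log_nonneg (by rw [one_div]; exact (one_le_inv₀ hc).2 hc1)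
  have k1 : (r - 1:ℝ) * Real.log l' ≤ (r - 1) * Real.log l := mul_le_mul_of_nonneg_left hlogl' (by linarith)
  have k2 : (k:ℝ) * (r + Real.log (1 / c)) ≤ K * (r + Real.log (1/c)) :=
    mul_le_mul_of_nonneg_right hkK' (by linarith)
  have k3 : (l:ℝ) * (Real.log (M / l) - 4 * γ) ≤ l * Real.log (((i0:ℝ) - l) / l) :=
    mul_le_mul_of_nonneg_left hLM hl0.le
  have k4 : 4 * (r - 1) * θ * l' ≤ 4 * (r - 1) * θ * l := by
    refine mul_le_mul_of_nonneg_left (by rw [hl'R]; linarith) ?_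
    have : (0:ℝ) ≤ r - 1 := by linarith
    positivity
  have k5 : η / 2 * (l - K) ≤ η / 2 * l' := mul_le_mul_of_nonneg_left (by rw [hl'R]; linarith) (by linarith)
  have k6 : (l' : ℝ) * Real.log (M / l) = l * Real.log (M/l) - k * Real.log (M / l) := by rw [hl'R]; ring
  have k7 : (k:ℝ) * Real.log τ = - (k * Real.log (1 / c)) - k * Real.log (M/l) := by rw [hlogτ]; ring
  have k8 : (r - 1 : ℝ) * (1 + Real.log l' - l') = (r - 1) + (r-1) * Real.log l' - (r-1) * l + (r-1) * k := by
    rw [hl'R]; ring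
  linarith

end FewBad

section BadStates
open Function

def Wcut {n r : ℕ} (W : Finset ℕ) (a : Fin (r - 1) → RR n r) (s : ℕ) : Finset ℕ :=
  W \ (Finset.univ.filter (fun u : Fin (r - 1) => u.val < s)).biUnion (fun u => (a u).1)

open scoped Classical in
noncomputable def kap {n r M : ℕ} (T τ : ℝ) (K : ℕ) (e : Fin M → RR n r) (S : Finset (Fin M)) (W : Finset ℕ)
    (x : RR n r) : ℝ :=
  (∑ s : Fin (r - 1), ∑ a : Fin (r - 1) → RR n r, (if Drop T τ K e S (Wcut W a s) x then (1:ℝ) else 0)) /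
    ((r - 1 : ℕ) * Fintype.card (Fin (r - 1) → RR n r))

lemma kap_01 {n r M : ℕ} (T τ : ℝ) (K : ℕ) (e : Fin M → RR n r) (S : Finset (Fin M)) (W : Finset ℕ)
    (x : RR n r) : 0 ≤ kap T τ K e S W x ∧ kap T τ K e S W x ≤ 1 := by
  classical
  unfold kap
  constructor
  · refine div_nonneg (Finset.sum_nonneg fun s _ => Finset.sum_nonneg fun a _ => by split_ifs <;> norm_num) (by positivity)
  · refine div_le_one_of_le₀ ?_ (by positivity)
    calc _ ≤ ∑ s : Fin (r - 1), ∑ a : Fin (r - 1) → RR n r, (1:ℝ) :=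
          Finset.sum_le_sum fun s _ => Finset.sum_le_sum fun a _ => by split_ifs <;> norm_num
      _ = _ := by simp

lemma kap_few {n r M : ℕ} (hr : 2 ≤ r) [Nonempty (RR n r)] (T τ η : ℝ) (K : ℕ) (e : Fin M → RR n r) (S : Finset (Fin M)) (W : Finset ℕ)
    (hfew : ∀ W', (by classical exact ((S.filter (fun q => Drop T τ K e (S.erase q) W' (e q))).card : ℝ)) ≤ η * S.card) :
    ∑ i ∈ S, kap T τ K e (S.erase i) W (e i) ≤ η * S.card := by
  classical
  unfold kap
  have hc : (0:ℝ) < Fintype.card (Fin (r - 1) → RR n r) := by exact_mod_cast Fintype.card_pos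
  have hr1 : (0:ℝ) < (r - 1 : ℕ) := by exact_mod_cast (by omega : 0 < r - 1)
  rw [← Finset.sum_div, div_le_iff₀ (by positivity), Finset.sum_comm]
  calc _ = ∑ s : Fin (r - 1), ∑ a : Fin (r - 1) → RR n r, ∑ i ∈ S,
        (if Drop T τ K e (S.erase i) (Wcut W a s) (e i) then (1:ℝ) else 0) :=
        Finset.sum_congr rfl fun s _ => Finset.sum_comm
    _ ≤ ∑ s : Fin (r - 1), ∑ a : Fin (r - 1) → RR n r, η * S.card := by
        refine Finset.sum_le_sum fun s _ => Finset.sum_le_sum fun a _ => ?_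
        rw [Finset.sum_boole]
        convert hfew (Wcut W a s)
    _ = _ := by simp; ring

open scoped Classical in
noncomputable def badA {n r M : ℕ} (τ : ℝ) (e : Fin M → RR n r) (S : Finset (Fin M)) (W : Finset ℕ) : Finset (Finset ℕ) :=
  (W.powersetCard (r * (r - 1))).filter (fun A => phi e S (W \ A) < τ ^ (r - 1) * phi e S W)

/-- a state for which many `r(r-1)`-sets are bad -/
def Bad {n r M : ℕ} (τ β : ℝ) (e : Fin M → RR n r) (S : Finset (Fin M)) (W : Finset ℕ) : Prop :=
  β * (n.choose (r * (r - 1)) : ℝ) ≤ ((badA τ e S W).card : ℝ)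

lemma Wcut_succ {n r : ℕ} (W : Finset ℕ) (a : Fin (r - 1) → RR n r) (s : Fin (r - 1)) :
    Wcut W a (s + 1) = Wcut W a s \ (a s).1 := by
  unfold Wcut
  have : (Finset.univ.filter (fun u : Fin (r - 1) => u.val < s.val + 1)) =
      insert s (Finset.univ.filter (fun u : Fin (r - 1) => u.val < s.val)) := by
    ext u
    simp only [Finset.mem_filter, Finset.mem_univ, true_and, Finset.mem_insert, Fin.ext_iff]
    omega
  rw [this, Finset.biUnion_insert]
  ext v
  simp only [Finset.mem_sdiff, Finset.mem_union]
  tauto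

lemma exists_drop {n r M : ℕ} (T τ : ℝ) (K K' : ℕ) (hK : K + r ≤ K') (hτ : 0 < τ)
    (e : Fin M → RR n r) (S : Finset (Fin M)) (W : Finset ℕ)
    (hL : Large T τ K e S W) (A : Finset ℕ) (hA : A ∈ badA τ e S W) (a : Fin (r - 1) → RR n r)
    (ha : PMp (fun i => (a i).1) Finset.univ A) :
    ∃ s : Fin (r - 1), Drop T τ K' e S (Wcut W a s) (a s) := by
  by_contra hcon
  push Not at hcon
  unfold badA at hA
  rw [Finset.mem_filter, Finset.mem_powersetCard] at hA
  have key : ∀ s : ℕ, s ≤ r - 1 → Large T τ (K + s) e S (Wcut W a s) ∧ τ ^ s * phi e S W ≤ phi e S (Wcut W a s) := by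
    intro s
    induction s with
    | zero =>
      intro _
      have : Wcut W a 0 = W := by simp [Wcut]
      rw [this]; simpa using hL
    | succ s ih =>
      intro hs
      obtain ⟨h1, h2⟩ := ih (by omega)
      have hnd := hcon ⟨s, by omega⟩
      have hcut := Wcut_succ W a ⟨s, by omega⟩
      simp only at hcut hnd
      have hsub : (a ⟨s, by omega⟩).1 ⊆ Wcut W a s := by
        unfold Wcut
        rw [Finset.subset_sdiff]
        refine ⟨(Finset.subset_biUnion_of_mem (fun i => (a i).1) (Finset.mem_univ _)).trans (ha.2.subset.trans hA.1.1), ?_⟩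
        rw [Finset.disjoint_biUnion_right]
        intro u hu
        have hu := (Finset.mem_filter.1 hu).2
        exact ha.1 _ (Finset.mem_univ _) _ (Finset.mem_univ _) (fun h => by
          rw [← h] at hu; simp at hu)
      have hge : τ * phi e S (Wcut W a s) ≤ phi e S (Wcut W a (s + 1)) := by
        rw [hcut]
        by_contra hlt
        rw [not_le] at hlt
        refine hnd ⟨?_, hsub, hlt⟩
        obtain ⟨b1, k, b2, b3⟩ := h1
        exact ⟨b1, k, by omega, b3⟩
      have h4 : τ ^ (s + 1) * phi e S W ≤ phi e S (Wcut W a (s + 1)) := by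
        refine le_trans ?_ hge
        rw [pow_succ, mul_comm (τ ^ s), mul_assoc]
        exact mul_le_mul_of_nonneg_left h2 hτ.le
      refine ⟨?_, h4⟩
      obtain ⟨b1, k, b2, b3, b4⟩ := h1
      refine ⟨hcut ▸ Finset.sdiff_subset.trans b1, k + 1, by omega, ?_, ?_⟩
      · have h5 : Finset.range n \ Wcut W a (s + 1) = (Finset.range n \ Wcut W a s) ∪ (a ⟨s, by omega⟩).1 := by
          rw [hcut]
          ext v
          have hv := @(RR_mem (a ⟨s, by omega⟩)).1 v
          simp only [Finset.mem_sdiff, Finset.mem_union]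
          tauto
        rw [h5, Finset.card_union_of_disjoint, b3, (RR_mem _).2]
        · ring
        · exact Finset.disjoint_of_subset_right hsub Finset.sdiff_disjoint
      · refine le_trans ?_ hge
        rw [pow_succ, mul_comm (τ ^ k), ← mul_assoc, mul_comm T, mul_assoc]
        exact mul_le_mul_of_nonneg_left b4 hτ.le
  have hfin := (key (r - 1) le_rfl).2
  have : Wcut W a (r - 1) = W \ A := by
    unfold Wcut
    rw [← ha.2]
    congr 2
    ext u; simp
  rw [this] at hfin
  linarith [hA.2]

lemma kap_bad {n r M : ℕ} (hr : 2 ≤ r) (hrn : r * (r - 1) ≤ n) (T τ β : ℝ) (K K' : ℕ) (hK : K + r ≤ K') (hτ : 0 < τ) (hβ : 0 ≤ β)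
    (hn : (n:ℝ) ^ (r * (r - 1)) ≤ 2 * ((n.choose (r * (r - 1)) : ℝ) * (r * (r - 1)).factorial))
    (e : Fin M → RR n r) (S : Finset (Fin M)) (W : Finset ℕ)
    (hL : Large T τ K e S W) (hB : Bad τ β e S W) :
    β / (2 * (r - 1 : ℕ)) * Fintype.card (RR n r) ≤ ∑ x, kap T τ K' e S W x := by
  classical
  have hrn' : r ≤ n := le_trans (Nat.le_mul_of_pos_right r (by omega)) hrn
  have hc : 0 < n.choose r := Nat.choose_pos hrn'
  haveI : Nonempty (RR n r) := by
    rw [← Fintype.card_pos_iff, RR_card]; exact hc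
  have hR : (0:ℝ) < Fintype.card (RR n r) := by exact_mod_cast Fintype.card_pos
  have hF : (0:ℝ) < Fintype.card (Fin (r - 1) → RR n r) := by exact_mod_cast Fintype.card_pos
  have hr1 : (0:ℝ) < (r - 1 : ℕ) := by exact_mod_cast (by omega : 0 < r - 1)
  have e1 : ∑ x, kap T τ K' e S W x = (Fintype.card (RR n r) * ∑ s : Fin (r - 1), ∑ a : Fin (r - 1) → RR n r,
      (if Drop T τ K' e S (Wcut W a s) (a s) then (1:ℝ) else 0)) /
    ((r - 1 : ℕ) * Fintype.card (Fin (r - 1) → RR n r)) := by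
    unfold kap
    rw [← Finset.sum_div]
    congr 1
    rw [Finset.sum_comm, Finset.mul_sum]
    refine Finset.sum_congr rfl fun s _ => ?_
    rw [Finset.sum_comm, ← sum_update s]
    refine Finset.sum_congr rfl fun a _ => Finset.sum_congr rfl fun x _ => ?_
    have : Wcut W (update a s x) s = Wcut W a s := by
      unfold Wcut
      congr 1
      refine Finset.biUnion_congr rfl fun u hu => ?_
      have hu := (Finset.mem_filter.1 hu).2
      rw [update_of_ne (fun h : u = s => by rw [h] at hu; simp at hu)]
    rw [this, update_self]
  have e2 : ∑ A ∈ badA τ e S W, ∑ a : Fin (r - 1) → RR n r, (if PMp (fun i => (a i).1) Finset.univ A then (1:ℝ) else 0)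
      ≤ ∑ s : Fin (r - 1), ∑ a : Fin (r - 1) → RR n r,
      (if Drop T τ K' e S (Wcut W a s) (a s) then (1:ℝ) else 0) := by
    rw [Finset.sum_comm, Finset.sum_comm (s := (Finset.univ : Finset (Fin (r-1))))]
    refine Finset.sum_le_sum fun a _ => ?_
    by_cases hex : ∃ A ∈ badA τ e S W, PMp (fun i => (a i).1) Finset.univ A
    · obtain ⟨A, hA, hP⟩ := hex
      obtain ⟨s, hs⟩ := exists_drop T τ K K' hK hτ e S W hL A hA a hP
      have h1 : ∑ A ∈ badA τ e S W, (if PMp (fun i => (a i).1) Finset.univ A then (1:ℝ) else 0) = 1 := by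
        rw [Finset.sum_eq_single_of_mem A hA]
        · rw [if_pos hP]
        · intro A' _ hne
          rw [if_neg]
          intro h
          exact hne (h.2.symm.trans hP.2)
      rw [h1]
      have h2 := Finset.single_le_sum (f := fun s : Fin (r - 1) => (if Drop T τ K' e S (Wcut W a s) (a s) then (1:ℝ) else 0))
        (fun s _ => by split_ifs <;> norm_num) (Finset.mem_univ s)
      simp only [if_pos hs] at h2
      exact h2
    · rw [Finset.sum_eq_zero]
      · exact Finset.sum_nonneg fun s _ => by split_ifs <;> norm_num
      · intro A hA
        rw [if_neg]
        intro h; exact hex ⟨A, hA, h⟩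
  have e3 : ∀ A ∈ badA τ e S W, ∑ a : Fin (r - 1) → RR n r, (if PMp (fun i => (a i).1) Finset.univ A then (1:ℝ) else 0)
      = Fintype.card (Fin (r - 1) → RR n r) * piK n r (r - 1) := by
    intro A hA
    unfold badA at hA
    rw [Finset.mem_filter, Finset.mem_powersetCard] at hA
    have hAV : A ⊆ Finset.range n := hA.1.1.trans hL.1
    have h := avgPM (n := n) (r := r) (M := r - 1) hc Finset.univ (fun _ => 1) (fun _ => A)
      (by intros; rfl) (by intros; rfl) (by intro e _; exact ⟨hAV, by simp [hA.1.2]⟩)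
    simp only [one_mul] at h
    rw [h]; simp
  rw [Finset.sum_congr rfl e3, Finset.sum_const, nsmul_eq_mul] at e2
  have e4 := piK_closed (r := r) hc (r - 1)
  set q := r * (r - 1) with hq
  have hpp := piK_pos (k := r - 1) (by omega : 0 < r) hc
  have hn0 : (0:ℝ) < n := by
    have : 0 < n := by omega
    exact_mod_cast this
  have e5 : (q.factorial : ℝ) ≤ piK n r (r - 1) * (n:ℝ) ^ q := by
    rw [← e4]
    refine mul_le_mul_of_nonneg_left ?_ hpp.le
    have : r.factorial * n.choose r ≤ n ^ r := by
      rw [← Nat.descFactorial_eq_factorial_mul_choose]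
      exact Nat.descFactorial_le_pow n r
    have h' : ((r.factorial : ℝ) * n.choose r) ≤ (n:ℝ) ^ r := by exact_mod_cast this
    calc _ ≤ ((n:ℝ) ^ r) ^ (r - 1) := pow_le_pow_left₀ (by positivity) h' _
      _ = _ := by rw [← pow_mul]
  have e6 : (1:ℝ) ≤ 2 * (n.choose q * piK n r (r - 1)) := by
    have : (n:ℝ) ^ q * 1 ≤ (n:ℝ) ^ q * (2 * (n.choose q * piK n r (r - 1))) := by
      calc (n:ℝ) ^ q * 1 ≤ 2 * ((n.choose q : ℝ) * q.factorial) := by rw [mul_one]; exact hn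
        _ ≤ 2 * ((n.choose q : ℝ) * (piK n r (r - 1) * (n:ℝ) ^ q)) := by gcongr
        _ = _ := by ring
    exact le_of_mul_le_mul_left this (by positivity)
  have e7 : β / 2 * Fintype.card (Fin (r - 1) → RR n r) ≤ ∑ s : Fin (r - 1), ∑ a : Fin (r - 1) → RR n r,
      (if Drop T τ K' e S (Wcut W a s) (a s) then (1:ℝ) else 0) := by
    refine le_trans ?_ e2
    unfold Bad at hB
    calc β / 2 * Fintype.card (Fin (r - 1) → RR n r) = β / 2 * Fintype.card (Fin (r - 1) → RR n r) * 1 := by ring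
      _ ≤ β / 2 * Fintype.card (Fin (r - 1) → RR n r) * (2 * (n.choose q * piK n r (r - 1))) :=
          mul_le_mul_of_nonneg_left e6 (by positivity)
      _ = (β * n.choose q) * (Fintype.card (Fin (r - 1) → RR n r) * piK n r (r - 1)) := by ring
      _ ≤ _ := mul_le_mul_of_nonneg_right hB (by positivity)
  rw [e1, le_div_iff₀ (by positivity)]
  calc _ = Fintype.card (RR n r) * (β / 2 * Fintype.card (Fin (r - 1) → RR n r)) := by
        field_simp
    _ ≤ _ := mul_le_mul_of_nonneg_left e7 hR.le

end BadStates

section DoomSec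
open Function

def Sx (M i : ℕ) : Finset (Fin M) := Finset.univ.filter (fun j => j.val < i)

lemma phi_comp {n r M : ℕ} (e : Fin M → RR n r) (σ : Equiv.Perm (Fin M)) (S : Finset (Fin M)) (W : Finset ℕ) :
    phi (e ∘ σ) S W = phi e (S.map σ.toEmbedding) W := by
  unfold phi
  congr 1
  refine Finset.card_bij (fun J _ => J.map σ.toEmbedding) ?_ ?_ ?_
  · intro J hJ
    rw [mem_pmI] at hJ ⊢
    refine ⟨Finset.map_subset_map.2 hJ.1, ?_, ?_⟩
    · intro i hi j hj hij
      rw [Finset.mem_map] at hi hj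
      obtain ⟨a, ha, rfl⟩ := hi
      obtain ⟨b, hb, rfl⟩ := hj
      exact hJ.2.1 a ha b hb (fun h => hij (by rw [h]))
    · rw [← hJ.2.2, Finset.map_eq_image, Finset.image_biUnion]
      rfl
  · intro A _ B _ h
    exact Finset.map_injective _ h
  · intro J hJ
    rw [mem_pmI] at hJ
    refine ⟨J.map σ.symm.toEmbedding, ?_, ?_⟩
    · rw [mem_pmI]
      refine ⟨?_, ?_, ?_⟩
      · intro x hx
        rw [Finset.mem_map] at hx
        obtain ⟨y, hy, rfl⟩ := hx
        have := hJ.1 hy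
        rw [Finset.mem_map] at this
        obtain ⟨z, hz, rfl⟩ := this
        simpa using hz
      · intro i hi j hj hij
        rw [Finset.mem_map] at hi hj
        obtain ⟨a, ha, rfl⟩ := hi
        obtain ⟨b, hb, rfl⟩ := hj
        have := hJ.2.1 a ha b hb (fun h => hij (by rw [h]))
        simpa using this
      · rw [← hJ.2.2, Finset.map_eq_image, Finset.image_biUnion]
        refine Finset.biUnion_congr rfl fun x _ => ?_
        simp
    · ext x; simp

lemma phi_congr {n r M : ℕ} {e e' : Fin M → RR n r} {S : Finset (Fin M)} (h : ∀ i ∈ S, e i = e' i) (W : Finset ℕ) :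
    phi e S W = phi e' S W := by
  unfold phi
  congr 2
  ext J
  rw [mem_pmI, mem_pmI]
  refine and_congr_right fun hJ => ?_
  have h1 : J.biUnion (fun i => (e i).1) = J.biUnion (fun i => (e' i).1) :=
    Finset.biUnion_congr rfl fun i hi => by rw [h i (hJ hi)]
  rw [h1]
  refine and_congr_left fun _ => ?_
  refine forall₂_congr fun a ha => forall₂_congr fun b hb => ?_
  simp only [h a (hJ ha), h b (hJ hb)]

/-- everything depends on `e`, `S` only through `phi e S` -/
lemma Large_congr {n r M : ℕ} {T τ : ℝ} {K : ℕ} {e e' : Fin M → RR n r} {S S' : Finset (Fin M)}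
    (h : ∀ W, phi e S W = phi e' S' W) (W : Finset ℕ) : Large T τ K e S W ↔ Large T τ K e' S' W := by
  unfold Large; simp only [h]

lemma Drop_congr {n r M : ℕ} {T τ : ℝ} {K : ℕ} {e e' : Fin M → RR n r} {S S' : Finset (Fin M)}
    (h : ∀ W, phi e S W = phi e' S' W) (W : Finset ℕ) (x : RR n r) :
    Drop T τ K e S W x ↔ Drop T τ K e' S' W x := by
  unfold Drop; simp only [h, Large_congr h]

lemma Bad_congr {n r M : ℕ} {τ β : ℝ} {e e' : Fin M → RR n r} {S S' : Finset (Fin M)}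
    (h : ∀ W, phi e S W = phi e' S' W) (W : Finset ℕ) :
    Bad τ β e S W ↔ Bad τ β e' S' W := by
  unfold Bad badA; simp only [h]

lemma kap_congr {n r M : ℕ} {T τ : ℝ} {K : ℕ} {e e' : Fin M → RR n r} {S S' : Finset (Fin M)}
    (h : ∀ W, phi e S W = phi e' S' W) (W : Finset ℕ) (x : RR n r) :
    kap T τ K e S W x = kap T τ K e' S' W x := by
  unfold kap
  congr 1
  refine Finset.sum_congr rfl fun s _ => Finset.sum_congr rfl fun a _ => ?_
  by_cases hD : Drop T τ K e S (Wcut W a s) x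
  · rw [if_pos hD, if_pos ((Drop_congr h _ _).1 hD)]
  · rw [if_neg hD, if_neg (fun h' => hD ((Drop_congr h _ _).2 h'))]

lemma mem_excI {ι : Type*} [DecidableEq ι] (E : ι → Finset ℕ) (S : Finset ι) (i : ι) :
    i ∈ excI E S ↔ i ∈ S ∧ ∃ j ∈ S, j ≠ i ∧ 2 ≤ (E i ∩ E j).card := by
  unfold excI; rw [Finset.mem_filter]

lemma excI_comp_card {n r M : ℕ} (e : Fin M → RR n r) (σ : Equiv.Perm (Fin M)) :
    (excI (fun i => ((e ∘ σ) i).1) Finset.univ).card = (excI (fun i => (e i).1) Finset.univ).card := by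
  refine Finset.card_bij (fun i _ => σ i) ?_ ?_ ?_
  · intro i hi
    rw [mem_excI] at *
    obtain ⟨-, j, -, h1, h2⟩ := hi
    exact ⟨Finset.mem_univ _, σ j, Finset.mem_univ _, fun h => h1 (σ.injective h), h2⟩
  · intro a _ b _ h; exact σ.injective h
  · intro i hi
    refine ⟨σ.symm i, ?_, by simp⟩
    rw [mem_excI] at *
    obtain ⟨-, j, -, h1, h2⟩ := hi
    refine ⟨Finset.mem_univ _, σ.symm j, Finset.mem_univ _, fun h => h1 (σ.symm.injective h), ?_⟩
    simpa using h2

def Qev {n r M : ℕ} (l : ℕ) (e : Fin M → RR n r) : Prop :=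
  ((excI (fun i => (e i).1) Finset.univ).card : ℝ) ≤ l

open scoped Classical in
def FewHyp (n r M : ℕ) (T τ η : ℝ) (K l : ℕ) : Prop :=
  ∀ (e : Fin M → RR n r), Qev l e → ∀ (S : Finset (Fin M)) (W : Finset ℕ),
    ((S.filter (fun q => Drop T τ K e (S.erase q) W (e q))).card : ℝ) ≤ η * S.card

lemma Sx_card {M i : ℕ} (h : i ≤ M) : (Sx M i).card = i := by
  have : Sx M i = Finset.univ.map (Fin.castLEEmb h) := by
    ext j
    simp only [Sx, Finset.mem_filter, Finset.mem_univ, true_and, Finset.mem_map]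
    constructor
    · intro hj; exact ⟨⟨j.val, hj⟩, by ext; simp⟩
    · rintro ⟨a, rfl⟩; simp
  rw [this]; simp

open scoped Classical in
theorem sched_bound {n r l M i0 : ℕ} (hr : 2 ≤ r) (hrn : r * (r - 1) ≤ n) (hi0 : i0 ≤ M)
    (T τ β η : ℝ) (K K' : ℕ) (hK : K + r ≤ K') (hτ : 0 < τ) (hβ : 0 ≤ β) (hβ1 : β ≤ 1) (hη : 0 ≤ η)
    (hn : (n:ℝ) ^ (r * (r - 1)) ≤ 2 * ((n.choose (r * (r - 1)) : ℝ) * (r * (r - 1)).factorial))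
    (hfew : FewHyp n r M T τ η K' l) (ω : ℕ → Finset ℕ) :
    (((Finset.univ : Finset (Fin M → RR n r)).filter
      (fun e => Qev l e ∧ ∀ i ∈ Finset.Ico i0 M, Large T τ K e (Sx M i) (ω i) ∧ Bad τ β e (Sx M i) (ω i))).card : ℝ) ^ 2 ≤
        ((1 - β / (2 * (r - 1 : ℕ)) / 2) * (1 + η)) ^ (M - i0) * (Fintype.card (Fin M → RR n r) : ℝ) ^ 2 := by
  have hrn' : r ≤ n := le_trans (Nat.le_mul_of_pos_right r (by omega)) hrn
  have hc : 0 < n.choose r := Nat.choose_pos hrn'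
  haveI : Nonempty (RR n r) := by
    rw [← Fintype.card_pos_iff, RR_card]; exact hc
  have hr1 : (1:ℝ) ≤ (r - 1 : ℕ) := by exact_mod_cast (by omega : 1 ≤ r - 1)
  have hupd : ∀ i (j : Fin M) (e : Fin M → RR n r) x, i ≤ j.val → ∀ W, phi (update e j x) (Sx M i) W = phi e (Sx M i) W := by
    intro i j e x hij W
    refine phi_congr (fun a ha => ?_) W
    have ha := (Finset.mem_filter.1 ha).2
    exact update_of_ne (fun h : a = j => by rw [h] at ha; omega) _ _
  have main := transfer i0 hi0 (fun i (e : Fin M → RR n r) => if h : i < M then kap T τ K' e (Sx M i) (ω i) (e ⟨i, h⟩) else 0)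
    (fun i e => Large T τ K e (Sx M i) (ω i) ∧ Bad τ β e (Sx M i) (ω i)) (Qev l)
    (β / (2 * (r - 1 : ℕ))) η ?_ hη ?_ ?_ ?_ ?_ ?_ ?_ ?_
  · convert main
  · rw [div_le_iff₀ (by positivity)]; linarith
  · intro i e
    beta_reduce
    split_ifs
    · exact kap_01 _ _ _ _ _ _ _
    · norm_num
  · intro i j e x hij
    beta_reduce
    split_ifs with h
    · rw [kap_congr (hupd i j e x hij.le), update_of_ne]
      intro h2
      have := congrArg Fin.val h2
      simp at this; omega
    · rfl
  · intro i j e x hij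
    rw [Large_congr (hupd i j e x hij), Bad_congr (hupd i j e x hij)]
  · intro i h e hi hE
    simp only [dif_pos h]
    refine (kap_bad hr hrn T τ β K K' hK hτ hβ hn e (Sx M i) (ω i) hE.1 hE.2).trans (le_of_eq ?_)
    refine Finset.sum_congr rfl fun x _ => ?_
    rw [kap_congr (hupd i ⟨i, h⟩ e x le_rfl), update_self]
  · intro i a b e ha hb
    beta_reduce
    split_ifs with h
    · have h1 : ∀ W, phi (e ∘ Equiv.swap a b) (Sx M i) W = phi e (Sx M i) W := by
        intro W
        rw [phi_comp]
        congr 1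
        ext x
        rw [Finset.mem_map_equiv, Equiv.symm_swap]
        simp only [Sx, Finset.mem_filter, Finset.mem_univ, true_and]
        by_cases hxa : x = a
        · subst hxa; simp [ha, hb]
        · by_cases hxb : x = b
          · subst hxb; simp [ha, hb]
          · rw [Equiv.swap_apply_of_ne_of_ne hxa hxb]
      rw [kap_congr h1]
      congr 1
      simp only [comp_apply]
      rw [Equiv.swap_apply_of_ne_of_ne]
      · intro h2; have := congrArg Fin.val h2; simp at this; omega
      · intro h2; have := congrArg Fin.val h2; simp at this; omega
    · rfl
  · intro a b e
    unfold Qev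
    rw [excI_comp_card]
  · intro i h e hi hQ
    simp only [dif_pos h]
    have hS : (Finset.univ : Finset (Fin M)).filter (fun j => j.val ≤ i) = Sx M (i + 1) := by
      ext j; simp only [Sx, Finset.mem_filter, Finset.mem_univ, true_and]; omega
    rw [hS]
    have h1 : ∀ j ∈ Sx M (i + 1), kap T τ K' (e ∘ Equiv.swap j ⟨i, h⟩) (Sx M i) (ω i) ((e ∘ Equiv.swap j ⟨i, h⟩) ⟨i, h⟩)
        = kap T τ K' e ((Sx M (i + 1)).erase j) (ω i) (e j) := by
      intro j hj
      have hj := (Finset.mem_filter.1 hj).2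
      have h2 : ∀ W, phi (e ∘ Equiv.swap j ⟨i, h⟩) (Sx M i) W = phi e ((Sx M (i + 1)).erase j) W := by
        intro W
        rw [phi_comp]
        congr 1
        ext x
        rw [Finset.mem_map_equiv, Equiv.symm_swap, Finset.mem_erase]
        simp only [Sx, Finset.mem_filter, Finset.mem_univ, true_and]
        by_cases hxa : x = j
        · subst hxa; simp
        · by_cases hxb : x = ⟨i, h⟩
          · subst hxb
            simp only [Equiv.swap_apply_right]
            constructor
            · intro h3; exact ⟨hxa, by omega⟩
            · intro _
              have : j.val ≠ i := fun h4 => hxa (by ext; simp [h4])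
              omega
          · rw [Equiv.swap_apply_of_ne_of_ne hxa hxb]
            have : x.val ≠ i := fun h4 => hxb (by ext; simp [h4])
            constructor
            · intro h3; exact ⟨hxa, by omega⟩
            · intro h3; omega
      rw [kap_congr h2]
      simp
    rw [Finset.sum_congr rfl h1]
    have := kap_few hr T τ η K' e (Sx M (i + 1)) (ω i) (fun W' => by convert hfew e hQ (Sx M (i+1)) W')
    rw [Sx_card (by omega)] at this
    push_cast at this
    exact this

def Doom {n r M : ℕ} (T τ β : ℝ) (K : ℕ) (e : Fin M → RR n r) (i : ℕ) (W : Finset ℕ) : Prop :=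
  ∃ ω : ℕ → Finset ℕ, (∀ j ∈ Finset.Ico i M, ω j ⊆ W ∧ Large T τ K e (Sx M j) (ω j) ∧ Bad τ β e (Sx M j) (ω j)) ∧
    (∀ j k, i ≤ j → j ≤ k → k < M → ω k ⊆ ω j)

lemma Doom_top {n r M : ℕ} {T τ β : ℝ} {K : ℕ} {e : Fin M → RR n r} {i : ℕ} {W : Finset ℕ} (h : M ≤ i) :
    Doom T τ β K e i W :=
  ⟨fun _ => ∅, by simp [h], fun _ _ _ _ _ => subset_rfl⟩

lemma Doom_mono {n r M : ℕ} {T τ β : ℝ} {K : ℕ} {e : Fin M → RR n r} {i : ℕ} {W W' : Finset ℕ} (h : W' ⊆ W)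
    (hD : Doom T τ β K e i W') : Doom T τ β K e i W := by
  obtain ⟨ω, h1, h2⟩ := hD
  exact ⟨ω, fun j hj => ⟨(h1 j hj).1.trans h, (h1 j hj).2⟩, h2⟩

lemma Doom_step {n r M : ℕ} {T τ β : ℝ} {K : ℕ} {e : Fin M → RR n r} {i : ℕ} {W : Finset ℕ}
    (hL : Large T τ K e (Sx M i) W) (hB : Bad τ β e (Sx M i) W)
    (hD : Doom T τ β K e (i + 1) W) : Doom T τ β K e i W := by
  obtain ⟨ω, h1, h2⟩ := hD
  refine ⟨fun j => if j = i then W else ω j, ?_, ?_⟩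
  · intro j hj
    rw [Finset.mem_Ico] at hj
    by_cases hji : j = i
    · subst hji; simp [hL, hB]
    · simp only [if_neg hji]
      exact h1 j (Finset.mem_Ico.2 ⟨by omega, hj.2⟩)
  · intro j k hij hjk hk
    by_cases hji : j = i
    · subst hji
      by_cases hkj : k = j
      · subst hkj; exact subset_rfl
      · simp only [if_neg hkj, if_true]
        exact (h1 k (Finset.mem_Ico.2 ⟨by omega, hk⟩)).1
    · simp only [if_neg hji, if_neg (show k ≠ i by omega)]
      exact h2 j k (by omega) hjk hk

lemma encode {n M i0 z : ℕ} (hn : 0 < n) (ω : ℕ → Finset ℕ)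
    (h1 : ∀ j ∈ Finset.Ico i0 M, ω j ⊆ Finset.range n ∧ (Finset.range n \ ω j).card ≤ z)
    (h2 : ∀ j k, i0 ≤ j → j ≤ k → k < M → ω k ⊆ ω j) :
    ∃ f : Fin z → Fin n × Fin (M + 1), ∀ j ∈ Finset.Ico i0 M,
      ω j = Finset.range n \ (Finset.univ.filter (fun u => (f u).2.val ≤ j)).image (fun u => (f u).1.val) := by
  classical
  by_cases hM : i0 < M
  swap
  · exact ⟨fun _ => (⟨0, hn⟩, 0), fun j hj => by rw [Finset.mem_Ico] at hj; omega⟩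
  set D := Finset.range n \ ω (M - 1) with hD
  have hDz : D.card ≤ z := (h1 (M - 1) (Finset.mem_Ico.2 ⟨by omega, by omega⟩)).2
  set t : ℕ → ℕ := fun v => sInf {j | i0 ≤ j ∧ j < M ∧ v ∉ ω j} with ht
  have htD : ∀ v ∈ D, t v ∈ {j | i0 ≤ j ∧ j < M ∧ v ∉ ω j} := by
    intro v hv
    refine Nat.sInf_mem ⟨M - 1, by omega, by omega, (Finset.mem_sdiff.1 hv).2⟩
  refine ⟨fun u => if h : u.val < D.card then
      (⟨(D.equivFin.symm ⟨u.val, h⟩).1, by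
        have := (D.equivFin.symm ⟨u.val, h⟩).2
        exact Finset.mem_range.1 (Finset.mem_sdiff.1 this).1⟩,
       ⟨t (D.equivFin.symm ⟨u.val, h⟩).1, by
        have := (htD _ (D.equivFin.symm ⟨u.val, h⟩).2).2.1
        omega⟩) else (⟨0, hn⟩, ⟨M, by omega⟩), ?_⟩
  intro j hj
  rw [Finset.mem_Ico] at hj
  have key : ∀ v, v ∈ (Finset.univ.filter (fun u : Fin z => ((if h : u.val < D.card then
      ((⟨(D.equivFin.symm ⟨u.val, h⟩).1, by
        have := (D.equivFin.symm ⟨u.val, h⟩).2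
        exact Finset.mem_range.1 (Finset.mem_sdiff.1 this).1⟩ : Fin n),
       (⟨t (D.equivFin.symm ⟨u.val, h⟩).1, by
        have := (htD _ (D.equivFin.symm ⟨u.val, h⟩).2).2.1
        omega⟩ : Fin (M + 1))) else (⟨0, hn⟩, ⟨M, by omega⟩)).2).val ≤ j)).image (fun u : Fin z => ((if h : u.val < D.card then
      ((⟨(D.equivFin.symm ⟨u.val, h⟩).1, by
        have := (D.equivFin.symm ⟨u.val, h⟩).2
        exact Finset.mem_range.1 (Finset.mem_sdiff.1 this).1⟩ : Fin n),
       (⟨t (D.equivFin.symm ⟨u.val, h⟩).1, by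
        have := (htD _ (D.equivFin.symm ⟨u.val, h⟩).2).2.1
        omega⟩ : Fin (M + 1))) else (⟨0, hn⟩, ⟨M, by omega⟩)).1).val) ↔ v ∈ D ∧ t v ≤ j := by
    intro v
    rw [Finset.mem_image]
    constructor
    · rintro ⟨u, hu, hv⟩
      have hu := (Finset.mem_filter.1 hu).2
      by_cases h : u.val < D.card
      · simp only [dif_pos h] at hu hv
        rw [← hv]
        exact ⟨(D.equivFin.symm ⟨u.val, h⟩).2, hu⟩
      · simp only [dif_neg h] at hu
        omega
    · rintro ⟨hv, htv⟩
      have hlt := (D.equivFin ⟨v, hv⟩).2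
      refine ⟨⟨(D.equivFin ⟨v, hv⟩).val, by omega⟩, Finset.mem_filter.2 ⟨Finset.mem_univ _, ?_⟩, ?_⟩
      · simp only [hlt, dif_pos, Fin.eta, Equiv.symm_apply_apply]
        exact htv
      · simp only [hlt, dif_pos, Fin.eta, Equiv.symm_apply_apply]
  ext v
  rw [Finset.mem_sdiff, key]
  constructor
  · intro hv
    refine ⟨(h1 j (Finset.mem_Ico.2 hj)).1 hv, ?_⟩
    rintro ⟨hvD, htv⟩
    obtain ⟨a1, a2, a3⟩ := htD v hvD
    exact a3 (h2 _ _ a1 htv hj.2 hv)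
  · rintro ⟨hv, hnot⟩
    by_contra hvj
    refine hnot ⟨Finset.mem_sdiff.2 ⟨hv, fun h => hvj (h2 j (M - 1) hj.1 (by omega) (by omega) h)⟩, ?_⟩
    exact Nat.sInf_le ⟨hj.1, hj.2, hvj⟩

open scoped Classical in
theorem doom_bound {n r l M i0 : ℕ} (hr : 2 ≤ r) (hrn : r * (r - 1) ≤ n) (hi0 : i0 ≤ M)
    (T τ β η : ℝ) (K K' : ℕ) (hK : K + r ≤ K') (hτ : 0 < τ) (hβ : 0 ≤ β) (hβ1 : β ≤ 1) (hη : 0 ≤ η)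
    (hn : (n:ℝ) ^ (r * (r - 1)) ≤ 2 * ((n.choose (r * (r - 1)) : ℝ) * (r * (r - 1)).factorial))
    (hfew : FewHyp n r M T τ η K' l) :
    (((Finset.univ : Finset (Fin M → RR n r)).filter
      (fun e => Qev l e ∧ Doom T τ β K e i0 (Finset.range n))).card : ℝ) ≤
        ((n:ℝ) * (M + 1)) ^ (r * K) * (Real.sqrt (((1 - β / (2 * (r - 1 : ℕ)) / 2) * (1 + η)) ^ (M - i0)) *
          (Fintype.card (Fin M → RR n r) : ℝ)) := by
  set om : (Fin (r * K) → Fin n × Fin (M + 1)) → ℕ → Finset ℕ := fun f j =>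
    Finset.range n \ (Finset.univ.filter (fun u => (f u).2.val ≤ j)).image (fun u => (f u).1.val) with hom
  set G : (Fin (r * K) → Fin n × Fin (M + 1)) → Finset (Fin M → RR n r) := fun f =>
    (Finset.univ : Finset (Fin M → RR n r)).filter
      (fun e => Qev l e ∧ ∀ i ∈ Finset.Ico i0 M, Large T τ K e (Sx M i) (om f i) ∧ Bad τ β e (Sx M i) (om f i)) with hG
  have hn0 : 0 < n := by
    have : 0 < r * (r - 1) := Nat.mul_pos (by omega) (by omega)
    omega
  have hsub : (Finset.univ : Finset (Fin M → RR n r)).filter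
      (fun e => Qev l e ∧ Doom T τ β K e i0 (Finset.range n)) ⊆ Finset.univ.biUnion G := by
    intro e he
    obtain ⟨hQ, ω, h1, h2⟩ := (Finset.mem_filter.1 he).2
    obtain ⟨f, hf⟩ := encode (z := r * K) hn0 ω (fun j hj => by
      obtain ⟨a1, ⟨a2, k, a3, a4, -⟩, -⟩ := h1 j hj
      exact ⟨a1, by rw [a4]; exact Nat.mul_le_mul_left r a3⟩) h2
    refine Finset.mem_biUnion.2 ⟨f, Finset.mem_univ _, Finset.mem_filter.2 ⟨Finset.mem_univ _, hQ, ?_⟩⟩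
    intro i hi
    have : om f i = ω i := (hf i hi).symm
    rw [this]
    exact (h1 i hi).2
  have hGb : ∀ f, ((G f).card : ℝ) ≤ Real.sqrt (((1 - β / (2 * (r - 1 : ℕ)) / 2) * (1 + η)) ^ (M - i0)) *
          (Fintype.card (Fin M → RR n r) : ℝ) := by
    intro f
    have h := sched_bound (l := l) hr hrn hi0 T τ β η K K' hK hτ hβ hβ1 hη hn hfew (om f)
    have h2 := Real.sqrt_le_sqrt h
    rw [Real.sqrt_sq (by positivity), Real.sqrt_mul' _ (by positivity), Real.sqrt_sq (by positivity)] at h2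
    exact h2
  calc _ ≤ ((Finset.univ.biUnion G).card : ℝ) := by exact_mod_cast Finset.card_le_card hsub
    _ ≤ ∑ f, ((G f).card : ℝ) := by exact_mod_cast Finset.card_biUnion_le
    _ ≤ ∑ f : Fin (r * K) → Fin n × Fin (M + 1), Real.sqrt (((1 - β / (2 * (r - 1 : ℕ)) / 2) * (1 + η)) ^ (M - i0)) *
          (Fintype.card (Fin M → RR n r) : ℝ) := Finset.sum_le_sum fun f _ => hGb f
    _ = _ := by
      rw [Finset.sum_const, nsmul_eq_mul, Finset.card_univ, Fintype.card_fun, Fintype.card_prod]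
      simp

end DoomSec

section ProbTools
variable {α : Type*} [DecidableEq α]

/-- expectation over the `p`-random subset of `U` -/
noncomputable def Ew (p : ℝ) (U : Finset α) (f : Finset α → ℝ) : ℝ :=
  ∑ B ∈ U.powerset, p ^ B.card * (1 - p) ^ (U.card - B.card) * f B

lemma Ew_empty (p : ℝ) (f : Finset α → ℝ) : Ew p ∅ f = f ∅ := by simp [Ew]

lemma Ew_insert (p : ℝ) {x : α} {U : Finset α} (hx : x ∉ U) (f : Finset α → ℝ) :
    Ew p (insert x U) f = Ew p U (fun B => (1 - p) * f B + p * f (insert x B)) := by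
  unfold Ew
  rw [Finset.sum_powerset_insert hx, ← Finset.sum_add_distrib]
  refine Finset.sum_congr rfl fun B hB => ?_
  rw [Finset.mem_powerset] at hB
  have hc := Finset.card_le_card hB
  rw [Finset.card_insert_of_notMem hx, Finset.card_insert_of_notMem (fun h => hx (hB h))]
  have e1 : U.card + 1 - B.card = (U.card - B.card) + 1 := by omega
  have e2 : U.card + 1 - (B.card + 1) = U.card - B.card := by omega
  rw [e1, e2, pow_succ, pow_succ]
  ring

lemma Ew_congr (p : ℝ) {U : Finset α} {f g : Finset α → ℝ} (h : ∀ B ⊆ U, f B = g B) : Ew p U f = Ew p U g :=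
  Finset.sum_congr rfl fun B hB => by rw [h B (Finset.mem_powerset.1 hB)]

lemma Ew_mono {p : ℝ} (hp0 : 0 ≤ p) (hp1 : p ≤ 1) {U : Finset α} {f g : Finset α → ℝ} (h : ∀ B ⊆ U, f B ≤ g B) :
    Ew p U f ≤ Ew p U g :=
  Finset.sum_le_sum fun B hB => mul_le_mul_of_nonneg_left (h B (Finset.mem_powerset.1 hB))
    (mul_nonneg (pow_nonneg hp0 _) (pow_nonneg (by linarith) _))

lemma Ew_add (p : ℝ) (U : Finset α) (f g : Finset α → ℝ) : Ew p U (fun B => f B + g B) = Ew p U f + Ew p U g := by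
  unfold Ew; rw [← Finset.sum_add_distrib]; exact Finset.sum_congr rfl fun B _ => by ring

lemma Ew_mul (p : ℝ) (U : Finset α) (c : ℝ) (f : Finset α → ℝ) : Ew p U (fun B => c * f B) = c * Ew p U f := by
  unfold Ew; rw [Finset.mul_sum]; exact Finset.sum_congr rfl fun B _ => by ring

lemma Ew_const (p : ℝ) (U : Finset α) (c : ℝ) : Ew p U (fun _ => c) = c := by
  induction U using Finset.induction_on with
  | empty => rw [Ew_empty]
  | insert x U hx ih =>
    rw [Ew_insert p hx]
    have : (fun _ : Finset α => (1 - p) * c + p * c) = fun _ => c := by funext; ring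
    rw [this, ih]

lemma Ew_union (p : ℝ) {F G : Finset α} (h : Disjoint F G) (f : Finset α → ℝ) :
    Ew p (F ∪ G) f = Ew p F (fun A => Ew p G (fun B => f (A ∪ B))) := by
  induction F using Finset.induction_on generalizing f with
  | empty => rw [Ew_empty]; simp
  | insert x F hx ih =>
    rw [Finset.disjoint_insert_left] at h
    rw [Finset.insert_union, Ew_insert p (by simp [hx, h.1]), ih h.2, Ew_insert p hx]
    refine Ew_congr p fun A _ => ?_
    rw [Ew_add, Ew_mul, Ew_mul]
    congr 3
    funext B
    rw [Finset.insert_union]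

lemma Ew_couple (pa pb : ℝ) (U : Finset α) (f : Finset α → ℝ) :
    Ew pa U (fun A => Ew pb U (fun B => f (A ∪ B))) = Ew (1 - (1 - pa) * (1 - pb)) U f := by
  induction U using Finset.induction_on generalizing f with
  | empty => simp [Ew_empty]
  | insert x U hx ih =>
    rw [Ew_insert _ hx, Ew_insert _ hx, ← ih]
    refine Ew_congr _ fun A _ => ?_
    rw [Ew_insert _ hx, Ew_insert _ hx, ← Ew_mul, ← Ew_mul, ← Ew_add]
    refine Ew_congr _ fun B _ => ?_
    have e1 : insert x A ∪ insert x B = insert x (A ∪ B) := by ext; simp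
    rw [e1, Finset.insert_union, Finset.union_insert]
    ring

open scoped Classical in
lemma Ew_miss (p : ℝ) {F T : Finset α} (hT : T ⊆ F) :
    Ew p F (fun B => if Disjoint T B then (1:ℝ) else 0) = (1 - p) ^ T.card := by
  have h0 : F = T ∪ (F \ T) := (Finset.union_sdiff_of_subset hT).symm
  rw [h0, Ew_union p Finset.disjoint_sdiff]
  have h1 : ∀ A ⊆ T, Ew p (F \ T) (fun B => if Disjoint T (A ∪ B) then (1:ℝ) else 0) = if A = ∅ then 1 else 0 := by
    intro A hA
    rw [← Ew_const p (F \ T) (if A = ∅ then 1 else 0)]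
    refine Ew_congr p fun B hB => ?_
    have : Disjoint T (A ∪ B) ↔ A = ∅ := by
      rw [Finset.disjoint_union_right]
      constructor
      · rintro ⟨h, -⟩
        exact Finset.disjoint_self_iff_empty _ |>.1 (h.mono_left hA)
      · rintro rfl
        exact ⟨by simp, Finset.disjoint_sdiff.mono_right hB⟩
    simp only [this]
  rw [Ew_congr p h1]
  unfold Ew
  rw [Finset.sum_eq_single ∅]
  · simp
  · intro B _ hB; simp [hB]
  · simp

/-- adaptive exposure trees: at each step there are at least `Kt` acceptable elements -/
def Thick (Kt : ℝ) : List (Finset α) → (List α → Prop) → Prop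
  | [], P => P []
  | F :: Fs, P => ∃ T ⊆ F, Kt ≤ (T.card : ℝ) ∧ ∀ U ∈ T, Thick Kt Fs (fun l => P (U :: l))

lemma Thick_mono {Kt : ℝ} : ∀ (Fs : List (Finset α)) {P Q : List α → Prop}, (∀ l, P l → Q l) →
    Thick Kt Fs P → Thick Kt Fs Q
  | [], P, Q, h, hP => h _ hP
  | F :: Fs, P, Q, h, hP => by
    obtain ⟨T, h1, h2, h3⟩ := hP
    exact ⟨T, h1, h2, fun U hU => Thick_mono Fs (fun l hl => h _ hl) (h3 U hU)⟩

lemma Thick_append {Kt : ℝ} : ∀ (F1 F2 : List (Finset α)) {P : List α → Prop},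
    Thick Kt F1 (fun l1 => Thick Kt F2 (fun l2 => P (l1 ++ l2))) → Thick Kt (F1 ++ F2) P
  | [], F2, P, h => h
  | F :: F1, F2, P, h => by
    obtain ⟨T, h1, h2, h3⟩ := h
    exact ⟨T, h1, h2, fun U hU => Thick_append F1 F2 (h3 U hU)⟩

open scoped Classical in
theorem Thick_prob {p : ℝ} (hp0 : 0 ≤ p) (hp1 : p ≤ 1) {Kt : ℝ} (f : ℝ)
    (hf : ∀ k : ℕ, Kt ≤ k → (1 - p) ^ k ≤ f) :
    ∀ (Fs : List (Finset α)) (U : Finset α) (P : List α → Prop), Fs.Pairwise Disjoint → (∀ F ∈ Fs, F ⊆ U) →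
      Thick Kt Fs P →
      Ew p U (fun B => if ∃ l, P l ∧ l.length = Fs.length ∧ ∀ x ∈ l, x ∈ B then (0:ℝ) else 1) ≤ Fs.length * f
  | [], U, P, _, _, h => by
    have : (fun B : Finset α => if ∃ l, P l ∧ l.length = ([] : List (Finset α)).length ∧ ∀ x ∈ l, x ∈ B then (0:ℝ) else 1) = fun _ => 0 := by
      funext B
      rw [if_pos ⟨[], h, rfl, by simp⟩]
    rw [this, Ew_const]; simp
  | F :: Fs, U, P, hd, hU, h => by
    obtain ⟨T, hTF, hTc, h3⟩ := h
    rw [List.pairwise_cons] at hd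
    have hFU : F ⊆ U := hU F (by simp)
    have h0 : U = F ∪ (U \ F) := (Finset.union_sdiff_of_subset hFU).symm
    have hFs : ∀ F' ∈ Fs, F' ⊆ U \ F := fun F' hF' =>
      Finset.subset_sdiff.2 ⟨hU F' (by simp [hF']), (hd.1 F' hF').symm⟩
    rw [h0, Ew_union p Finset.disjoint_sdiff]
    have hf0 : 0 ≤ f := le_trans (pow_nonneg (by linarith) _) (hf T.card hTc)
    calc _ ≤ Ew p F (fun A => (if Disjoint T A then (1:ℝ) else 0) + Fs.length * f) := by
          refine Ew_mono hp0 hp1 fun A hA => ?_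
          by_cases hTA : Disjoint T A
          · rw [if_pos hTA]
            calc _ ≤ Ew p (U \ F) (fun _ => (1:ℝ)) := Ew_mono hp0 hp1 fun B _ => by split_ifs <;> norm_num
              _ = 1 := Ew_const _ _ _
              _ ≤ _ := by
                have : (0:ℝ) ≤ Fs.length * f := by positivity
                linarith
          · rw [if_neg hTA, zero_add]
            rw [Finset.not_disjoint_iff] at hTA
            obtain ⟨y, hyT, hyA⟩ := hTA
            refine le_trans (Ew_mono hp0 hp1 fun B _ => ?_)
              (Thick_prob hp0 hp1 f hf Fs (U \ F) (fun l => P (y :: l)) hd.2 hFs (h3 y hyT))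
            by_cases hB : ∃ l, P (y :: l) ∧ l.length = Fs.length ∧ ∀ x ∈ l, x ∈ B
            · obtain ⟨l, l1, l2, l3⟩ := hB
              rw [if_pos]
              · split_ifs <;> norm_num
              · refine ⟨y :: l, l1, by simp [l2], ?_⟩
                intro x hx
                rw [List.mem_cons] at hx
                rcases hx with rfl | hx
                · exact Finset.mem_union_left _ hyA
                · exact Finset.mem_union_right _ (l3 x hx)
            · rw [if_neg hB]; split_ifs <;> norm_num
      _ = (1 - p) ^ T.card + Fs.length * f := by
          rw [Ew_add, Ew_const, Ew_miss p hTF]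
      _ ≤ f + Fs.length * f := by linarith [hf T.card hTc]
      _ = _ := by rw [List.length_cons]; push_cast; ring

end ProbTools

section Batch

def cov (l : List (Finset ℕ)) : Finset ℕ := l.foldr (· ∪ ·) ∅

lemma cov_nil : cov [] = ∅ := rfl
lemma cov_cons (a : Finset ℕ) (l : List (Finset ℕ)) : cov (a :: l) = a ∪ cov l := rfl
lemma cov_append (l1 l2 : List (Finset ℕ)) : cov (l1 ++ l2) = cov l1 ∪ cov l2 := by
  induction l1 with
  | nil => simp [cov_nil]
  | cons a l ih => rw [List.cons_append, cov_cons, cov_cons, ih, Finset.union_assoc]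
lemma mem_cov {l : List (Finset ℕ)} {x : ℕ} : x ∈ cov l ↔ ∃ a ∈ l, x ∈ a := by
  induction l with
  | nil => simp [cov_nil]
  | cons a l ih => rw [cov_cons, Finset.mem_union, ih]; simp

def fam (n r : ℕ) (Z : Finset ℕ) (x : ℕ) : Finset (Finset ℕ) := (Kn n r).filter (fun E => E ∩ Z = {x})

def nuN (n q : ℕ) (G : Finset (Finset ℕ)) (Y : Finset ℕ) : Finset (Finset ℕ) :=
  ((Finset.range n).powersetCard q).filter (fun A => A ∉ G ∧ Y ⊆ A)

lemma nuN_count {n q t : ℕ} (G : Finset (Finset ℕ)) (Y : Finset ℕ) :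
    ∑ U ∈ (Finset.range n \ Y).powersetCard t, (nuN n q G (Y ∪ U)).card = (nuN n q G Y).card * (q - Y.card).choose t := by
  classical
  have h1 : ∀ U ∈ (Finset.range n \ Y).powersetCard t,
      (nuN n q G (Y ∪ U)).card = ∑ A ∈ nuN n q G Y, if U ⊆ A then 1 else 0 := by
    intro U _
    rw [← Finset.card_filter]
    congr 1
    ext A
    simp only [nuN, Finset.mem_filter, Finset.union_subset_iff]
    tauto
  rw [Finset.sum_congr rfl h1, Finset.sum_comm, Finset.card_eq_sum_ones, Finset.sum_mul]
  refine Finset.sum_congr rfl fun A hA => ?_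
  simp only [nuN, Finset.mem_filter, Finset.mem_powersetCard] at hA
  obtain ⟨⟨hAn, hAq⟩, -, hYA⟩ := hA
  rw [← Finset.card_filter, one_mul]
  have : ((Finset.range n \ Y).powersetCard t).filter (fun U => U ⊆ A) = (A \ Y).powersetCard t := by
    ext U
    simp only [Finset.mem_filter, Finset.mem_powersetCard, Finset.subset_sdiff]
    constructor
    · rintro ⟨⟨⟨_, h⟩, h2⟩, h3⟩; exact ⟨⟨h3, h⟩, h2⟩
    · rintro ⟨⟨h3, h⟩, h2⟩; exact ⟨⟨⟨h3.trans hAn, h⟩, h2⟩, h3⟩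
  rw [this, Finset.card_powersetCard, Finset.card_sdiff_of_subset hYA, hAq]

lemma nuN_markov {n q t : ℕ} (hqn : q ≤ n) (G : Finset (Finset ℕ)) (Y : Finset ℕ) (hY : Y ⊆ Finset.range n)
    (hYq : Y.card + t ≤ q) (δ D : ℝ) (hδ : 0 < δ) (hD : 0 < D)
    (h : ((nuN n q G Y).card : ℝ) < δ * D * (n - Y.card).choose (q - Y.card)) :
    (1 - δ) * (n - Y.card).choose t ≤
      ((((Finset.range n \ Y).powersetCard t).filter
        (fun U => ((nuN n q G (Y ∪ U)).card : ℝ) < D * (n - (Y.card + t)).choose (q - (Y.card + t)))).card : ℝ) := by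
  classical
  set D' : ℝ := D * (n - (Y.card + t)).choose (q - (Y.card + t)) with hD'
  have hD'0 : 0 < D' := by
    rw [hD']
    have : 0 < (n - (Y.card + t)).choose (q - (Y.card + t)) := Nat.choose_pos (by omega)
    positivity
  set Us := (Finset.range n \ Y).powersetCard t
  have hUs : Us.card = (n - Y.card).choose t := by
    rw [Finset.card_powersetCard, Finset.card_sdiff_of_subset hY, Finset.card_range]
  have h1 := Finset.card_filter_add_card_filter_not (s := Us) (fun U => ((nuN n q G (Y ∪ U)).card : ℝ) < D')
  set Gd := Us.filter (fun U => ((nuN n q G (Y ∪ U)).card : ℝ) < D')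
  set Bd := Us.filter (fun U => ¬ ((nuN n q G (Y ∪ U)).card : ℝ) < D') with hBd
  have h2 : (Bd.card : ℝ) * D' ≤ (nuN n q G Y).card * (q - Y.card).choose t := by
    calc (Bd.card : ℝ) * D' = ∑ U ∈ Bd, D' := by simp
      _ ≤ ∑ U ∈ Bd, ((nuN n q G (Y ∪ U)).card : ℝ) := Finset.sum_le_sum fun U hU => by
          rw [hBd, Finset.mem_filter] at hU; exact not_lt.1 hU.2
      _ ≤ ∑ U ∈ Us, ((nuN n q G (Y ∪ U)).card : ℝ) :=
          Finset.sum_le_sum_of_subset_of_nonneg (Finset.filter_subset _ _) fun _ _ _ => by positivity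
      _ = _ := by
          have := nuN_count (n := n) (q := q) (t := t) G Y
          exact_mod_cast this
  have h3 : ((n - Y.card).choose (q - Y.card) : ℝ) * (q - Y.card).choose t =
      (n - Y.card).choose t * (n - (Y.card + t)).choose (q - (Y.card + t)) := by
    have := Nat.choose_mul (n := n - Y.card) (k := q - Y.card) (s := t) (by omega)
    rw [Nat.sub_sub, Nat.sub_sub] at this
    exact_mod_cast this
  have h4 : (Bd.card : ℝ) * D' ≤ (δ * (n - Y.card).choose t) * D' := by
    calc _ ≤ _ := h2
      _ ≤ δ * D * (n - Y.card).choose (q - Y.card) * (q - Y.card).choose t :=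
          mul_le_mul_of_nonneg_right h.le (by positivity)
      _ = δ * D * ((n - Y.card).choose (q - Y.card) * (q - Y.card).choose t) := by ring
      _ = _ := by rw [h3, hD']; ring
  have h5 := le_of_mul_le_mul_right h4 hD'0
  have h6 : (Gd.card : ℝ) + Bd.card = (n - Y.card).choose t := by rw [← hUs]; exact_mod_cast h1
  linarith

theorem batch {n r q : ℕ} (hr : 2 ≤ r) (hqn : q ≤ n) {Z W : Finset ℕ} (hW : W ⊆ Finset.range n) (hWZ : Disjoint W Z)
    (hZ : Z ⊆ Finset.range n) (G : Finset (Finset ℕ)) (hG : ∀ A ∈ G, A ⊆ W) (δ Kt : ℝ) (hδ : 0 < δ) (hδ1 : δ ≤ 1)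
    (hKt : Kt ≤ (1 - δ) * (n - q).choose (r - 1)) :
    ∀ (xs : List ℕ) (Y : Finset ℕ), xs.Nodup → (∀ x ∈ xs, x ∈ Z) → Y ⊆ Finset.range n →
      Y.card + xs.length * (r - 1) = q →
      ((nuN n q G Y).card : ℝ) < δ ^ xs.length * (n - Y.card).choose (q - Y.card) →
      Thick Kt (xs.map (fam n r Z)) (fun l => l.Pairwise Disjoint ∧ ∃ A ∈ G, A.card = q ∧ Y ⊆ A ∧ cov l = (A \ Y) ∪ xs.toFinset)
  | [], Y, _, _, hY, hYq, h => by
    refine ⟨List.Pairwise.nil, Y, ?_, by simpa using hYq, subset_rfl, by simp [cov_nil]⟩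
    have hq : Y.card = q := by simpa using hYq
    rw [hq] at h
    simp only [List.length_nil, pow_zero, Nat.sub_self, Nat.choose_zero_right, Nat.cast_one, mul_one] at h
    have h0 : (nuN n q G Y).card = 0 := by
      have : (nuN n q G Y).card < 1 := by exact_mod_cast h
      omega
    by_contra hYG
    have : Y ∈ nuN n q G Y := by
      simp only [nuN, Finset.mem_filter, Finset.mem_powersetCard]
      exact ⟨⟨hY, hq⟩, hYG, subset_rfl⟩
    rw [Finset.card_eq_zero] at h0
    rw [h0] at this
    exact absurd this (Finset.notMem_empty _)
  | x :: xs, Y, hnd, hxZ, hY, hYq, h => by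
    classical
    rw [List.nodup_cons] at hnd
    have hxZ' : x ∈ Z := hxZ x (by simp)
    have hlen : Y.card + (r - 1) + xs.length * (r - 1) = q := by
      rw [← hYq, List.length_cons]; ring
    have hmk := nuN_markov (t := r - 1) hqn G Y hY (by omega) δ (δ ^ xs.length) hδ (by positivity)
      (by rw [List.length_cons, pow_succ] at h; linarith [h, mul_comm (δ ^ xs.length) δ])
    set Us := ((Finset.range n \ Y).powersetCard (r - 1)).filter
        (fun U => ((nuN n q G (Y ∪ U)).card : ℝ) < δ ^ xs.length * (n - (Y.card + (r - 1))).choose (q - (Y.card + (r - 1)))) with hUs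
    have hU : ∀ U ∈ Us, U ⊆ Finset.range n ∧ Disjoint U Y ∧ U.card = r - 1 ∧
        Thick Kt (xs.map (fam n r Z)) (fun l => l.Pairwise Disjoint ∧ ∃ A ∈ G, A.card = q ∧ Y ∪ U ⊆ A ∧ cov l = (A \ (Y ∪ U)) ∪ xs.toFinset) := by
      intro U hU
      rw [hUs, Finset.mem_filter, Finset.mem_powersetCard, Finset.subset_sdiff] at hU
      obtain ⟨⟨⟨u1, u2⟩, u3⟩, u4⟩ := hU
      have hc : (Y ∪ U).card = Y.card + (r - 1) := by
        rw [Finset.card_union_of_disjoint u2.symm, u3]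
      refine ⟨u1, u2, u3, batch hr hqn hW hWZ hZ G hG δ Kt hδ hδ1 hKt xs (Y ∪ U) hnd.2 (fun y hy => hxZ y (by simp [hy]))
        (Finset.union_subset hY u1) (by rw [hc]; exact hlen) (by rw [hc]; exact u4)⟩
    have hUW : ∀ U ∈ Us, U ⊆ W := by
      intro U hUU
      obtain ⟨-, -, u3, u4⟩ := hU U hUU
      rw [hUs, Finset.mem_filter, Finset.mem_powersetCard, Finset.subset_sdiff] at hUU
      obtain ⟨⟨⟨u1, u2⟩, -⟩, u5⟩ := hUU
      have hc : (Y ∪ U).card = Y.card + (r - 1) := by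
        rw [Finset.card_union_of_disjoint u2.symm, u3]
      -- some good set contains `Y ∪ U`
      by_contra hcon
      have hall : (((Finset.range n).powersetCard q).filter (fun A => Y ∪ U ⊆ A)) ⊆ nuN n q G (Y ∪ U) := by
        intro A hA
        rw [Finset.mem_filter] at hA
        rw [nuN, Finset.mem_filter]
        exact ⟨hA.1, fun hAG => hcon ((Finset.subset_union_right.trans hA.2).trans (hG A hAG)), hA.2⟩
      have hcount : (((Finset.range n).powersetCard q).filter (fun A => Y ∪ U ⊆ A)).card =
          (n - (Y.card + (r - 1))).choose (q - (Y.card + (r - 1))) := by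
        rw [← hc]
        have : ((Finset.range n \ (Y ∪ U)).powersetCard (q - (Y ∪ U).card)).card = (n - (Y ∪ U).card).choose (q - (Y ∪ U).card) := by
          rw [Finset.card_powersetCard, Finset.card_sdiff_of_subset (Finset.union_subset hY u1), Finset.card_range]
        rw [← this]
        refine Finset.card_bij (fun A _ => A \ (Y ∪ U)) ?_ ?_ ?_
        · intro A hA
          rw [Finset.mem_filter, Finset.mem_powersetCard] at hA
          rw [Finset.mem_powersetCard, Finset.card_sdiff_of_subset hA.2, hA.1.2]
          exact ⟨Finset.sdiff_subset_sdiff hA.1.1 subset_rfl, rfl⟩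
        · intro A hA B hB hAB
          rw [Finset.mem_filter] at hA hB
          rw [← Finset.sdiff_union_of_subset hA.2, ← Finset.sdiff_union_of_subset hB.2, hAB]
        · intro A hA
          rw [Finset.mem_powersetCard, Finset.subset_sdiff] at hA
          refine ⟨A ∪ (Y ∪ U), ?_, ?_⟩
          · rw [Finset.mem_filter, Finset.mem_powersetCard, Finset.card_union_of_disjoint hA.1.2, hA.2]
            exact ⟨⟨Finset.union_subset hA.1.1 (Finset.union_subset hY u1), by omega⟩, Finset.subset_union_right⟩
          · rw [Finset.union_sdiff_right]
            exact Finset.sdiff_eq_self_of_disjoint hA.1.2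
      have h1 := Finset.card_le_card hall
      rw [hcount] at h1
      have h2 : ((n - (Y.card + (r - 1))).choose (q - (Y.card + (r - 1))) : ℝ) ≤ (nuN n q G (Y ∪ U)).card := by exact_mod_cast h1
      have h3 : δ ^ xs.length ≤ 1 := pow_le_one₀ hδ.le hδ1
      have h4 := mul_le_mul_of_nonneg_right h3 (Nat.cast_nonneg (α := ℝ) ((n - (Y.card + (r - 1))).choose (q - (Y.card + (r - 1)))))
      linarith
    have hxW : x ∉ W := fun hx => Finset.disjoint_left.1 hWZ hx hxZ'
    refine ⟨Us.image (fun U => insert x U), ?_, ?_, ?_⟩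
    · intro E hE
      rw [Finset.mem_image] at hE
      obtain ⟨U, hUU, rfl⟩ := hE
      obtain ⟨u1, u2, u3, u4⟩ := hU U hUU
      have uW := hUW U hUU
      rw [fam, Finset.mem_filter, Kn, Finset.mem_powersetCard]
      refine ⟨⟨Finset.insert_subset (hZ hxZ') u1, ?_⟩, ?_⟩
      · rw [Finset.card_insert_of_notMem (fun h => hxW (uW h)), u3]; omega
      · rw [Finset.insert_inter_of_mem hxZ', Finset.disjoint_iff_inter_eq_empty.1 (hWZ.mono_left uW)]
        rfl
    · rw [Finset.card_image_of_injOn]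
      · refine hKt.trans (le_trans ?_ hmk)
        refine mul_le_mul_of_nonneg_left ?_ (by linarith)
        exact_mod_cast Nat.choose_le_choose _ (by omega)
      · intro U hUU U' hUU' heq
        have e1 : x ∉ U := fun h => hxW (hUW U hUU h)
        have e2 : x ∉ U' := fun h => hxW (hUW U' hUU' h)
        rw [← Finset.erase_insert e1, ← Finset.erase_insert e2]
        exact congrArg (fun s => Finset.erase s x) heq
    · intro E hE
      rw [Finset.mem_image] at hE
      obtain ⟨U, hUU, rfl⟩ := hE
      obtain ⟨u1, u2, u3, u4⟩ := hU U hUU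
      have uW := hUW U hUU
      refine Thick_mono _ ?_ u4
      rintro l ⟨l1, A, hA, hAq, hYA, hcov⟩
      have hAW := hG A hA
      refine ⟨?_, A, hA, hAq, Finset.subset_union_left.trans hYA, ?_⟩
      · rw [List.pairwise_cons]
        refine ⟨fun E hE => ?_, l1⟩
        rw [Finset.disjoint_left]
        intro y hy hyE
        have hyc : y ∈ cov l := mem_cov.2 ⟨E, hE, hyE⟩
        rw [hcov, Finset.mem_union, Finset.mem_sdiff, Finset.mem_union, List.mem_toFinset] at hyc
        rw [Finset.mem_insert] at hy
        rcases hy with rfl | hy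
        · rcases hyc with hyc | hyc
          · exact hxW (hAW hyc.1)
          · exact hnd.1 hyc
        · rcases hyc with hyc | hyc
          · exact hyc.2 (Or.inr hy)
          · exact Finset.disjoint_left.1 hWZ (uW hy) (hxZ y (by simp [hyc]))
      · rw [cov_cons, hcov]
        have hUA : U ⊆ A := Finset.subset_union_right.trans hYA
        ext y
        simp only [Finset.mem_union, Finset.mem_insert, Finset.mem_sdiff, List.mem_toFinset, List.mem_cons]
        have a1 : y ∈ U → y ∉ Y := fun h h' => Finset.disjoint_left.1 u2 h h'
        have a2 : y ∈ U → y ∈ A := fun h => hUA h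
        tauto

end Batch

section Greedy

lemma Sx_mono {M i j : ℕ} (h : i ≤ j) : Sx M i ⊆ Sx M j := by
  intro x hx
  simp only [Sx, Finset.mem_filter, Finset.mem_univ, true_and] at *
  omega

lemma Large_mono {n r M : ℕ} {T τ : ℝ} {K : ℕ} {e : Fin M → RR n r} {S S' : Finset (Fin M)} (h : S ⊆ S')
    {W : Finset ℕ} (hL : Large T τ K e S W) : Large T τ K e S' W := by
  obtain ⟨h1, k, h2, h3, h4⟩ := hL
  exact ⟨h1, k, h2, h3, h4.trans (phi_mono e h W)⟩

lemma advance {n r M : ℕ} {T τ β : ℝ} {K : ℕ} {e : Fin M → RR n r} {W : Finset ℕ} :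
    ∀ (t i : ℕ), M - i ≤ t → Large T τ K e (Sx M i) W → ¬ Doom T τ β K e i W →
      ∃ i', i ≤ i' ∧ ¬ Doom T τ β K e i' W ∧ ¬ Bad τ β e (Sx M i') W := by
  intro t
  induction t with
  | zero =>
    intro i hi _ hD
    exact absurd (Doom_top (by omega)) hD
  | succ t ih =>
    intro i hi hL hD
    by_cases hB : Bad τ β e (Sx M i) W
    · have hD' : ¬ Doom T τ β K e (i + 1) W := fun h => hD (Doom_step hL hB h)
      obtain ⟨i', h1, h2⟩ := ih (i + 1) (by omega) (Large_mono (Sx_mono (by omega)) hL) hD'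
      exact ⟨i', by omega, h2⟩
    · exact ⟨i, le_rfl, hD, hB⟩

lemma hit_count {n q z : ℕ} (hq : 0 < q) (D : Finset ℕ) (hD : D ⊆ Finset.range n) (hz : D.card ≤ z) :
    (n:ℝ) * ((((Finset.range n).powersetCard q).filter (fun A => ¬ Disjoint A D)).card : ℝ) ≤ z * q * n.choose q := by
  classical
  rcases Nat.eq_zero_or_pos n with rfl | hn
  · simp; positivity
  obtain ⟨n', rfl⟩ : ∃ n', n = n' + 1 := ⟨n - 1, by omega⟩
  obtain ⟨q', rfl⟩ : ∃ q', q = q' + 1 := ⟨q - 1, by omega⟩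
  have h1 : ((Finset.range (n' + 1)).powersetCard (q' + 1)).filter (fun A => ¬ Disjoint A D) ⊆
      D.biUnion (fun v => (((Finset.range (n' + 1)).erase v).powersetCard q').image (fun A => insert v A)) := by
    intro A hA
    rw [Finset.mem_filter, Finset.mem_powersetCard, Finset.not_disjoint_iff] at hA
    obtain ⟨⟨a1, a2⟩, v, hv, hvD⟩ := hA
    rw [Finset.mem_biUnion]
    refine ⟨v, hvD, Finset.mem_image.2 ⟨A.erase v, ?_, Finset.insert_erase hv⟩⟩
    rw [Finset.mem_powersetCard, Finset.card_erase_of_mem hv, a2]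
    exact ⟨Finset.erase_subset_erase _ a1, by simp⟩
  have h2 : (((Finset.range (n' + 1)).powersetCard (q' + 1)).filter (fun A => ¬ Disjoint A D)).card ≤ z * n'.choose q' := by
    refine (Finset.card_le_card h1).trans (Finset.card_biUnion_le.trans ?_)
    calc _ ≤ ∑ v ∈ D, n'.choose q' := Finset.sum_le_sum fun v hv => by
          refine Finset.card_image_le.trans ?_
          rw [Finset.card_powersetCard, Finset.card_erase_of_mem (hD hv), Finset.card_range]
          simp
      _ = D.card * n'.choose q' := by simp
      _ ≤ _ := Nat.mul_le_mul_right _ hz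
  have h3 := Nat.add_one_mul_choose_eq n' q'
  have h4 : (n' + 1) * (((Finset.range (n' + 1)).powersetCard (q' + 1)).filter (fun A => ¬ Disjoint A D)).card ≤
      z * (q' + 1) * (n' + 1).choose (q' + 1) := by
    calc _ ≤ (n' + 1) * (z * n'.choose q') := Nat.mul_le_mul_left _ h2
      _ = z * ((n' + 1) * n'.choose q') := by ring
      _ = _ := by rw [h3]; ring
  exact_mod_cast h4

open scoped Classical in
noncomputable def goodA {n r M : ℕ} (τ : ℝ) (e : Fin M → RR n r) (S : Finset (Fin M)) (W : Finset ℕ) : Finset (Finset ℕ) :=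
  (W.powersetCard (r * (r - 1))).filter (fun A => τ ^ (r - 1) * phi e S W ≤ phi e S (W \ A))

lemma nongood_count {n r M : ℕ} (hr : 2 ≤ r) (hn : 0 < n) {τ β : ℝ} {K k : ℕ} {e : Fin M → RR n r} {S : Finset (Fin M)} {W : Finset ℕ}
    (hk : (Finset.range n \ W).card = r * k) (hkK : k ≤ K)
    (hKβ : ((r * K : ℕ):ℝ) * (r * (r - 1) : ℕ) ≤ β * n) (hB : ¬ Bad τ β e S W) :
    ((nuN n (r * (r - 1)) (goodA τ e S W) ∅).card : ℝ) < 2 * β * n.choose (r * (r - 1)) := by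
  classical
  have hq : 0 < r * (r - 1) := Nat.mul_pos (by omega) (by omega)
  have h1 : nuN n (r * (r - 1)) (goodA τ e S W) ∅ ⊆ badA τ e S W ∪
      ((Finset.range n).powersetCard (r * (r - 1))).filter (fun A => ¬ Disjoint A (Finset.range n \ W)) := by
    intro A hA
    rw [nuN, Finset.mem_filter] at hA
    obtain ⟨a1, a2, -⟩ := hA
    rw [Finset.mem_union]
    by_cases hd : Disjoint A (Finset.range n \ W)
    · left
      unfold badA
      unfold goodA at a2
      rw [Finset.mem_powersetCard] at a1
      have hAW : A ⊆ W := by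
        intro x hx
        by_contra hxW
        exact Finset.disjoint_left.1 hd hx (Finset.mem_sdiff.2 ⟨a1.1 hx, hxW⟩)
      rw [Finset.mem_filter, Finset.mem_powersetCard] at a2 ⊢
      refine ⟨⟨hAW, a1.2⟩, ?_⟩
      by_contra hcon
      exact a2 ⟨⟨hAW, a1.2⟩, not_lt.1 hcon⟩
    · right; exact Finset.mem_filter.2 ⟨a1, hd⟩
  have h2 : ((nuN n (r * (r - 1)) (goodA τ e S W) ∅).card : ℝ) ≤ (badA τ e S W).card +
      (((Finset.range n).powersetCard (r * (r - 1))).filter (fun A => ¬ Disjoint A (Finset.range n \ W))).card := by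
    exact_mod_cast (Finset.card_le_card h1).trans (Finset.card_union_le _ _)
  have h3 := hit_count hq (Finset.range n \ W) Finset.sdiff_subset (z := r * K) (by rw [hk]; exact Nat.mul_le_mul_left _ hkK)
  have h4 : (n:ℝ) * (((Finset.range n).powersetCard (r * (r - 1))).filter (fun A => ¬ Disjoint A (Finset.range n \ W))).card
      ≤ n * (β * n.choose (r * (r - 1))) := by
    refine h3.trans ((mul_le_mul_of_nonneg_right hKβ (by positivity)).trans (le_of_eq (by ring)))
  have h5 := le_of_mul_le_mul_left h4 (by exact_mod_cast hn)
  unfold Bad at hB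
  rw [not_le] at hB
  linarith

theorem greedy {n r M : ℕ} (hr : 2 ≤ r) (hqn : r * (r - 1) ≤ n) (T τ β δ Kt : ℝ) (K : ℕ) (hT : 0 < T) (hτ : 0 < τ)
    (hδ : 0 < δ) (hδ1 : δ ≤ 1) (hβδ : 2 * β ≤ δ ^ r)
    (hKt : Kt ≤ (1 - δ) * (n - r * (r - 1)).choose (r - 1))
    (hKβ : ((r * K : ℕ):ℝ) * (r * (r - 1) : ℕ) ≤ β * n)
    (e : Fin M → RR n r) {Z : Finset ℕ} (hZ : Z ⊆ Finset.range n) :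
    ∀ (b : ℕ) (xs : List ℕ) (i k : ℕ) (W : Finset ℕ), xs.length = r * b → xs.Nodup → (∀ x ∈ xs, x ∈ Z) →
      W ⊆ Finset.range n → Disjoint W Z → (Finset.range n \ W).card = r * k → k + (r - 1) * b ≤ K →
      T * τ ^ k ≤ phi e (Sx M i) W → ¬ Doom T τ β K e i W →
      Thick Kt (xs.map (fam n r Z)) (fun l => l.Pairwise Disjoint ∧ cov l ⊆ W ∪ xs.toFinset ∧ xs.toFinset ⊆ cov l ∧
        0 < phi e Finset.univ (W \ cov l)) := by
  intro b
  induction b with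
  | zero =>
    intro xs i k W hlen hnd hxZ hW hWZ hk hkK hphi hD
    have : xs = [] := List.length_eq_zero_iff.1 (by simpa using hlen)
    subst this
    refine ⟨List.Pairwise.nil, by simp [cov_nil], by simp, ?_⟩
    rw [cov_nil, Finset.sdiff_empty]
    refine lt_of_lt_of_le ?_ (hphi.trans (phi_mono e (Finset.subset_univ _) W))
    positivity
  | succ b ih =>
    intro xs i k W hlen hnd hxZ hW hWZ hk hkK hphi hD
    have hkK' : k + (r - 1) + (r - 1) * b ≤ K := by
      have : (r - 1) * (b + 1) = (r - 1) + (r - 1) * b := by ring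
      omega
    have hn : 0 < n := by
      have : 0 < r * (r - 1) := Nat.mul_pos (by omega) (by omega)
      omega
    obtain ⟨i', hii', hD', hB'⟩ := advance (M - i) i le_rfl ⟨hW, k, by omega, hk, hphi⟩ hD
    have hphi' : T * τ ^ k ≤ phi e (Sx M i') W := hphi.trans (phi_mono e (Sx_mono hii') W)
    have hng := nongood_count hr hn hk (by omega : k ≤ K) hKβ hB'
    set xs1 := xs.take r with hxs1
    set xs2 := xs.drop r with hxs2
    have hx12 : xs1 ++ xs2 = xs := List.take_append_drop r xs
    have hrb : r * (b + 1) = r + r * b := by ring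
    have hl1 : xs1.length = r := by rw [hxs1, List.length_take, hlen]; omega
    have hl2 : xs2.length = r * b := by rw [hxs2, List.length_drop, hlen]; omega
    have hnd12 : xs1.Nodup ∧ xs2.Nodup ∧ ∀ a ∈ xs1, ∀ c ∈ xs2, a ≠ c := by
      rw [← hx12, List.nodup_append] at hnd
      exact hnd
    have hz1 : ∀ x ∈ xs1, x ∈ Z := fun x hx => hxZ x (by rw [← hx12]; simp [hx])
    have hz2 : ∀ x ∈ xs2, x ∈ Z := fun x hx => hxZ x (by rw [← hx12]; simp [hx])
    rw [← hx12, List.map_append]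
    refine Thick_append _ _ ?_
    have hb := batch hr hqn hW hWZ hZ (goodA τ e (Sx M i') W)
      (fun A hA => by unfold goodA at hA; rw [Finset.mem_filter, Finset.mem_powersetCard] at hA; exact hA.1.1)
      δ Kt hδ hδ1 hKt xs1 ∅ hnd12.1 hz1 (by simp) (by rw [hl1]; simp)
      (by
        rw [hl1]
        simp only [Finset.card_empty, Nat.sub_zero]
        exact hng.trans_le (mul_le_mul_of_nonneg_right hβδ (by positivity)))
    refine Thick_mono _ ?_ hb
    rintro l1 ⟨hl1d, A, hA, hAq, -, hcov⟩
    unfold goodA at hA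
    rw [Finset.mem_filter, Finset.mem_powersetCard] at hA
    obtain ⟨⟨hAW, -⟩, hAphi⟩ := hA
    rw [Finset.sdiff_empty] at hcov
    have hih := ih xs2 i' (k + (r - 1)) (W \ A) hl2 hnd12.2.1 hz2 (Finset.sdiff_subset.trans hW)
      (hWZ.mono_left Finset.sdiff_subset)
      (by
        have e1 : Finset.range n \ (W \ A) = (Finset.range n \ W) ∪ A := by
          ext x
          simp only [Finset.mem_sdiff, Finset.mem_union]
          have := @hW x
          have := @hAW x
          tauto
        rw [e1, Finset.card_union_of_disjoint, hk, hAq, Nat.mul_add]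
        exact Finset.disjoint_left.2 fun x hx hx' => (Finset.mem_sdiff.1 hx).2 (hAW hx'))
      hkK'
      (by
        rw [pow_add]
        calc T * (τ ^ k * τ ^ (r - 1)) = τ ^ (r - 1) * (T * τ ^ k) := by ring
          _ ≤ τ ^ (r - 1) * phi e (Sx M i') W := mul_le_mul_of_nonneg_left hphi' (by positivity)
          _ ≤ _ := hAphi)
      (fun h => hD' (Doom_mono Finset.sdiff_subset h))
    refine Thick_mono _ ?_ hih
    rintro l2 ⟨hl2d, c1, c2, c3⟩
    have hWx1 : ∀ x ∈ W, x ∉ xs1 ∧ x ∉ xs2 := fun x hx =>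
      ⟨fun h => Finset.disjoint_left.1 hWZ hx (hz1 x h), fun h => Finset.disjoint_left.1 hWZ hx (hz2 x h)⟩
    have hcd : Disjoint (cov l1) (cov l2) := by
      rw [Finset.disjoint_left]
      intro x h1 h2
      have h2 := c1 h2
      rw [hcov, Finset.mem_union, List.mem_toFinset] at h1
      rw [Finset.mem_union, Finset.mem_sdiff, List.mem_toFinset] at h2
      rcases h1 with h1 | h1
      · rcases h2 with h2 | h2
        · exact h2.2 h1
        · exact (hWx1 x (hAW h1)).2 h2
      · rcases h2 with h2 | h2
        · exact (hWx1 x h2.1).1 h1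
        · exact hnd12.2.2 x h1 x h2 rfl
    refine ⟨?_, ?_, ?_, ?_⟩
    · rw [List.pairwise_append]
      refine ⟨hl1d, hl2d, fun a ha c hc => ?_⟩
      exact hcd.mono (fun x hx => mem_cov.2 ⟨a, ha, hx⟩) (fun x hx => mem_cov.2 ⟨c, hc, hx⟩)
    · rw [cov_append, hcov]
      intro x hx
      rw [Finset.mem_union, Finset.mem_union, List.mem_toFinset] at hx
      rw [Finset.mem_union, List.mem_toFinset, List.mem_append]
      rcases hx with (hx | hx) | hx
      · exact Or.inl (hAW hx)
      · exact Or.inr (Or.inl hx)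
      · have := c1 hx
        rw [Finset.mem_union, Finset.mem_sdiff, List.mem_toFinset] at this
        tauto
    · rw [cov_append, hcov]
      intro x hx
      rw [List.mem_toFinset, List.mem_append] at hx
      rw [Finset.mem_union, Finset.mem_union, List.mem_toFinset]
      rcases hx with hx | hx
      · exact Or.inl (Or.inr hx)
      · exact Or.inr (c2 (List.mem_toFinset.2 hx))
    · convert c3 using 1
      congr 1
      rw [cov_append, hcov]
      ext x
      simp only [Finset.mem_sdiff, Finset.mem_union, List.mem_toFinset]
      have := hWx1 x
      tauto

end Greedy

section PerE

lemma pm_of_parts {n r M : ℕ} (hr : 0 < r) (e : Fin M → RR n r) (B : Finset (Finset ℕ)) (l : List (Finset ℕ))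
    (hl : l.Pairwise Disjoint) (hlB : ∀ x ∈ l, x ∈ B) (hc : cov l ⊆ Finset.range n)
    (hphi : 0 < phi e Finset.univ (Finset.range n \ cov l)) :
    0 < pmCount (Finset.range n) (Finset.univ.image (fun i => (e i).1) ∪ B) := by
  classical
  unfold phi at hphi
  have h1 : 0 < (pmI (fun i => (e i).1) Finset.univ (Finset.range n \ cov l)).card := by exact_mod_cast hphi
  rw [Finset.card_pos] at h1
  obtain ⟨J, hJ⟩ := h1
  rw [mem_pmI] at hJ
  obtain ⟨-, j1, j2⟩ := hJ
  unfold pmCount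
  rw [Finset.card_pos]
  refine ⟨l.toFinset ∪ J.image (fun i => (e i).1), ?_⟩
  unfold pmSet
  have hls : ∀ A ∈ l, ∀ A' ∈ l, A ≠ A' → Disjoint A A' := by
    intro A hA A' hA' hne
    exact hl.forall hA hA' hne
  have hcross : ∀ A ∈ l, ∀ i ∈ J, Disjoint A (e i).1 := by
    intro A hA i hi
    rw [Finset.disjoint_left]
    intro x hx hx'
    have : x ∈ J.biUnion (fun i => (e i).1) := Finset.mem_biUnion.2 ⟨i, hi, hx'⟩
    rw [j2, Finset.mem_sdiff] at this
    exact this.2 (mem_cov.2 ⟨A, hA, hx⟩)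
  rw [Finset.mem_filter, Finset.mem_powerset]
  refine ⟨?_, ?_, ?_⟩
  · refine Finset.union_subset ?_ ?_
    · intro A hA; exact Finset.mem_union_right _ (hlB A (List.mem_toFinset.1 hA))
    · exact (Finset.image_subset_image (Finset.subset_univ _)).trans Finset.subset_union_left
  · intro A hA A' hA' hne
    rw [← Finset.disjoint_iff_inter_eq_empty]
    rw [Finset.mem_union, List.mem_toFinset, Finset.mem_image] at hA hA'
    rcases hA with hA | ⟨i, hi, rfl⟩ <;> rcases hA' with hA' | ⟨i', hi', rfl⟩
    · exact hls A hA A' hA' hne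
    · exact hcross A hA i' hi'
    · exact (hcross A' hA' i hi).symm
    · have := j1 i hi i' hi' (fun h => hne (by rw [h]))
      first
        | exact this
        | exact Finset.disjoint_iff_inter_eq_empty.2 this
  · ext x
    constructor
    · intro hx
      rw [Finset.mem_biUnion] at hx
      obtain ⟨A, hA, hx⟩ := hx
      rw [Finset.mem_union, List.mem_toFinset, Finset.mem_image] at hA
      rcases hA with hA | ⟨i, hi, rfl⟩
      · exact hc (mem_cov.2 ⟨A, hA, hx⟩)
      · exact (RR_mem (e i)).1 hx
    · intro hx
      rw [Finset.mem_biUnion]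
      by_cases hxc : x ∈ cov l
      · obtain ⟨A, hA, hxA⟩ := mem_cov.1 hxc
        exact ⟨A, Finset.mem_union_left _ (List.mem_toFinset.2 hA), hxA⟩
      · have : x ∈ J.biUnion (fun i => (e i).1) := by
          rw [j2]; exact Finset.mem_sdiff.2 ⟨hx, hxc⟩
        obtain ⟨i, hi, hxi⟩ := Finset.mem_biUnion.1 this
        exact ⟨(e i).1, Finset.mem_union_right _ (Finset.mem_image_of_mem _ hi), hxi⟩

open scoped Classical in
/-- probability (over `B`) that `A ∪ B` has no perfect matching -/
noncomputable def failB (n r : ℕ) (p : ℝ) (A : Finset (Finset ℕ)) : ℝ :=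
  Ew p (Kn n r) (fun B => if 0 < pmCount (Finset.range n) (A ∪ B) then (0:ℝ) else 1)

theorem per_e {n r M i0 d : ℕ} (hr : 2 ≤ r) (hqn : r * (r - 1) ≤ n) (T τ β δ Kt p f : ℝ) (K : ℕ) (hT : 0 < T) (hτ : 0 < τ)
    (hτ1 : τ ≤ 1)
    (hδ : 0 < δ) (hδ1 : δ ≤ 1) (hβδ : 2 * β ≤ δ ^ r)
    (hKt : Kt ≤ (1 - δ) * (n - r * (r - 1)).choose (r - 1))
    (hKβ : ((r * K : ℕ):ℝ) * (r * (r - 1) : ℕ) ≤ β * n) (hdK : r * d ≤ K)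
    (hp0 : 0 ≤ p) (hp1 : p ≤ 1) (hf : ∀ k : ℕ, Kt ≤ k → (1 - p) ^ k ≤ f) (hf0 : 0 ≤ f)
    (e : Fin M → RR n r) (hD : ¬ Doom T τ β K e i0 (Finset.range n))
    (hnear : ∃ Z ⊆ Finset.range n, (∃ k, k ≤ d ∧ Z.card = r * k) ∧ T ≤ phi e (Sx M i0) (Finset.range n \ Z)) :
    failB n r p (Finset.univ.image (fun i => (e i).1)) ≤ n * f := by
  classical
  obtain ⟨Z, hZ, ⟨k, hk, hZk⟩, hphi⟩ := hnear
  have hth := greedy hr hqn T τ β δ Kt K hT hτ hδ hδ1 hβδ hKt hKβ e hZ k Z.toList i0 k (Finset.range n \ Z)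
    (by rw [Finset.length_toList, hZk]) Z.nodup_toList (fun x hx => Finset.mem_toList.1 hx) Finset.sdiff_subset
    Finset.sdiff_disjoint (by rw [Finset.sdiff_sdiff_eq_self hZ, hZk])
    (by
      have h1 : k + (r - 1) * k = r * k := by
        obtain ⟨s, rfl⟩ : ∃ s, r = s + 1 := ⟨r - 1, by omega⟩
        simp; ring
      rw [h1]
      exact (Nat.mul_le_mul_left _ hk).trans hdK)
    ((mul_le_of_le_one_right hT.le (pow_le_one₀ hτ.le hτ1)).trans hphi)
    (fun h => hD (Doom_mono Finset.sdiff_subset h))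
  have hpr := Thick_prob hp0 hp1 f hf (Z.toList.map (fam n r Z)) (Kn n r) _
    (by
      rw [List.pairwise_map]
      refine Z.nodup_toList.imp ?_
      intro a b hab
      rw [Finset.disjoint_left]
      intro E hE hE'
      rw [fam, Finset.mem_filter] at hE hE'
      rw [hE.2] at hE'
      exact hab (Finset.singleton_inj.1 hE'.2))
    (by
      intro F hF
      rw [List.mem_map] at hF
      obtain ⟨x, -, rfl⟩ := hF
      exact Finset.filter_subset _ _) hth
  unfold failB
  refine le_trans (Ew_mono hp0 hp1 fun B _ => ?_) (hpr.trans ?_)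
  · split_ifs with h1 h2
    · exact le_rfl
    · norm_num
    · rename_i h2
      exfalso
      obtain ⟨l, ⟨l1, l2, l3, l4⟩, -, l5⟩ := h2
      refine h1 (pm_of_parts (by omega) e B l l1 l5 ?_ ?_)
      · refine l2.trans ?_
        rw [Finset.toList_toFinset]
        exact Finset.union_subset Finset.sdiff_subset hZ
      · convert l4 using 2
        rw [Finset.toList_toFinset] at l3
        ext x
        simp only [Finset.mem_sdiff]
        have := @l3 x
        tauto
    · exact le_rfl
  · rw [List.length_map, Finset.length_toList]
    refine mul_le_mul_of_nonneg_right ?_ hf0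
    have := Finset.card_le_card hZ
    rw [Finset.card_range] at this
    exact_mod_cast this

end PerE

section QSec
open Function

lemma two_common {n r : ℕ} (hr : 2 ≤ r) (hrn : r ≤ n) (x : RR n r) :
    (∑ y : RR n r, (if 2 ≤ (x.1 ∩ y.1).card then (1:ℝ) else 0)) * (n:ℝ) ^ 2 ≤ (r:ℝ) ^ 4 * n.choose r := by
  classical
  rw [Finset.sum_boole]
  have h1 : (Finset.univ.filter (fun y : RR n r => 2 ≤ (x.1 ∩ y.1).card)).card ≤ r.choose 2 * (n - 2).choose (r - 2) := by
    have hsub : (Finset.univ.filter (fun y : RR n r => 2 ≤ (x.1 ∩ y.1).card)).image (fun y => y.1) ⊆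
        (x.1.powersetCard 2).biUnion (fun D => ((Finset.range n \ D).powersetCard (r - 2)).image (fun A => A ∪ D)) := by
      intro A hA
      rw [Finset.mem_image] at hA
      obtain ⟨y, hy, rfl⟩ := hA
      have hy := (Finset.mem_filter.1 hy).2
      obtain ⟨D, hD, hDc⟩ := Finset.exists_subset_card_eq hy
      have hDy : D ⊆ y.1 := hD.trans Finset.inter_subset_right
      rw [Finset.mem_biUnion]
      refine ⟨D, Finset.mem_powersetCard.2 ⟨hD.trans Finset.inter_subset_left, hDc⟩, Finset.mem_image.2 ⟨y.1 \ D, ?_, Finset.sdiff_union_of_subset hDy⟩⟩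
      rw [Finset.mem_powersetCard, Finset.card_sdiff_of_subset hDy, (RR_mem y).2, hDc]
      exact ⟨Finset.sdiff_subset_sdiff (RR_mem y).1 subset_rfl, rfl⟩
    rw [← Finset.card_image_of_injective _ (Subtype.val_injective (p := fun A => A ∈ Kn n r))]
    refine (Finset.card_le_card hsub).trans (Finset.card_biUnion_le.trans ?_)
    calc _ ≤ ∑ D ∈ x.1.powersetCard 2, (n - 2).choose (r - 2) := Finset.sum_le_sum fun D hD => by
          rw [Finset.mem_powersetCard] at hD
          refine Finset.card_image_le.trans ?_
          rw [Finset.card_powersetCard, Finset.card_sdiff_of_subset (hD.1.trans (RR_mem x).1), hD.2, Finset.card_range]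
      _ = _ := by rw [Finset.sum_const, Finset.card_powersetCard, (RR_mem x).2, smul_eq_mul]
  have h2 := choose_sub_le n r 2 hrn hr
  have h3 : r.choose 2 ≤ r ^ 2 := Nat.choose_le_pow r 2
  have h4 : (Finset.univ.filter (fun y : RR n r => 2 ≤ (x.1 ∩ y.1).card)).card * n ^ 2 ≤ r ^ 4 * n.choose r := by
    calc _ ≤ r.choose 2 * (n - 2).choose (r - 2) * n ^ 2 := Nat.mul_le_mul_right _ h1
      _ = r.choose 2 * ((n - 2).choose (r - 2) * n ^ 2) := by ring
      _ ≤ r ^ 2 * (n.choose r * r ^ 2) := Nat.mul_le_mul h3 h2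
      _ = _ := by ring
  exact_mod_cast h4

open scoped Classical in
theorem Q_bound {n r M l : ℕ} (hr : 2 ≤ r) (hrn : r ≤ n) :
    ((Finset.univ.filter (fun e : Fin M → RR n r => ¬ Qev l e)).card : ℝ) * l * (n:ℝ) ^ 2 ≤
      (M:ℝ) ^ 2 * r ^ 4 * Fintype.card (Fin M → RR n r) := by
  have hn0 : 0 < n := by omega
  have hc : 0 < n.choose r := Nat.choose_pos hrn
  have hexc : ∀ e : Fin M → RR n r, ((excI (fun i => (e i).1) Finset.univ).card : ℝ) ≤
      ∑ i : Fin M, ∑ j : Fin M, if j ≠ i ∧ 2 ≤ ((e i).1 ∩ (e j).1).card then (1:ℝ) else 0 := by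
    intro e
    rw [Finset.card_eq_sum_ones, Nat.cast_sum]
    calc _ ≤ ∑ i ∈ excI (fun i => (e i).1) Finset.univ, ∑ j : Fin M, (if j ≠ i ∧ 2 ≤ ((e i).1 ∩ (e j).1).card then (1:ℝ) else 0) := by
          refine Finset.sum_le_sum fun i hi => ?_
          rw [mem_excI] at hi
          obtain ⟨-, j, -, hj⟩ := hi
          refine le_trans ?_ (Finset.single_le_sum (fun j _ => by split_ifs <;> norm_num) (Finset.mem_univ j))
          rw [if_pos hj]; simp
      _ ≤ _ := Finset.sum_le_sum_of_subset_of_nonneg (Finset.subset_univ _) fun i _ _ =>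
          Finset.sum_nonneg fun j _ => by split_ifs <;> norm_num
  have hpair : ∀ i j : Fin M, (∑ e : Fin M → RR n r, if j ≠ i ∧ 2 ≤ ((e i).1 ∩ (e j).1).card then (1:ℝ) else 0) * (n:ℝ) ^ 2 ≤
      r ^ 4 * Fintype.card (Fin M → RR n r) := by
    intro i j
    by_cases hij : j = i
    · subst hij; simp; positivity
    have h1 := sum_update j (fun e : Fin M → RR n r => if j ≠ i ∧ 2 ≤ ((e i).1 ∩ (e j).1).card then (1:ℝ) else 0)
    rw [RR_card] at h1
    have h2 : ∀ e : Fin M → RR n r, (∑ x : RR n r, if j ≠ i ∧ 2 ≤ ((update e j x i).1 ∩ (update e j x j).1).card then (1:ℝ) else 0) * (n:ℝ) ^ 2 ≤ (r:ℝ) ^ 4 * n.choose r := by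
      intro e
      refine le_trans (le_of_eq ?_) (two_common hr hrn (e i))
      congr 1
      refine Finset.sum_congr rfl fun x _ => ?_
      rw [update_self, update_of_ne (Ne.symm hij)]
      simp [hij]
    have h3 : (n.choose r : ℝ) * ((∑ e : Fin M → RR n r, if j ≠ i ∧ 2 ≤ ((e i).1 ∩ (e j).1).card then (1:ℝ) else 0) * (n:ℝ) ^ 2) ≤
        n.choose r * (r ^ 4 * Fintype.card (Fin M → RR n r)) := by
      rw [← mul_assoc, ← h1, Finset.sum_mul]
      refine (Finset.sum_le_sum fun e _ => h2 e).trans (le_of_eq ?_)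
      rw [Finset.sum_const, nsmul_eq_mul, Finset.card_univ]; ring
    exact le_of_mul_le_mul_left h3 (by exact_mod_cast hc)
  calc _ = (∑ e ∈ Finset.univ.filter (fun e : Fin M → RR n r => ¬ Qev l e), (l:ℝ)) * (n:ℝ) ^ 2 := by
        rw [Finset.sum_const, nsmul_eq_mul]
    _ ≤ (∑ e : Fin M → RR n r, ∑ i : Fin M, ∑ j : Fin M, if j ≠ i ∧ 2 ≤ ((e i).1 ∩ (e j).1).card then (1:ℝ) else 0) * (n:ℝ) ^ 2 := by
        refine mul_le_mul_of_nonneg_right ?_ (by positivity)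
        calc _ ≤ ∑ e ∈ Finset.univ.filter (fun e : Fin M → RR n r => ¬ Qev l e), ∑ i : Fin M, ∑ j : Fin M, (if j ≠ i ∧ 2 ≤ ((e i).1 ∩ (e j).1).card then (1:ℝ) else 0) := by
              refine Finset.sum_le_sum fun e he => ?_
              have he := (Finset.mem_filter.1 he).2
              unfold Qev at he
              exact (not_le.1 he).le.trans (hexc e)
          _ ≤ _ := Finset.sum_le_sum_of_subset_of_nonneg (Finset.subset_univ _) fun e _ _ =>
              Finset.sum_nonneg fun i _ => Finset.sum_nonneg fun j _ => by split_ifs <;> norm_num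
    _ = ∑ i : Fin M, ∑ j : Fin M, (∑ e : Fin M → RR n r, if j ≠ i ∧ 2 ≤ ((e i).1 ∩ (e j).1).card then (1:ℝ) else 0) * (n:ℝ) ^ 2 := by
        rw [Finset.sum_comm, Finset.sum_mul]
        refine Finset.sum_congr rfl fun i _ => ?_
        rw [Finset.sum_comm, Finset.sum_mul]
    _ ≤ ∑ i : Fin M, ∑ j : Fin M, (r:ℝ) ^ 4 * Fintype.card (Fin M → RR n r) :=
        Finset.sum_le_sum fun i _ => Finset.sum_le_sum fun j _ => hpair i j
    _ = _ := by simp; ring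

end QSec

section Compare
variable {α : Type*} [DecidableEq α]

lemma Ew_map {β' : Type*} [DecidableEq β'] (p : ℝ) (φ : α ↪ β') (U : Finset α) (h : Finset β' → ℝ) :
    Ew p (U.map φ) h = Ew p U (fun A => h (A.map φ)) := by
  induction U using Finset.induction_on generalizing h with
  | empty => simp [Ew_empty]
  | insert x U hx ih =>
    rw [Finset.map_insert, Ew_insert p (by simpa using hx), Ew_insert p hx, ih]
    refine Ew_congr p fun A _ => ?_
    rw [Finset.map_insert]

lemma Ew_sq (p : ℝ) (U : Finset α) (c : ℝ) :
    Ew p U (fun B => ((B.card : ℝ) + c) ^ 2) = (U.card * p + c) ^ 2 + U.card * p * (1 - p) := by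
  induction U using Finset.induction_on generalizing c with
  | empty => simp [Ew_empty]
  | insert x U hx ih =>
    rw [Ew_insert p hx, Ew_congr p (g := fun B => (1 - p) * ((B.card : ℝ) + c) ^ 2 + p * ((B.card : ℝ) + (1 + c)) ^ 2)]
    · rw [Ew_add, Ew_mul, Ew_mul, ih, ih, Finset.card_insert_of_notMem hx]
      push_cast
      ring
    · intro B hB
      rw [Finset.card_insert_of_notMem (fun h => hx (hB h))]
      push_cast
      ring

open scoped Classical in
lemma Ew_tail {p : ℝ} (hp0 : 0 < p) (hp1 : p ≤ 1) (U : Finset α) (M : ℕ) (hM : 2 * (M:ℝ) ≤ U.card * p) (hU : 0 < U.card) :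
    Ew p U (fun B => if B.card < M then (1:ℝ) else 0) ≤ 4 / (U.card * p) := by
  have hUp : 0 < (U.card : ℝ) * p := mul_pos (by exact_mod_cast hU) hp0
  set m := (U.card : ℝ) * p with hm
  calc _ ≤ Ew p U (fun B => (4 / m ^ 2) * ((B.card : ℝ) + (-m)) ^ 2) := by
        refine Ew_mono hp0.le hp1 fun B _ => ?_
        split_ifs with h
        · have h1 : (B.card : ℝ) ≤ m / 2 := by
            have : (B.card : ℝ) ≤ M := by exact_mod_cast h.le
            linarith
          rw [div_mul_eq_mul_div, le_div_iff₀ (by positivity)]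
          nlinarith
        · positivity
    _ = (4 / m ^ 2) * (m * (1 - p)) := by
        rw [Ew_mul, Ew_sq]; congr 1; rw [← hm]; ring
    _ ≤ (4 / m ^ 2) * (m * 1) := by
        refine mul_le_mul_of_nonneg_left (mul_le_mul_of_nonneg_left (by linarith) hUp.le) (by positivity)
    _ = _ := by field_simp

lemma exists_perm_cover [Fintype α] {A B : Finset α} (h : B.card ≤ A.card) :
    ∃ π : Equiv.Perm α, B ⊆ A.map π.toEmbedding := by
  classical
  obtain ⟨A', hA', hc⟩ := Finset.exists_subset_card_eq h
  have e : {x // x ∈ A'} ≃ {x // x ∈ B} := Finset.equivOfCardEq hc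
  refine ⟨e.extendSubtype, ?_⟩
  intro b hb
  rw [Finset.mem_map]
  refine ⟨(e.symm ⟨b, hb⟩).1, hA' (e.symm ⟨b, hb⟩).2, ?_⟩
  have := e.extendSubtype_apply_of_mem (e.symm ⟨b, hb⟩).1 (e.symm ⟨b, hb⟩).2
  simpa using this

theorem compare [Fintype α] {p : ℝ} (hp0 : 0 < p) (hp1 : p ≤ 1) (M : ℕ)
    (hM : 2 * (M:ℝ) ≤ Fintype.card α * p) (hU : 0 < Fintype.card α) (g : Finset α → ℝ)
    (hg0 : ∀ A, 0 ≤ g A) (hg1 : ∀ A, g A ≤ 1) (hg : ∀ A B, A ⊆ B → g B ≤ g A) :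
    Ew p Finset.univ g ≤ 4 / (Fintype.card α * p) +
      (∑ e : Fin M → α, g (Finset.univ.image e)) / Fintype.card (Fin M → α) := by
  classical
  haveI : Nonempty α := Fintype.card_pos_iff.1 hU
  set N : ℝ := ((Fintype.card (Equiv.Perm α) : ℕ) : ℝ) with hN
  have hN0 : 0 < N := by rw [hN]; exact_mod_cast Fintype.card_pos
  set C : ℝ := ((Fintype.card (Fin M → α) : ℕ) : ℝ) with hC
  have hC0 : 0 < C := by rw [hC]; exact_mod_cast Fintype.card_pos
  set gh : Finset α → ℝ := fun A => (∑ σ : Equiv.Perm α, g (A.map σ.toEmbedding)) / N with hgh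
  have h1 : Ew p Finset.univ gh = Ew p Finset.univ g := by
    have : ∀ σ : Equiv.Perm α, Ew p Finset.univ (fun A => g (A.map σ.toEmbedding)) = Ew p Finset.univ g := by
      intro σ
      rw [← Ew_map, Finset.map_univ_equiv]
    have h2 : Ew p Finset.univ gh = (∑ σ : Equiv.Perm α, Ew p Finset.univ (fun A => g (A.map σ.toEmbedding))) / N := by
      unfold Ew
      rw [Finset.sum_comm, Finset.sum_div]
      refine Finset.sum_congr rfl fun A _ => ?_
      rw [hgh, ← Finset.mul_sum, mul_div_assoc]
    rw [h2, Finset.sum_congr rfl fun σ _ => this σ, Finset.sum_const, nsmul_eq_mul, Finset.card_univ, ← hN]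
    field_simp
  have h2 : ∑ e : Fin M → α, gh (Finset.univ.image e) = ∑ e : Fin M → α, g (Finset.univ.image e) := by
    simp only [hgh]
    rw [← Finset.sum_div, Finset.sum_comm]
    have : ∀ σ : Equiv.Perm α, ∑ e : Fin M → α, g ((Finset.univ.image e).map σ.toEmbedding) = ∑ e : Fin M → α, g (Finset.univ.image e) := by
      intro σ
      refine Fintype.sum_equiv (Equiv.arrowCongr (Equiv.refl (Fin M)) σ) _ _ fun e => ?_
      congr 1
      rw [Finset.map_eq_image, Finset.image_image]
      rfl
    rw [Finset.sum_congr rfl fun σ _ => this σ, Finset.sum_const, nsmul_eq_mul, Finset.card_univ, ← hN]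
    field_simp
  have h3 : ∀ A B : Finset α, B.card ≤ A.card → gh A ≤ gh B := by
    intro A B hAB
    obtain ⟨π, hπ⟩ := exists_perm_cover hAB
    simp only [hgh]
    refine div_le_div_of_nonneg_right ?_ hN0.le
    calc ∑ σ : Equiv.Perm α, g (A.map σ.toEmbedding) = ∑ σ : Equiv.Perm α, g ((A.map π.toEmbedding).map σ.toEmbedding) := by
          symm
          refine Fintype.sum_equiv (Equiv.mulRight π) _ _ fun σ => ?_
          congr 1
          rw [Finset.map_map]
          rfl
      _ ≤ _ := Finset.sum_le_sum fun σ _ => hg _ _ (Finset.map_subset_map.2 hπ)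
  have h4 : ∀ A, gh A ≤ 1 := by
    intro A
    simp only [hgh]
    rw [div_le_one hN0]
    calc _ ≤ ∑ σ : Equiv.Perm α, (1:ℝ) := Finset.sum_le_sum fun σ _ => hg1 _
      _ = N := by simp [hN]
  have h0 : ∀ A, 0 ≤ gh A := fun A => div_nonneg (Finset.sum_nonneg fun σ _ => hg0 _) hN0.le
  rw [← h1, ← h2]
  set av := (∑ e : Fin M → α, gh (Finset.univ.image e)) / C with hav
  have hav0 : 0 ≤ av := div_nonneg (Finset.sum_nonneg fun e _ => h0 _) hC0.le
  calc _ ≤ Ew p Finset.univ (fun A : Finset α => (if A.card < M then (1:ℝ) else 0) + av) := by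
        refine Ew_mono hp0.le hp1 fun A _ => ?_
        split_ifs with h
        · linarith [h4 A]
        · rw [zero_add, hav, le_div_iff₀ hC0]
          calc gh A * C = ∑ e : Fin M → α, gh A := by rw [Finset.sum_const, nsmul_eq_mul, Finset.card_univ, mul_comm]
            _ ≤ _ := Finset.sum_le_sum fun e _ => h3 _ _ (by
                refine Finset.card_image_le.trans ?_
                rw [Finset.card_univ, Fintype.card_fin]; omega)
    _ = Ew p Finset.univ (fun A : Finset α => (if A.card < M then (1:ℝ) else 0)) + av := by rw [Ew_add, Ew_const]
    _ ≤ _ := by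
        have := Ew_tail hp0 hp1 (Finset.univ : Finset α) M (by rw [Finset.card_univ]; exact hM) (by rw [Finset.card_univ]; exact hU)
        rw [Finset.card_univ] at this
        linarith

end Compare

section Core

lemma failB_01 {n r : ℕ} {p : ℝ} (hp0 : 0 ≤ p) (hp1 : p ≤ 1) (A : Finset (Finset ℕ)) :
    0 ≤ failB n r p A ∧ failB n r p A ≤ 1 := by
  classical
  unfold failB
  constructor
  · calc (0:ℝ) = Ew p (Kn n r) (fun _ => 0) := (Ew_const _ _ _).symm
      _ ≤ _ := Ew_mono hp0 hp1 fun B _ => by split_ifs <;> norm_num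
  · calc _ ≤ Ew p (Kn n r) (fun _ => 1) := Ew_mono hp0 hp1 fun B _ => by split_ifs <;> norm_num
      _ = 1 := Ew_const _ _ _

lemma pmCount_mono {V : Finset ℕ} {H H' : Finset (Finset ℕ)} (h : H ⊆ H') : pmCount V H ≤ pmCount V H' := by
  unfold pmCount pmSet
  exact Finset.card_le_card (Finset.filter_subset_filter _ (Finset.powerset_mono.2 h))

lemma failB_anti {n r : ℕ} {p : ℝ} (hp0 : 0 ≤ p) (hp1 : p ≤ 1) {A A' : Finset (Finset ℕ)} (h : A ⊆ A') :
    failB n r p A' ≤ failB n r p A := by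
  classical
  unfold failB
  refine Ew_mono hp0 hp1 fun B _ => ?_
  have := pmCount_mono (V := Finset.range n) (Finset.union_subset_union_left (t := B) h)
  split_ifs with h1 h2
  · exact le_rfl
  · norm_num
  · omega
  · exact le_rfl

lemma Kn_eq_map (n r : ℕ) : Kn n r = (Finset.univ : Finset (RR n r)).map ⟨Subtype.val, Subtype.val_injective⟩ := by
  ext A
  simp only [Finset.mem_map, Finset.mem_univ, true_and, Function.Embedding.coeFn_mk]
  exact ⟨fun h => ⟨⟨A, h⟩, rfl⟩, fun ⟨a, ha⟩ => ha ▸ a.2⟩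

open scoped Classical in
theorem core {n r M i0 d l : ℕ} (hr : 2 ≤ r) (hqn : r * (r - 1) ≤ n) (T τ β δ Kt p f : ℝ) (K : ℕ) (hT : 0 < T) (hτ : 0 < τ)
    (hτ1 : τ ≤ 1)
    (hδ : 0 < δ) (hδ1 : δ ≤ 1) (hβδ : 2 * β ≤ δ ^ r)
    (hKt : Kt ≤ (1 - δ) * (n - r * (r - 1)).choose (r - 1))
    (hKβ : ((r * K : ℕ):ℝ) * (r * (r - 1) : ℕ) ≤ β * n) (hdK : r * d ≤ K)
    (hp0 : 0 ≤ p) (hp1 : p ≤ 1) (hf : ∀ k : ℕ, Kt ≤ k → (1 - p) ^ k ≤ f) (hf0 : 0 ≤ f)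
    (ρ1 ρ2 ρ3 : ℝ)
    (h1 : ((Finset.univ.filter (fun e : Fin M → RR n r => ¬ ∃ Z ⊆ Finset.range n, (∃ k, k ≤ d ∧ Z.card = r * k) ∧
      T ≤ phi e (Sx M i0) (Finset.range n \ Z))).card : ℝ) ≤ ρ1 * Fintype.card (Fin M → RR n r))
    (h2 : ((Finset.univ.filter (fun e : Fin M → RR n r => ¬ Qev l e)).card : ℝ) ≤ ρ2 * Fintype.card (Fin M → RR n r))
    (h3 : ((Finset.univ.filter (fun e : Fin M → RR n r => Qev l e ∧ Doom T τ β K e i0 (Finset.range n))).card : ℝ) ≤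
      ρ3 * Fintype.card (Fin M → RR n r))
    (pa : ℝ) (hpa0 : 0 < pa) (hpa1 : pa ≤ 1) (hM : 2 * (M:ℝ) ≤ n.choose r * pa) :
    Ew (1 - (1 - pa) * (1 - p)) (Kn n r) (fun H => if 0 < pmCount (Finset.range n) H then (0:ℝ) else 1) ≤
      4 / (n.choose r * pa) + (n * f + ρ1 + ρ2 + ρ3) := by
  have hrn : r ≤ n := le_trans (Nat.le_mul_of_pos_right r (by omega)) hqn
  have hc : 0 < n.choose r := Nat.choose_pos hrn
  have : Nonempty (RR n r) := by rw [← Fintype.card_pos_iff, RR_card]; exact hc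
  rw [← Ew_couple]
  change Ew pa (Kn n r) (failB n r p) ≤ _
  have hcmp := compare hpa0 hpa1 M (α := RR n r) (by rw [RR_card]; exact hM) (by rw [RR_card]; exact hc)
    (fun A => failB n r p (A.map ⟨Subtype.val, Subtype.val_injective⟩))
    (fun A => (failB_01 hp0 hp1 _).1) (fun A => (failB_01 hp0 hp1 _).2)
    (fun A B h => failB_anti hp0 hp1 (Finset.map_subset_map.2 h))
  rw [← Ew_map, ← Kn_eq_map, RR_card] at hcmp
  refine hcmp.trans (add_le_add le_rfl ?_)
  set C : ℝ := ((Fintype.card (Fin M → RR n r) : ℕ) : ℝ) with hC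
  have hC0 : 0 < C := by rw [hC]; exact_mod_cast Fintype.card_pos
  rw [div_le_iff₀ hC0]
  have hpt : ∀ e : Fin M → RR n r, failB n r p ((Finset.univ.image e).map ⟨Subtype.val, Subtype.val_injective⟩) ≤
      n * f + (if ¬ ∃ Z ⊆ Finset.range n, (∃ k, k ≤ d ∧ Z.card = r * k) ∧
        T ≤ phi e (Sx M i0) (Finset.range n \ Z) then (1:ℝ) else 0) + (if ¬ Qev l e then (1:ℝ) else 0) +
        (if Qev l e ∧ Doom T τ β K e i0 (Finset.range n) then (1:ℝ) else 0) := by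
    intro e
    have hnf : 0 ≤ n * f := by positivity
    have hle := (failB_01 hp0 hp1 (n := n) (r := r) ((Finset.univ.image e).map ⟨Subtype.val, Subtype.val_injective⟩)).2
    have a1 : (0:ℝ) ≤ (if ¬ ∃ Z ⊆ Finset.range n, (∃ k, k ≤ d ∧ Z.card = r * k) ∧
        T ≤ phi e (Sx M i0) (Finset.range n \ Z) then (1:ℝ) else 0) := by split_ifs <;> norm_num
    have a2 : (0:ℝ) ≤ (if ¬ Qev l e then (1:ℝ) else 0) := by split_ifs <;> norm_num
    have a3 : (0:ℝ) ≤ (if Qev l e ∧ Doom T τ β K e i0 (Finset.range n) then (1:ℝ) else 0) := by split_ifs <;> norm_num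
    by_cases b1 : ¬ ∃ Z ⊆ Finset.range n, (∃ k, k ≤ d ∧ Z.card = r * k) ∧
        T ≤ phi e (Sx M i0) (Finset.range n \ Z)
    · rw [if_pos b1]; linarith
    by_cases b2 : ¬ Qev l e
    · rw [if_pos b2]; linarith
    by_cases b3 : Qev l e ∧ Doom T τ β K e i0 (Finset.range n)
    · rw [if_pos b3]; linarith
    have hD : ¬ Doom T τ β K e i0 (Finset.range n) := fun h => b3 ⟨not_not.1 b2, h⟩
    have := per_e hr hqn T τ β δ Kt p f K hT hτ hτ1 hδ hδ1 hβδ hKt hKβ hdK hp0 hp1 hf hf0 e hD (not_not.1 b1)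
    have heq : (Finset.univ.image e).map ⟨Subtype.val, Subtype.val_injective⟩ = Finset.univ.image (fun i => (e i).1) := by
      rw [Finset.map_eq_image, Finset.image_image]; rfl
    rw [heq]
    linarith
  refine (Finset.sum_le_sum fun e _ => hpt e).trans ?_
  rw [Finset.sum_add_distrib, Finset.sum_add_distrib, Finset.sum_add_distrib, Finset.sum_boole, Finset.sum_boole, Finset.sum_boole,
    Finset.sum_const, nsmul_eq_mul, Finset.card_univ, ← hC]
  have e0 : (n * f + ρ1 + ρ2 + ρ3) * C = C * (n * f) + ρ1 * C + ρ2 * C + ρ3 * C := by ring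
  rw [e0]
  exact add_le_add (add_le_add (add_le_add le_rfl h1) h2) h3

end Core

section Numeric

lemma pow_bern {x y : ℝ} (hx : 0 < x) (hy0 : 0 ≤ y) (hy : y ≤ x) (s : ℕ) : x ^ s * (1 - s * y / x) ≤ (x - y) ^ s := by
  have h1 := one_add_mul_le_pow (a := -(y / x)) (by
    have : y / x ≤ 1 := (div_le_one hx).2 hy
    linarith) s
  have h2 : (x - y) ^ s = x ^ s * (1 + -(y / x)) ^ s := by
    rw [← mul_pow]; congr 1; field_simp; ring
  rw [h2]
  refine mul_le_mul_of_nonneg_left (le_trans (le_of_eq ?_) h1) (by positivity)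
  ring

lemma choose_lower {n q s : ℕ} (hqs : q + s ≤ n) (hn : 0 < n) :
    (n:ℝ) ^ s * (1 - s * (q + s) / n) ≤ (n - q).choose s * s.factorial := by
  have h1 := Nat.pow_sub_le_descFactorial (n - q) s
  rw [Nat.descFactorial_eq_factorial_mul_choose] at h1
  have h2 := pow_bern (x := (n:ℝ)) (y := ((q + s : ℕ):ℝ)) (by exact_mod_cast hn) (by positivity) (by exact_mod_cast hqs) s
  have h3 : ((n:ℝ) - (q + s : ℕ)) ^ s ≤ ((n - q + 1 - s : ℕ) : ℝ) ^ s := by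
    refine pow_le_pow_left₀ ?_ ?_ s
    · have : ((q + s : ℕ):ℝ) ≤ n := by exact_mod_cast hqs
      linarith
    · have : n ≤ (n - q + 1 - s) + (q + s) := by omega
      have h : (n:ℝ) ≤ ((n - q + 1 - s : ℕ):ℝ) + (q + s : ℕ) := by exact_mod_cast this
      linarith
  have h4 : ((n - q + 1 - s : ℕ) : ℝ) ^ s ≤ (n - q).choose s * s.factorial := by
    rw [mul_comm]; exact_mod_cast h1
  push_cast at h2 h3
  exact h2.trans (h3.trans h4)

lemma choose_half {n q : ℕ} (hn : 0 < n) (hqn : q ≤ n) (h : 2 * q * q ≤ n) :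
    (n:ℝ) ^ q ≤ 2 * ((n.choose q : ℝ) * q.factorial) := by
  have h1 := choose_lower (n := n) (q := 0) (s := q) (by omega) hn
  have hn0 : (0:ℝ) < n := by exact_mod_cast hn
  have h2 : (q:ℝ) * (q : ℝ) / n ≤ 1 / 2 := by
    rw [div_le_iff₀ hn0]
    have : (2 * q * q : ℝ) ≤ n := by exact_mod_cast h
    linarith
  have h3 : (n:ℝ) ^ q * (1 / 2) ≤ (n:ℝ) ^ q * (1 - q * ((0:ℕ) + q) / n) := by
    refine mul_le_mul_of_nonneg_left ?_ (by positivity)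
    push_cast; rw [zero_add]; linarith
  have h4 := h3.trans h1
  rw [Nat.sub_zero] at h4
  linarith

lemma choose_comp {n q s : ℕ} (hqs : q + s ≤ n) (hn : 0 < n) (δ : ℝ) (h : (s:ℝ) * (q + s) ≤ δ * n) :
    (1 - δ) * (n - 1).choose s ≤ (n - q).choose s := by
  have hn0 : (0:ℝ) < n := by exact_mod_cast hn
  have h1 := choose_lower hqs hn
  have h2 : (s:ℝ) * (q + s) / n ≤ δ := by rw [div_le_iff₀ hn0]; exact h
  have hf : (0:ℝ) < s.factorial := by exact_mod_cast s.factorial_pos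
  by_cases hδ : δ ≤ 1
  · have h3 : ((n - 1).choose s : ℝ) * s.factorial ≤ (n:ℝ) ^ s := by
      have := Nat.descFactorial_le_pow (n - 1) s
      rw [Nat.descFactorial_eq_factorial_mul_choose] at this
      have h4 : (n - 1) ^ s ≤ n ^ s := Nat.pow_le_pow_left (by omega) s
      rw [mul_comm]
      exact_mod_cast this.trans h4
    refine le_of_mul_le_mul_right ?_ hf
    calc (1 - δ) * (n - 1).choose s * s.factorial = (1 - δ) * ((n - 1).choose s * s.factorial) := by ring
      _ ≤ (1 - δ) * (n:ℝ) ^ s := mul_le_mul_of_nonneg_left h3 (by linarith)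
      _ = (n:ℝ) ^ s * (1 - δ) := by ring
      _ ≤ (n:ℝ) ^ s * (1 - s * (q + s) / n) := mul_le_mul_of_nonneg_left (by linarith) (by positivity)
      _ ≤ _ := h1
  · have : (0:ℝ) ≤ (n - 1).choose s := by positivity
    have : (0:ℝ) ≤ (n - q).choose s := by positivity
    nlinarith

lemma choose_eq_mul {r l : ℕ} (hr : 0 < r) (hl : 0 < l) : ((r * l).choose r : ℝ) = l * (r * l - 1).choose (r - 1) := by
  obtain ⟨r', rfl⟩ : ∃ r', r = r' + 1 := ⟨r - 1, by omega⟩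
  have hpos : 0 < (r' + 1) * l := Nat.mul_pos hr hl
  obtain ⟨m, hm⟩ : ∃ m, (r' + 1) * l = m + 1 := ⟨(r' + 1) * l - 1, by omega⟩
  have h := Nat.add_one_mul_choose_eq m r'
  rw [← hm] at h
  have e1 : (r' + 1) * l - 1 = m := by omega
  rw [e1, Nat.add_sub_cancel]
  have h2 : (r' + 1) * ((r' + 1) * l).choose (r' + 1) = (r' + 1) * (l * m.choose r') := by
    rw [mul_comm (r' + 1) (((r' + 1) * l).choose (r' + 1)), ← h]; ring
  have h3 := Nat.eq_of_mul_eq_mul_left hr h2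
  exact_mod_cast h3

/-- the exponential rate of the doom bound -/
lemma doom_rate {β1 η : ℝ} (hβ1 : 0 ≤ β1) (hβ2 : β1 ≤ 1) (hη : η = β1 / 4) (g : ℕ) :
    Real.sqrt (((1 - β1 / 2) * (1 + η)) ^ g) ≤ Real.exp (-(β1 * g / 8)) := by
  have h1 : (1 - β1 / 2) * (1 + η) ≤ Real.exp (-(β1 / 4)) := by
    have a1 : 1 - β1 / 2 ≤ Real.exp (-(β1 / 2)) := by linarith [Real.add_one_le_exp (-(β1 / 2))]
    have a2 : 1 + η ≤ Real.exp η := by linarith [Real.add_one_le_exp η]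
    calc _ ≤ Real.exp (-(β1 / 2)) * Real.exp η := mul_le_mul a1 a2 (by rw [hη]; linarith) (Real.exp_pos _).le
      _ = _ := by rw [← Real.exp_add, hη]; congr 1; ring
  have h0 : 0 ≤ (1 - β1 / 2) * (1 + η) := mul_nonneg (by linarith) (by rw [hη]; linarith)
  rw [Real.sqrt_le_left (Real.exp_pos _).le]
  calc _ ≤ (Real.exp (-(β1 / 4))) ^ g := pow_le_pow_left₀ h0 h1 g
    _ = _ := by
      rw [← Real.exp_nat_mul, ← Real.exp_nat_mul]; congr 1; push_cast; ring

end Numeric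

section Assemble

theorem assemble {n r l M g t0 d : ℕ} (hr : 3 ≤ r) (hn : n = r * l) (hl : 0 < l)
    (δ β β1 η γ c θ a Kt pb pa f ρ3 : ℝ) (hδ : 0 < δ) (hδ1 : δ ≤ 1) (hβ : 0 < β) (hβ1 : β ≤ 1) (hβδ : 2 * β ≤ δ ^ r)
    (hβ1e : β1 = β / (2 * (r - 1 : ℕ))) (hβ11 : β1 ≤ 1) (hη : η = β1 / 4) (hγ : 0 < γ) (hγ1 : γ ≤ 1 / 4)
    (hc : 0 < c) (hc1 : c ≤ 1) (hθ : 0 < θ)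
    (hq : 2 * (r * (r - 1)) * (r * (r - 1)) ≤ n) (hK2 : 2 * (r * d + r) ≤ l) (hlM : l ≤ M) (hgM : g ≤ M)
    (hgl : (g:ℝ) + l ≤ 2 * γ * M) (hθ2 : 6 * (l:ℝ) ≤ M * θ ^ (2 * (r - 1)))
    (hnum : 4 * γ * l + c * l + 4 * (r - 1) * θ * l + r * (1 + Real.log l) + (d + 1)
      + (r * d + r) * (r + Real.log (1 / c)) < η / 2 * (l - (r * d + r)))
    (hKβ : ((r:ℝ) * (r * d)) * (r * (r - 1) : ℕ) ≤ β * n)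
    (ht0 : 2 * t0 ≤ l) (ht : (Real.exp (r + 1) - 1) * l ^ 2 / ((M - g : ℕ):ℝ) ≤ t0) (ha : 0 < a)
    (hK : 4 * (Real.exp (2 * (r * t0 : ℝ) ^ 2 / n) + 1) ≤ Real.exp a)
    (hd : 2 * Real.sqrt (2 * M * a) ≤ d)
    (h3 : ((n:ℝ) * (M + 1)) ^ (r * (r * d)) * Real.exp (-(β1 * g / 8)) ≤ ρ3)
    (hKt : Kt ≤ (1 - δ) * (n - r * (r - 1)).choose (r - 1))
    (hp0 : 0 ≤ pb) (hp1 : pb ≤ 1) (hf : Real.exp (-(pb * Kt)) ≤ f)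
    (hpa0 : 0 < pa) (hpa1 : pa ≤ 1) (hM : 2 * (M:ℝ) ≤ n.choose r * pa) :
    Ew (1 - (1 - pa) * (1 - pb)) (Kn n r) (fun H => if 0 < pmCount (Finset.range n) H then (0:ℝ) else 1) ≤
      4 / (n.choose r * pa) + (n * f + Real.exp (-a) + (M:ℝ) ^ 2 * r ^ 4 / (l * (n:ℝ) ^ 2) + ρ3) := by
  have hl0 : (0:ℝ) < l := by exact_mod_cast hl
  have hlM' : (l:ℝ) ≤ M := by exact_mod_cast hlM
  have hM0 : (0:ℝ) < M := by linarith
  have hrn : r ≤ n := by rw [hn]; exact Nat.le_mul_of_pos_right r hl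
  have hn0 : 0 < n := by omega
  have hn0' : (0:ℝ) < n := by exact_mod_cast hn0
  have hcn : 0 < n.choose r := Nat.choose_pos hrn
  have hqpos : 0 < r * (r - 1) := Nat.mul_pos (by omega) (by omega)
  have hqn : r * (r - 1) ≤ n := by
    refine le_trans ?_ hq
    rw [mul_comm 2, mul_assoc]
    exact Nat.le_mul_of_pos_right _ (by positivity)
  have hp := piK_pos (k := l) (by omega : 0 < r) hcn
  have hi0c : ((M - g : ℕ):ℝ) = M - g := by rw [Nat.cast_sub hgM]
  have hi0 : (1 - 2 * γ) * M ≤ ((M - g : ℕ):ℝ) - l := by rw [hi0c]; linarith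
  have hil : l ≤ M - g := by
    have : (0:ℝ) ≤ ((M - g : ℕ):ℝ) - l := le_trans (by
      refine mul_nonneg (by linarith) hM0.le) hi0
    have : (l:ℝ) ≤ ((M - g : ℕ):ℝ) := by linarith
    exact_mod_cast this
  have hch : (0:ℝ) < (M - g).choose l := by exact_mod_cast Nat.choose_pos hil
  have hr1 : (1:ℝ) ≤ ((r - 1 : ℕ):ℝ) := by exact_mod_cast (by omega : 1 ≤ r - 1)
  have hβ10 : 0 < β1 := by rw [hβ1e]; positivity
  have hη0 : 0 < η := by rw [hη]; positivity
  set T : ℝ := (M - g).choose l * piK n r l / 2 / 2 ^ d with hT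
  set τ : ℝ := c * l / M with hτ
  have hT0 : 0 < T := by rw [hT]; positivity
  have hτ0 : 0 < τ := by rw [hτ]; positivity
  have hτ1 : τ ≤ 1 := by
    rw [hτ, div_le_one hM0]
    calc c * l ≤ 1 * l := mul_le_mul_of_nonneg_right hc1 hl0.le
      _ ≤ M := by linarith
  have hfew : FewHyp n r M T τ η (r * d + r) l := by
    intro e he S W
    have := few_bad (K := r * d + r) (by omega : 2 ≤ r) hn hl hK2 η γ c θ T τ hη0 (by rw [hη]; linarith) hγ hγ1 hc hc1 hθ hlM hτ
      hi0 hT hθ2 (by push_cast; exact hnum) e he S W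
    convert this
  have hdoom := doom_bound (l := l) (by omega : 2 ≤ r) hqn (Nat.sub_le M g) T τ β η (r * d) (r * d + r) le_rfl hτ0 hβ.le hβ1
    hη0.le (choose_half hn0 hqn hq) hfew
  have hnear := near_most (M := M) (d := d) (by omega : 0 < r) hn hl (Sx M (M - g)) (Sx_card (Nat.sub_le M g)) hil
    (by omega) ht0 ht a ha hK hd
  have hQ := Q_bound (M := M) (l := l) (by omega : 2 ≤ r) hrn
  refine core (l := l) (i0 := M - g) (d := d) (by omega : 2 ≤ r) hqn T τ β δ Kt pb f (r * d) hT0 hτ0 hτ1 hδ hδ1 hβδ hKt ?_ le_rfl hp0 hp1 ?_ ?_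
    (Real.exp (-a)) ((M:ℝ) ^ 2 * r ^ 4 / (l * (n:ℝ) ^ 2)) ρ3 ?_ ?_ ?_ pa hpa0 hpa1 hM
  · push_cast at hKβ ⊢; exact hKβ
  · intro k hk
    refine le_trans ?_ hf
    calc (1 - pb) ^ k ≤ (Real.exp (-pb)) ^ k := pow_le_pow_left₀ (by linarith) (Real.one_sub_le_exp_neg pb) k
      _ = Real.exp (-(pb * k)) := by rw [← Real.exp_nat_mul]; congr 1; ring
      _ ≤ _ := by
        rw [Real.exp_le_exp]
        have := mul_le_mul_of_nonneg_left hk hp0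
        linarith
  · exact (Real.exp_pos _).le.trans hf
  · convert hnear
  · rw [div_mul_eq_mul_div, le_div_iff₀ (by positivity)]
    rw [← mul_assoc]
    convert hQ
  · have hrate := doom_rate hβ10.le hβ11 hη g
    have hMg : M - (M - g) = g := by omega
    rw [hMg, ← hβ1e] at hdoom
    refine le_trans (le_trans (le_of_eq ?_) hdoom) ?_
    · congr!
    rw [← mul_assoc]
    refine mul_le_mul_of_nonneg_right (le_trans ?_ h3) (by positivity)
    exact mul_le_mul_of_nonneg_left hrate (by positivity)

end Assemble

section Num

lemma num_M {ε u l : ℝ} (hε : 0 < ε) (hε1 : ε ≤ 1) (hu : 1 ≤ u) (hu1 : 8 / ε ≤ u) (hl : 1 ≤ l) :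
    ε / 8 * u ^ 4 * l ≤ (⌊ε / 4 * u ^ 4 * l⌋₊ : ℝ) ∧ (⌊ε / 4 * u ^ 4 * l⌋₊ : ℝ) ≤ ε / 4 * u ^ 4 * l ∧
      ε / 4 * u ^ 4 * l ≤ u ^ 4 * l := by
  have h4 : u ≤ u ^ 4 := le_self_pow₀ hu (by norm_num)
  have h1 : 8 ≤ ε * u := by rw [div_le_iff₀ hε] at hu1; linarith
  have h2 : 8 ≤ ε * u ^ 4 * l := by
    calc (8:ℝ) ≤ ε * u := h1
      _ ≤ ε * u ^ 4 := mul_le_mul_of_nonneg_left h4 hε.le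
      _ ≤ ε * u ^ 4 * l := le_mul_of_one_le_right (by positivity) hl
  have h3 := Nat.lt_floor_add_one (ε / 4 * u ^ 4 * l)
  refine ⟨by linarith, Nat.floor_le (by positivity), ?_⟩
  have : 0 ≤ u ^ 4 * l := by positivity
  have : ε * (u ^ 4 * l) ≤ 1 * (u ^ 4 * l) := mul_le_mul_of_nonneg_right hε1 this
  linarith

lemma num_g {γ m u l M : ℝ} (hγ : 0 < γ) (hm : 0 < m) (hu : 1 ≤ u) (hu1 : 2 / (γ * m) ≤ u) (hl : 1 ≤ l)
    (hM : m * u ^ 4 * l ≤ M) :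
    γ * m / 2 * u ^ 4 * l ≤ (⌊γ * M⌋₊ : ℝ) ∧ (⌊γ * M⌋₊ : ℝ) ≤ γ * M ∧ l ≤ γ * M := by
  have h4 : u ≤ u ^ 4 := le_self_pow₀ hu (by norm_num)
  have h1 : 2 ≤ u * (γ * m) := by rwa [div_le_iff₀ (by positivity)] at hu1
  have h2 : 2 * l ≤ γ * m * u ^ 4 * l := by
    refine mul_le_mul_of_nonneg_right ?_ (by linarith)
    calc (2:ℝ) ≤ γ * m * u := by linarith
      _ ≤ _ := mul_le_mul_of_nonneg_left h4 (by positivity)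
  have h5 : γ * m * u ^ 4 * l ≤ γ * M := by
    have := mul_le_mul_of_nonneg_left hM hγ.le
    linarith
  have hM0 : 0 ≤ M := le_trans (by positivity) hM
  have h3 := Nat.lt_floor_add_one (γ * M)
  exact ⟨by linarith, Nat.floor_le (by positivity), by linarith⟩

lemma num_t {E m u l i : ℝ} (hE : 0 < E) (hm : 0 < m) (hu : 1 ≤ u) (hlu : u ^ 10 ≤ l)
    (hi : m / 2 * u ^ 4 * l ≤ i) :
    (⌈E * l ^ 2 / i⌉₊ : ℝ) ≤ (2 * E / m + 1) * (l / u ^ 4) := by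
  have hu0 : 0 < u := by linarith
  have hl0 : 0 < l := lt_of_lt_of_le (by positivity) hlu
  have hi0 : 0 < i := lt_of_lt_of_le (by positivity) hi
  have h1 := Nat.ceil_lt_add_one (a := E * l ^ 2 / i) (by positivity)
  have h2 : E * l ^ 2 / i ≤ 2 * E / m * (l / u ^ 4) := by
    calc E * l ^ 2 / i ≤ E * l ^ 2 / (m / 2 * u ^ 4 * l) := div_le_div_of_nonneg_left (by positivity) (by positivity) hi
      _ = _ := by field_simp
  have h3 : 1 ≤ l / u ^ 4 := by
    rw [one_le_div (by positivity)]
    exact (pow_le_pow_right₀ hu (by norm_num)).trans hlu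
  linarith

lemma num_x {r B u l t : ℝ} (hr : 1 ≤ r) (hB : 1 ≤ B) (hu : 2 ≤ u) (hu1 : 4 * r * B ^ 2 ≤ u) (hlu : u ^ 10 ≤ l)
    (ht0 : 0 ≤ t) (ht : t ≤ B * (l / u ^ 4)) :
    4 * (Real.exp (2 * (r * t) ^ 2 / (r * l)) + 1) ≤ Real.exp (l / u ^ 6) := by
  have hu0 : 0 < u := by linarith
  have hl0 : 0 < l := lt_of_lt_of_le (by positivity) hlu
  have hr0 : 0 < r := by linarith
  set x := 2 * (r * t) ^ 2 / (r * l) with hx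
  have hx0 : 0 ≤ x := by positivity
  have h1 : x ≤ 1 / 2 * (l / u ^ 6) := by
    have a1 : t ^ 2 ≤ (B * (l / u ^ 4)) ^ 2 := pow_le_pow_left₀ ht0 ht 2
    have a2 : x = 2 * r / l * t ^ 2 := by rw [hx]; field_simp
    rw [a2]
    calc 2 * r / l * t ^ 2 ≤ 2 * r / l * (B * (l / u ^ 4)) ^ 2 := mul_le_mul_of_nonneg_left a1 (by positivity)
      _ = (4 * r * B ^ 2) * (l / u ^ 8 / 2) := by field_simp; ring
      _ ≤ u ^ 2 * (l / u ^ 8 / 2) := mul_le_mul_of_nonneg_right (hu1.trans (le_self_pow₀ (by linarith) (by norm_num))) (by positivity)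
      _ = _ := by field_simp
  have h2 : 16 ≤ l / u ^ 6 := by
    rw [le_div_iff₀ (by positivity)]
    refine le_trans ?_ hlu
    calc 16 * u ^ 6 = 2 ^ 4 * u ^ 6 := by norm_num
      _ ≤ u ^ 4 * u ^ 6 := mul_le_mul_of_nonneg_right (pow_le_pow_left₀ (by norm_num) hu 4) (by positivity)
      _ = _ := by ring
  have h3 : 1 ≤ Real.exp x := Real.one_le_exp hx0
  have h4 : (8:ℝ) ≤ Real.exp 8 := by linarith [Real.add_one_le_exp (8:ℝ)]
  calc 4 * (Real.exp x + 1) ≤ 8 * Real.exp x := by linarith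
    _ ≤ Real.exp 8 * Real.exp x := mul_le_mul_of_nonneg_right h4 (Real.exp_pos _).le
    _ = Real.exp (8 + x) := by rw [Real.exp_add]
    _ ≤ _ := by rw [Real.exp_le_exp]; linarith

lemma num_d {u l M : ℝ} (hu : 1 ≤ u) (hlu : u ^ 10 ≤ l) (hM0 : 0 ≤ M) (hM : M ≤ u ^ 4 * l) :
    (⌈2 * Real.sqrt (2 * M * (l / u ^ 6))⌉₊ : ℝ) ≤ 4 * (l / u) := by
  have hu0 : 0 < u := by linarith
  have hl0 : 0 < l := lt_of_lt_of_le (by positivity) hlu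
  have h1 : Real.sqrt (2 * M * (l / u ^ 6)) ≤ 3 / 2 * (l / u) := by
    rw [Real.sqrt_le_left (by positivity)]
    calc 2 * M * (l / u ^ 6) ≤ 2 * (u ^ 4 * l) * (l / u ^ 6) := mul_le_mul_of_nonneg_right (by linarith) (by positivity)
      _ = 2 * (l / u) ^ 2 := by field_simp
      _ ≤ (3 / 2 * (l / u)) ^ 2 := by
        have : 0 ≤ (l / u) ^ 2 := by positivity
        rw [mul_pow]; linarith
  have h3 : 1 ≤ l / u := by
    rw [one_le_div hu0]
    exact (le_self_pow₀ hu (by norm_num)).trans hlu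
  have h2 := Nat.ceil_lt_add_one (a := 2 * Real.sqrt (2 * M * (l / u ^ 6))) (by positivity)
  linarith

lemma num_num {r η γ c θ lc u l d : ℝ} (hr : 3 ≤ r) (hη : 0 < η) (hγ : γ = η / 32) (hc : c = η / 32) (hθ : θ = η / (64 * (r - 1)))
    (hlc : 0 ≤ lc) (hu : 1 ≤ u) (hu1 : 4 * (2 * r + 5 + 5 * r * (r + lc) + 5 * r * η / 2) / η ≤ u)
    (hlu : u ^ 10 ≤ l) (hlog : Real.log l ≤ u ^ 4) (hd : d ≤ 4 * (l / u)) :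
    4 * γ * l + c * l + 4 * (r - 1) * θ * l + r * (1 + Real.log l) + (d + 1)
      + (r * d + r) * (r + lc) < η / 2 * (l - (r * d + r)) := by
  have hu0 : 0 < u := by linarith
  have hl0 : 0 < l := lt_of_lt_of_le (by positivity) hlu
  set w := l / u with hw
  have hlw : l = w * u := by rw [hw]; field_simp
  have h3 : 1 ≤ w := by
    rw [hw, one_le_div hu0]
    exact (le_self_pow₀ hu (by norm_num)).trans hlu
  have h4 : u ^ 4 ≤ w := by
    rw [hw, le_div_iff₀ hu0, ← pow_succ]
    exact (pow_le_pow_right₀ hu (by norm_num)).trans hlu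
  have e1 : 4 * (r - 1) * θ * l = η / 16 * l := by
    rw [hθ]; have : r - 1 ≠ 0 := by intro h; linarith
    field_simp; ring
  rw [e1, hγ, hc]
  have e2 : r * (1 + Real.log l) ≤ r * (2 * w) := mul_le_mul_of_nonneg_left (by linarith) (by linarith)
  have e3 : r * d + r ≤ 5 * r * w := by
    have : r * d ≤ r * (4 * w) := mul_le_mul_of_nonneg_left hd (by linarith)
    have : r * 1 ≤ r * w := mul_le_mul_of_nonneg_left h3 (by linarith)
    linarith
  have e4 : (r * d + r) * (r + lc) ≤ 5 * r * w * (r + lc) := mul_le_mul_of_nonneg_right e3 (by linarith)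
  have e5 : η / 2 * (l - 5 * r * w) ≤ η / 2 * (l - (r * d + r)) := mul_le_mul_of_nonneg_left (by linarith) (by linarith)
  have e6 : 4 * (2 * r + 5 + 5 * r * (r + lc) + 5 * r * η / 2) * w ≤ η * l := by
    rw [div_le_iff₀ hη] at hu1
    calc _ ≤ (u * η) * w := mul_le_mul_of_nonneg_right hu1 (by linarith)
      _ = _ := by rw [hlw]; ring
  have e7 : 0 < η * l := by positivity
  have e8 : r * (2 * w) + 5 * w + 5 * r * w * (r + lc) + η / 2 * (5 * r * w) =
    (2 * r + 5 + 5 * r * (r + lc) + 5 * r * η / 2) * w := by ring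
  linarith

lemma num_3 {r l M d : ℕ} {G u g : ℝ} (hr : 2 ≤ r) (hG : 0 < G) (hu : 1 ≤ u) (hu1 : (12 * (r:ℝ) ^ 2 + 1) / G ≤ u)
    (hlu : u ^ 10 ≤ l) (hL : u ^ 4 = Real.log (r * l)) (hd : (d:ℝ) ≤ 4 * (l / u)) (hM : (M:ℝ) ≤ u ^ 4 * l)
    (hg : G * u ^ 4 * l ≤ g) :
    (((r * l : ℕ):ℝ) * (M + 1)) ^ (r * (r * d)) * Real.exp (-g) ≤ Real.exp (-u) := by
  have hu0 : 0 < u := by linarith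
  have hl0 : (0:ℝ) < l := lt_of_lt_of_le (by positivity) hlu
  have hl1 : (1:ℝ) ≤ l := (one_le_pow₀ hu).trans hlu
  have hr2 : (2:ℝ) ≤ r := by exact_mod_cast hr
  have hn : ((r * l : ℕ):ℝ) = Real.exp (u ^ 4) := by
    rw [hL, Real.exp_log (by positivity)]; push_cast; ring
  have h1 : (M:ℝ) + 1 ≤ Real.exp (u ^ 4) ^ 2 := by
    rw [← hn]; push_cast
    have a1 : u ^ 4 * l ≤ l * l := mul_le_mul_of_nonneg_right ((pow_le_pow_right₀ hu (by norm_num)).trans hlu) hl0.le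
    have a2 : (1:ℝ) ≤ l * l := by
      calc (1:ℝ) = 1 * 1 := by norm_num
        _ ≤ l * l := mul_le_mul hl1 hl1 (by norm_num) hl0.le
    have a3 : (2:ℝ) ^ 2 * (l * l) ≤ r ^ 2 * (l * l) := mul_le_mul_of_nonneg_right (pow_le_pow_left₀ (by norm_num) hr2 2) (by positivity)
    have : ((r:ℝ) * l) ^ 2 = r ^ 2 * (l * l) := by ring
    rw [this]; linarith
  have h2 : ((r * l : ℕ):ℝ) * (M + 1) ≤ Real.exp (3 * u ^ 4) := by
    rw [hn]
    calc _ ≤ Real.exp (u ^ 4) * Real.exp (u ^ 4) ^ 2 := mul_le_mul_of_nonneg_left h1 (Real.exp_pos _).le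
      _ = Real.exp (u ^ 4) ^ 3 := by ring
      _ = _ := by rw [← Real.exp_nat_mul]; norm_num
  calc _ ≤ Real.exp (3 * u ^ 4) ^ (r * (r * d)) * Real.exp (-g) :=
        mul_le_mul_of_nonneg_right (pow_le_pow_left₀ (by positivity) h2 _) (Real.exp_pos _).le
    _ = Real.exp ((r:ℝ) ^ 2 * d * (3 * u ^ 4) - g) := by
      rw [← Real.exp_nat_mul, ← Real.exp_add]; congr 1; push_cast; ring
    _ ≤ _ := by
      rw [Real.exp_le_exp]
      have b1 : (r:ℝ) ^ 2 * d * (3 * u ^ 4) ≤ 12 * (r:ℝ) ^ 2 * (u ^ 3 * l) := by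
        calc (r:ℝ) ^ 2 * d * (3 * u ^ 4) = d * (3 * (r:ℝ) ^ 2 * u ^ 4) := by ring
          _ ≤ 4 * (l / u) * (3 * (r:ℝ) ^ 2 * u ^ 4) := mul_le_mul_of_nonneg_right hd (by positivity)
          _ = _ := by field_simp; ring
      have b2 : (12 * (r:ℝ) ^ 2 + 1) * (u ^ 3 * l) ≤ G * u ^ 4 * l := by
        rw [div_le_iff₀ hG] at hu1
        calc _ ≤ u * G * (u ^ 3 * l) := mul_le_mul_of_nonneg_right hu1 (by positivity)
          _ = _ := by ring
      have b3 : u ≤ u ^ 3 * l := by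
        calc u ≤ u ^ 3 := le_self_pow₀ hu (by norm_num)
          _ ≤ _ := le_mul_of_one_le_right (by positivity) hl1
      linarith

lemma num_Q {r l M u : ℝ} (hr : 1 ≤ r) (hu : 1 ≤ u) (hu1 : r ^ 2 ≤ u) (hlu : u ^ 10 ≤ l) (hM0 : 0 ≤ M) (hM : M ≤ u ^ 4 * l) :
    M ^ 2 * r ^ 4 / (l * (r * l) ^ 2) ≤ 1 / u := by
  have hu0 : 0 < u := by linarith
  have hl0 : 0 < l := lt_of_lt_of_le (by positivity) hlu
  rw [div_le_div_iff₀ (by positivity) hu0]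
  calc M ^ 2 * r ^ 4 * u ≤ (u ^ 4 * l) ^ 2 * r ^ 4 * u := by
        have := pow_le_pow_left₀ hM0 hM 2
        gcongr
    _ = r ^ 2 * (u ^ 9 * l ^ 2 * r ^ 2) := by ring
    _ ≤ u * (u ^ 9 * l ^ 2 * r ^ 2) := mul_le_mul_of_nonneg_right hu1 (by positivity)
    _ = u ^ 10 * (l ^ 2 * r ^ 2) := by ring
    _ ≤ l * (l ^ 2 * r ^ 2) := mul_le_mul_of_nonneg_right hlu (by positivity)
    _ = _ := by ring

lemma exp_neg_le_inv {u : ℝ} (hu : 0 < u) : Real.exp (-u) ≤ 1 / u := by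
  rw [Real.exp_neg, inv_eq_one_div]
  exact one_div_le_one_div_of_le hu (by linarith [Real.add_one_le_exp u])

end Num

section MainNum

set_option maxHeartbeats 2000000 in
theorem main_num (r : ℕ) (hr : 3 ≤ r) (ε : ℝ) (hε : 0 < ε) (hε1 : ε ≤ 1) :
    ∀ᶠ u : ℝ in Filter.atTop, ∀ l : ℕ, u ^ 10 ≤ (l:ℝ) → u ^ 4 = Real.log (r * l) → ∀ pa pb : ℝ, 0 < pa → pa ≤ 1 →
      pb ≤ 1 → pb = (1 + ε / 2) * u ^ 4 / ((r * l - 1).choose (r - 1) : ℝ) →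
      ε / 2 * u ^ 4 * l ≤ ((r * l).choose r : ℝ) * pa →
      Ew (1 - (1 - pa) * (1 - pb)) (Kn (r * l) r) (fun H => if 0 < pmCount (Finset.range (r * l)) H then (0:ℝ) else 1) ≤
        5 / u := by
  have hr3 : (3:ℝ) ≤ r := by exact_mod_cast hr
  have hrc : ((r - 1 : ℕ):ℝ) = r - 1 := by rw [Nat.cast_sub (by omega)]; norm_num
  set q : ℕ := r * (r - 1) with hq
  set δ : ℝ := ε / 32 with hδ
  have hδ0 : 0 < δ := by positivity
  have hδ1 : δ ≤ 1 := by rw [hδ]; linarith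
  set β : ℝ := δ ^ r / 2 with hβ
  have hβ0 : 0 < β := by positivity
  have hβ1 : β ≤ 1 := by
    have := pow_le_one₀ (n := r) hδ0.le hδ1
    rw [hβ]; linarith
  set β1 : ℝ := β / (2 * (r - 1 : ℕ)) with hβ1e
  have hβ10 : 0 < β1 := by rw [hβ1e, hrc]; exact div_pos hβ0 (by linarith)
  have hβ11 : β1 ≤ 1 := by rw [hβ1e, hrc, div_le_one (by linarith)]; linarith
  set η : ℝ := β1 / 4 with hη
  have hη0 : 0 < η := by positivity
  have hη1 : η ≤ 1 := by rw [hη]; linarith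
  set γ : ℝ := η / 32 with hγ
  have hγ0 : 0 < γ := by positivity
  have hγ1 : γ ≤ 1 / 32 := by rw [hγ]; linarith
  set θ : ℝ := η / (64 * (r - 1)) with hθ
  have hθ0 : 0 < θ := div_pos hη0 (by linarith)
  set lc : ℝ := Real.log (1 / γ) with hlc
  have hlc0 : 0 ≤ lc := Real.log_nonneg (by rw [le_div_iff₀ hγ0]; linarith)
  set E : ℝ := Real.exp (r + 1) with hE
  have hE0 : 0 < E := Real.exp_pos _
  set m : ℝ := ε / 8 with hm
  have hm0 : 0 < m := by positivity
  set B : ℝ := 2 * E / m + 1 with hB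
  have hB1 : 1 ≤ B := by
    have : 0 < 2 * E / m := by positivity
    rw [hB]; linarith
  set G : ℝ := β1 * (γ * m / 2) / 8 with hG
  have hG0 : 0 < G := by positivity
  filter_upwards [Filter.eventually_ge_atTop (2:ℝ), Filter.eventually_ge_atTop (8 / ε), Filter.eventually_ge_atTop (2 / (γ * m)),
    Filter.eventually_ge_atTop (2 * B), Filter.eventually_ge_atTop (4 * r * B ^ 2), Filter.eventually_ge_atTop (10 * r : ℝ),
    Filter.eventually_ge_atTop (4 * r * q / β : ℝ), Filter.eventually_ge_atTop (2 * q * q : ℝ),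
    Filter.eventually_ge_atTop (6 / (m * θ ^ (2 * (r - 1)))),
    Filter.eventually_ge_atTop (4 * (2 * r + 5 + 5 * r * (r + lc) + 5 * r * η / 2) / η),
    Filter.eventually_ge_atTop ((12 * (r:ℝ) ^ 2 + 1) / G), Filter.eventually_ge_atTop ((r:ℝ) ^ 2),
    Filter.eventually_ge_atTop (((r - 1 : ℕ):ℝ) * (q + (r - 1 : ℕ)) / δ)] with
    u u2 u3 u4 u5 u6 u7 u8 u9 u10 u11 u12 u13 u14
  intro l hlu hL pa pb hpa0 hpa1 hpb1 hpb hM2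
  have hu1 : (1:ℝ) ≤ u := by linarith
  have hu0 : 0 < u := by linarith
  have hul : u ≤ l := (le_self_pow₀ hu1 (by norm_num)).trans hlu
  have hl1 : (1:ℝ) ≤ l := by linarith
  have hl0 : (0:ℝ) < l := by linarith
  have hlN : 0 < l := by exact_mod_cast hl0
  have hrl : (l:ℝ) ≤ r * l := le_mul_of_one_le_left hl0.le (by linarith)
  have h4u : u ≤ u ^ 4 := le_self_pow₀ hu1 (by norm_num)
  obtain ⟨M1, M2, M3⟩ := num_M hε hε1 hu1 u3 hl1
  rw [← hm] at M1
  set M : ℕ := ⌊ε / 4 * u ^ 4 * l⌋₊ with hM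
  obtain ⟨g1, g2, g3⟩ := num_g hγ0 hm0 hu1 u4 hl1 M1
  set g : ℕ := ⌊γ * M⌋₊ with hg
  have hM0 : (0:ℝ) ≤ M := by positivity
  have hγM : γ * M ≤ 1 / 32 * M := mul_le_mul_of_nonneg_right hγ1 hM0
  have hgM : g ≤ M := by
    have : (g:ℝ) ≤ M := by linarith
    exact_mod_cast this
  have hlM : l ≤ M := by
    have : (l:ℝ) ≤ M := by linarith
    exact_mod_cast this
  have hi : m / 2 * u ^ 4 * l ≤ ((M - g : ℕ):ℝ) := by
    rw [Nat.cast_sub hgM]; linarith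
  have ht := num_t hE0 hm0 hu1 hlu hi
  have htle := Nat.le_ceil (E * (l:ℝ) ^ 2 / ((M - g : ℕ):ℝ))
  set t0 : ℕ := ⌈E * (l:ℝ) ^ 2 / ((M - g : ℕ):ℝ)⌉₊ with ht0
  have hd := num_d (M := M) hu1 hlu hM0 (by linarith)
  have hdle := Nat.le_ceil (2 * Real.sqrt (2 * M * ((l:ℝ) / u ^ 6)))
  set d : ℕ := ⌈2 * Real.sqrt (2 * M * ((l:ℝ) / u ^ 6))⌉₊ with hdd
  have hnR : ((r * l : ℕ):ℝ) = r * l := by push_cast; ring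
  have hq1 : 2 * q * q ≤ r * l := by
    have : (2 * q * q : ℝ) ≤ ((r * l : ℕ):ℝ) := by rw [hnR]; linarith
    exact_mod_cast this
  have hw1 : 1 ≤ (l:ℝ) / u := by rw [one_le_div hu0]; exact hul
  have hK2 : 2 * (r * d + r) ≤ l := by
    have : (2 * (r * d + r) : ℝ) ≤ l := by
      have a1 : (r:ℝ) * (d + 1) ≤ r * (5 * (l / u)) := mul_le_mul_of_nonneg_left (by linarith) (by linarith)
      have a2 : 10 * (r:ℝ) * (l / u) ≤ u * (l / u) := mul_le_mul_of_nonneg_right u7 (by positivity)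
      have a3 : u * ((l:ℝ) / u) = l := by field_simp
      linarith
    exact_mod_cast this
  have hθp : 0 < θ ^ (2 * (r - 1)) := by positivity
  have hθ2 : 6 * (l:ℝ) ≤ M * θ ^ (2 * (r - 1)) := by
    rw [div_le_iff₀ (by positivity)] at u10
    calc 6 * (l:ℝ) ≤ u * (m * θ ^ (2 * (r - 1))) * l := mul_le_mul_of_nonneg_right u10 hl0.le
      _ ≤ u ^ 4 * (m * θ ^ (2 * (r - 1))) * l := by gcongr
      _ = (m * u ^ 4 * l) * θ ^ (2 * (r - 1)) := by ring
      _ ≤ _ := mul_le_mul_of_nonneg_right M1 hθp.le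
  have hlog : Real.log l ≤ u ^ 4 := by rw [hL]; exact Real.log_le_log hl0 hrl
  have hnum := num_num (d := (d:ℝ)) hr3 hη0 hγ hγ hθ hlc0 hu1 u11 hlu hlog hd
  have hKβ : ((r:ℝ) * (r * d)) * (q : ℕ) ≤ β * ((r * l : ℕ):ℝ) := by
    rw [hnR]
    rw [div_le_iff₀ hβ0] at u8
    calc ((r:ℝ) * (r * d)) * q = r * r * q * d := by ring
      _ ≤ r * r * q * (4 * (l / u)) := mul_le_mul_of_nonneg_left hd (by positivity)
      _ = (4 * r * q) * (r * (l / u)) := by ring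
      _ ≤ (u * β) * (r * (l / u)) := mul_le_mul_of_nonneg_right u8 (by positivity)
      _ = _ := by field_simp
  have ht2 : 2 * t0 ≤ l := by
    have : (2 * t0 : ℝ) ≤ l := by
      have a1 : 2 * B * (l / u ^ 4) ≤ u ^ 4 * (l / u ^ 4) := mul_le_mul_of_nonneg_right (by linarith) (by positivity)
      have a2 : u ^ 4 * ((l:ℝ) / u ^ 4) = l := by field_simp
      linarith
    exact_mod_cast this
  have hx := num_x (by linarith) hB1 u2 u6 hlu (Nat.cast_nonneg t0) ht
  have hgG : G * u ^ 4 * l ≤ β1 * g / 8 := by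
    have := mul_le_mul_of_nonneg_left g1 (by positivity : 0 ≤ β1 / 8)
    rw [hG]; linarith
  have h3 := num_3 (M := M) (d := d) (by omega : 2 ≤ r) hG0 hu1 u12 hlu hL hd (by linarith) hgG
  set N : ℝ := ((r * l - 1).choose (r - 1) : ℝ) with hN
  have hrl' : r ≤ r * l := Nat.le_mul_of_pos_right r hlN
  have hN0 : 0 < N := by rw [hN]; exact_mod_cast Nat.choose_pos (by omega : r - 1 ≤ r * l - 1)
  have hpb0 : 0 ≤ pb := by rw [hpb]; positivity
  have hqr : q + (r - 1) ≤ r * l := by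
    have a1 : r - 1 ≤ q := Nat.le_mul_of_pos_left _ (by omega)
    have a2 : 1 ≤ q := Nat.mul_pos (by omega) (by omega)
    have a3 : q ≤ q * q := Nat.le_mul_of_pos_left _ a2
    have a4 : 2 * q * q = 2 * (q * q) := by ring
    omega
  have hcomp := choose_comp hqr (by omega : 0 < r * l) δ (by
    rw [div_le_iff₀ hδ0] at u14
    rw [hnR]
    refine u14.trans ?_
    rw [mul_comm]
    exact mul_le_mul_of_nonneg_left (hul.trans hrl) hδ0.le)
  have hf : Real.exp (-(pb * ((1 - δ) * ((r * l - q).choose (r - 1) : ℝ)))) ≤ Real.exp (-((1 + ε / 4) * u ^ 4)) := by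
    rw [Real.exp_le_exp, neg_le_neg_iff]
    have a1 : (1 - δ) * ((1 - δ) * N) ≤ (1 - δ) * ((r * l - q).choose (r - 1) : ℝ) :=
      mul_le_mul_of_nonneg_left hcomp (by linarith)
    refine le_trans ?_ (mul_le_mul_of_nonneg_left a1 hpb0)
    have a2 : pb * ((1 - δ) * ((1 - δ) * N)) = ((1 + ε / 2) * (1 - δ) ^ 2) * u ^ 4 := by
      rw [hpb]; field_simp
    rw [a2]
    refine mul_le_mul_of_nonneg_right ?_ (by positivity)
    have a3 : 1 - ε / 16 ≤ (1 - δ) ^ 2 := by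
      have : 0 ≤ δ ^ 2 := by positivity
      have e : (1 - δ) ^ 2 = 1 - 2 * δ + δ ^ 2 := by ring
      have e2 : 2 * δ = ε / 16 := by rw [hδ]; ring
      linarith
    have a4 := mul_le_mul_of_nonneg_left a3 (by linarith : 0 ≤ 1 + ε / 2)
    have a5 : ε * ε ≤ ε := mul_le_of_le_one_right hε.le hε1
    have a6 : (1 + ε / 2) * (1 - ε / 16) = 1 + 7 * ε / 16 - ε * ε / 32 := by ring
    linarith
  have hMp : 2 * (M:ℝ) ≤ ((r * l).choose r : ℝ) * pa := by linarith
  have hfin := assemble (M := M) (g := g) (t0 := t0) (d := d) hr (rfl : r * l = r * l) hlN δ β β1 η γ γ θ ((l:ℝ) / u ^ 6)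
    ((1 - δ) * ((r * l - q).choose (r - 1) : ℝ)) pb pa (Real.exp (-((1 + ε / 4) * u ^ 4))) (Real.exp (-u))
    hδ0 hδ1 hβ0 hβ1 (by rw [hβ]; linarith) hβ1e hβ11 hη hγ0 (by linarith) hγ0 (by linarith) hθ0 hq1 hK2 hlM hgM
    (by linarith) hθ2 hnum hKβ ht2 (le_trans (by
      refine div_le_div_of_nonneg_right ?_ (by positivity)
      refine mul_le_mul_of_nonneg_right ?_ (by positivity)
      linarith) htle) (by positivity) (by rw [hnR]; exact hx) hdle h3 le_rfl hpb0 hpb1 hf hpa0 hpa1 hMp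
  refine hfin.trans ?_
  have f1 : 4 / (((r * l).choose r : ℝ) * pa) ≤ 1 / u := by
    have b0 : 0 < ε / 2 * u ^ 4 * l := by positivity
    calc _ ≤ 4 / (ε / 2 * u ^ 4 * l) := div_le_div_of_nonneg_left (by norm_num) b0 hM2
      _ ≤ 1 / u := by
        rw [div_le_div_iff₀ b0 hu0]
        rw [div_le_iff₀ hε] at u3
        have b1 : 8 * u ≤ u * ε * u := mul_le_mul_of_nonneg_right u3 hu0.le
        have b2 : u * ε * u ≤ ε * u ^ 4 * l := by
          calc u * ε * u = ε * u ^ 2 * 1 := by ring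
            _ ≤ ε * u ^ 4 * l := by
              have := pow_le_pow_right₀ hu1 (by norm_num : 2 ≤ 4)
              gcongr
        linarith
  have f2 : ((r * l : ℕ):ℝ) * Real.exp (-((1 + ε / 4) * u ^ 4)) ≤ 1 / u := by
    have b0 : ((r * l : ℕ):ℝ) = Real.exp (u ^ 4) := by
      rw [hL, Real.exp_log (by positivity), hnR]
    rw [b0, ← Real.exp_add]
    refine le_trans ?_ (exp_neg_le_inv hu0)
    rw [Real.exp_le_exp]
    rw [div_le_iff₀ hε] at u3
    have b1 : 1 * u ≤ (ε / 4 * u) * u ^ 3 := by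
      have : u ≤ u ^ 3 := le_self_pow₀ hu1 (by norm_num)
      exact mul_le_mul (by linarith) this hu0.le (by positivity)
    have b2 : (ε / 4 * u) * u ^ 3 = ε / 4 * u ^ 4 := by ring
    linarith
  have f3 : Real.exp (-((l:ℝ) / u ^ 6)) ≤ 1 / u := by
    refine le_trans ?_ (exp_neg_le_inv hu0)
    rw [Real.exp_le_exp, neg_le_neg_iff, le_div_iff₀ (by positivity), ← pow_succ']
    exact (pow_le_pow_right₀ hu1 (by norm_num)).trans hlu
  have f4 := num_Q (M := (M:ℝ)) (by linarith : (1:ℝ) ≤ r) hu1 u13 hlu hM0 (by linarith)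
  have f5 := exp_neg_le_inv hu0
  rw [← hnR] at f4
  have f6 : 5 / u = 1 / u + (1 / u + 1 / u + 1 / u + 1 / u) := by ring
  rw [f6]
  exact add_le_add f1 (add_le_add (add_le_add (add_le_add f2 f3) f4) f5)

end MainNum

section Final

lemma main_event (r : ℕ) (hr : 3 ≤ r) :
    ∀ᶠ n : ℕ in Filter.atTop, Real.sqrt (Real.sqrt (Real.log n)) ^ 10 * r ≤ n := by
  have h1 : ∀ᶠ x : ℝ in Filter.atTop, Real.log x ^ 3 * r ≤ x := by
    have h := (Real.isLittleO_pow_log_id_atTop (n := 3)).bound (c := (1:ℝ) / r) (by positivity)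
    filter_upwards [h, Filter.eventually_ge_atTop (1:ℝ)] with x hx hx1
    have hr0 : (0:ℝ) < r := by exact_mod_cast (by omega : 0 < r)
    have h0 : 0 ≤ Real.log x := Real.log_nonneg hx1
    simp only [id, Real.norm_eq_abs] at hx
    rw [abs_of_nonneg (by positivity), abs_of_nonneg (by linarith)] at hx
    calc Real.log x ^ 3 * r ≤ 1 / r * x * r := mul_le_mul_of_nonneg_right hx hr0.le
      _ = x := by field_simp
  have h2 : ∀ᶠ x : ℝ in Filter.atTop, 1 ≤ Real.log x := Real.tendsto_log_atTop.eventually_ge_atTop 1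
  filter_upwards [tendsto_natCast_atTop_atTop.eventually h1, tendsto_natCast_atTop_atTop.eventually h2] with n hn hn2
  refine le_trans (mul_le_mul_of_nonneg_right ?_ (by positivity)) hn
  set u := Real.sqrt (Real.sqrt (Real.log n)) with hu
  have hu1 : 1 ≤ u := by
    rw [hu, Real.one_le_sqrt, Real.one_le_sqrt]; exact hn2
  have hu4 : u ^ 4 = Real.log n := by
    have : u ^ 4 = (u ^ 2) ^ 2 := by ring
    rw [this, hu, Real.sq_sqrt (Real.sqrt_nonneg _), Real.sq_sqrt (by linarith)]
  rw [← hu4, ← pow_mul]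
  exact pow_le_pow_right₀ hu1 (by norm_num)

lemma prob_compl {n r : ℕ} (p : ℝ) :
    ∑ H ∈ (Kn n r).powerset.filter (fun H => 0 < pmCount (Finset.range n) H),
      p ^ H.card * (1 - p) ^ ((Kn n r).card - H.card) =
    1 - Ew p (Kn n r) (fun H => if 0 < pmCount (Finset.range n) H then (0:ℝ) else 1) := by
  have h1 := Ew_const p (Kn n r) 1
  rw [eq_sub_iff_add_eq]
  refine Eq.trans ?_ h1
  unfold Ew
  rw [Finset.sum_filter, ← Finset.sum_add_distrib]
  refine Finset.sum_congr rfl fun H _ => ?_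
  by_cases hh : 0 < pmCount (Finset.range n) H <;> simp [hh]

theorem shamir_binomial' (r : ℕ) (hr : 3 ≤ r) (ε : ℝ) (hε : 0 < ε) (ρ : ℝ) (hρ : 0 < ρ) :
  ∃ n₀ : ℕ, ∀ n : ℕ, n₀ ≤ n → r ∣ n → ∀ p : ℝ, 0 ≤ p → p ≤ 1 →
   (1 + ε) * ((n - 1).choose (r - 1) : ℝ)⁻¹ * Real.log n < p →
   1 - ρ ≤ ∑ H ∈ (Kn n r).powerset.filter (fun H => 0 < pmCount (Finset.range n) H), p ^ H.card * (1 - p) ^ ((Kn n r).card - H.card) := by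
  set e : ℝ := min ε 1 with he
  have he0 : 0 < e := lt_min hε one_pos
  have he1 : e ≤ 1 := min_le_right _ _
  have heε : e ≤ ε := min_le_left _ _
  have hu : Filter.Tendsto (fun n : ℕ => Real.sqrt (Real.sqrt (Real.log n))) Filter.atTop Filter.atTop :=
    Real.tendsto_sqrt_atTop.comp (Real.tendsto_sqrt_atTop.comp (Real.tendsto_log_atTop.comp tendsto_natCast_atTop_atTop))
  have hev := (hu.eventually (main_num r hr e he0 he1)).and ((main_event r hr).and
    ((hu.eventually_ge_atTop (5 / ρ)).and (hu.eventually_ge_atTop 1)))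
  obtain ⟨n₀, hn₀⟩ := Filter.eventually_atTop.1 hev
  refine ⟨n₀, fun n hn hrn p hp0 hp1 hp => ?_⟩
  obtain ⟨h1, h2, h3, h4⟩ := hn₀ n hn
  obtain ⟨l, rfl⟩ := hrn
  set u := Real.sqrt (Real.sqrt (Real.log ((r * l : ℕ):ℝ))) with hud
  have hr0 : (0:ℝ) < r := by exact_mod_cast (by omega : 0 < r)
  have hlog : 0 ≤ Real.log ((r * l : ℕ):ℝ) := Real.log_natCast_nonneg _
  have hu4 : u ^ 4 = Real.log ((r * l : ℕ):ℝ) := by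
    have : u ^ 4 = (u ^ 2) ^ 2 := by ring
    rw [this, hud, Real.sq_sqrt (Real.sqrt_nonneg _), Real.sq_sqrt hlog]
  have hul : u ^ 10 ≤ (l:ℝ) := by
    push_cast at h2
    have : u ^ 10 * r ≤ l * r := by linarith
    exact le_of_mul_le_mul_right this hr0
  have hu0 : 0 < u := by linarith
  have hl1 : (1:ℝ) ≤ l := (one_le_pow₀ h4).trans hul
  have hl : 0 < l := by
    have : (0:ℝ) < l := by linarith
    exact_mod_cast this
  have hrl : r ≤ r * l := Nat.le_mul_of_pos_right r hl
  set N : ℝ := ((r * l - 1).choose (r - 1) : ℝ) with hN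
  have hN0 : 0 < N := by rw [hN]; exact_mod_cast Nat.choose_pos (by omega : r - 1 ≤ r * l - 1)
  rw [← hu4] at hp
  set pb : ℝ := (1 + e / 2) * u ^ 4 / N with hpb
  have hu40 : 0 < u ^ 4 / N := by positivity
  have hpe : (1 + e) * (u ^ 4 / N) < p := by
    refine lt_of_le_of_lt ?_ hp
    have : (1 + ε) * N⁻¹ * u ^ 4 = (1 + ε) * (u ^ 4 / N) := by rw [div_eq_mul_inv]; ring
    rw [this]
    exact mul_le_mul_of_nonneg_right (by linarith) hu40.le
  have hpb' : pb = (1 + e / 2) * (u ^ 4 / N) := by rw [hpb, mul_div_assoc]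
  have hdiff : e / 2 * (u ^ 4 / N) ≤ p - pb := by rw [hpb']; linarith
  have hd0 : 0 < e / 2 * (u ^ 4 / N) := by positivity
  have hpb1 : pb < 1 := by linarith
  have hpb0 : 0 ≤ pb := by positivity
  set pa : ℝ := (p - pb) / (1 - pb) with hpa
  have h1pb : 0 < 1 - pb := by linarith
  have hpa0 : 0 < pa := div_pos (by linarith) h1pb
  have hpa1 : pa ≤ 1 := by rw [hpa, div_le_one h1pb]; linarith
  have hpage : p - pb ≤ pa := by
    rw [hpa, le_div_iff₀ h1pb]
    have : 0 ≤ (p - pb) * pb := mul_nonneg (by linarith) hpb0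
    linarith
  have hcomb : 1 - (1 - pa) * (1 - pb) = p := by
    have : pa * (1 - pb) = p - pb := by rw [hpa]; field_simp
    linarith
  have hch := choose_eq_mul (r := r) (l := l) (by omega) hl
  have hbig : e / 2 * u ^ 4 * l ≤ ((r * l).choose r : ℝ) * pa := by
    rw [hch]
    calc e / 2 * u ^ 4 * l = l * N * (e / 2 * (u ^ 4 / N)) := by field_simp
      _ ≤ l * N * pa := mul_le_mul_of_nonneg_left (by linarith) (by positivity)
  have key := h1 l hul (by rw [hu4]; push_cast; ring) pa pb hpa0 hpa1 hpb1.le hpb hbig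
  rw [hcomb] at key
  rw [prob_compl]
  have : 5 / u ≤ ρ := by
    rw [div_le_iff₀ hρ] at h3
    rw [div_le_iff₀ hu0]; linarith
  have : Ew p (Kn (r * l) r) (fun H => if 0 < pmCount (Finset.range (r * l)) H then (0:ℝ) else 1) ≤ ρ := by
    refine le_trans (le_of_eq ?_) (key.trans this)
    congr!
  linarith

end Final

/-- **Shamir's problem, binomial model (Theorem 3).** For fixed `r ≥ 3` and `ε > 0`,
if `p > (1+ε)·C(n-1,r-1)⁻¹·log n` then `H^r_{n,p}` has a perfect matching w.h.p.
The probability that `H^r_{n,p}` has a perfect matching is expressed as the sum,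
over sets `H` of `r`-subsets of `[n]` admitting a perfect matching, of
`p^|H| (1-p)^{|K|-|H|}`. -/
theorem shamir_binomial (r : ℕ) (hr : 3 ≤ r) (ε : ℝ) (hε : 0 < ε)
    (ρ : ℝ) (hρ : 0 < ρ) :
    ∃ n₀ : ℕ, ∀ n : ℕ, n₀ ≤ n → r ∣ n → ∀ p : ℝ, 0 ≤ p → p ≤ 1 →
      (1 + ε) * ((n - 1).choose (r - 1) : ℝ)⁻¹ * Real.log n < p →
      1 - ρ ≤
        ∑ H ∈ (Kn n r).powerset.filter (fun H => 0 < pmCount (Finset.range n) H),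
          p ^ H.card * (1 - p) ^ ((Kn n r).card - H.card) := by
  exact shamir_binomial' r hr ε hε ρ hρ
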